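/- arXiv:1111.2002 — 5 statements merged into one kernel-verified Lean document; each statement's English description precedes it below -/
import Mathlib

section
/- Let K be an imaginary quadratic field. Every ideal class of K contains a prime ideal 𝔭 of residue degree one lying above a rational prime p that splits in K (i.e. pO_K = 𝔭 σ(𝔭) with 𝔭 ≠ σ(𝔭)). -/
open NumberField
open scoped nonZeroDivisors

section

open Filter Topology
open scoped ComplexOrder

namespace ArithmeticFunction

/-- Multiplication of the coefficients of an arithmetic function by `log n`. On `L`-series it is
the derivation `-d/ds`. -/
noncomputable def logTwist (f : ArithmeticFunction ℂ) : ArithmeticFunction ℂ :=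
  ⟨LSeries.logMul f, by simp [LSeries.logMul]⟩

lemma logTwist_apply (f : ArithmeticFunction ℂ) (n : ℕ) :
    f.logTwist n = Complex.log n * f n := rfl

lemma logTwist_one : (1 : ArithmeticFunction ℂ).logTwist = 0 := by
  ext n
  rcases eq_or_ne n 1 with rfl | hn <;> simp [logTwist_apply, one_apply_ne, *]

lemma logTwist_mul (f g : ArithmeticFunction ℂ) :
    (f * g).logTwist = f.logTwist * g + f * g.logTwist := by
  ext n
  simp only [logTwist_apply, add_apply, mul_apply, Finset.mul_sum, ← Finset.sum_add_distrib]
  refine Finset.sum_congr rfl fun x hx ↦ ?_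
  obtain ⟨hx, hn⟩ := Nat.mem_divisorsAntidiagonal.mp hx
  have h1 : x.1 ≠ 0 := by rintro h; simp [h] at hx; exact hn hx.symm
  have h2 : x.2 ≠ 0 := by rintro h; simp [h] at hx; exact hn hx.symm
  rw [← hx, ← Complex.natCast_log, ← Complex.natCast_log, ← Complex.natCast_log, Nat.cast_mul,
    Real.log_mul (by exact_mod_cast h1) (by exact_mod_cast h2)]
  push_cast
  ring

lemma logTwist_prod {ι : Type*} [DecidableEq ι] (S : Finset ι) (a b : ι → ArithmeticFunction ℂ)
    (h : ∀ i ∈ S, (a i).logTwist = b i * a i) :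
    (∏ i ∈ S, a i).logTwist = (∑ i ∈ S, b i) * ∏ i ∈ S, a i := by
  induction S using Finset.induction_on with
  | empty => simp [logTwist_one]
  | insert i S hi ih =>
    rw [Finset.prod_insert hi, Finset.sum_insert hi, logTwist_mul, h i (by simp),
      ih fun j hj ↦ h j (by simp [hj])]
    ring

/-- An arithmetic function with leading coefficient `1` and nonnegative logarithmic derivative
is nonnegative. -/
lemma nonneg_of_logTwist_eq_mul {a b : ArithmeticFunction ℂ} (ha : a 1 = 1) (hb : ∀ n, 0 ≤ b n)
    (h : a.logTwist = b * a) (n : ℕ) : 0 ≤ a n := by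
  induction n using Nat.strong_induction_on with
  | _ n ih =>
    have hb1 : b 1 = 0 := by
      have := congrArg (fun f : ArithmeticFunction ℂ ↦ f 1) h
      simpa [logTwist_apply, ha] using this.symm
    rcases Nat.lt_or_ge n 2 with hn | hn
    · interval_cases n <;> simp [ha]
    · have hlog : 0 < Real.log n := Real.log_pos (by exact_mod_cast hn)
      have h1 : (Real.log n : ℂ) * a n = (b * a) n := by
        rw [← h, logTwist_apply, Complex.natCast_log]
      have h2 : 0 ≤ (b * a) n := by
        rw [mul_apply]
        refine Finset.sum_nonneg fun x hx ↦ ?_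
        obtain ⟨hx, hn0⟩ := Nat.mem_divisorsAntidiagonal.mp hx
        rcases eq_or_ne x.1 1 with h1 | h1
        · simp [h1, hb1]
        · refine mul_nonneg (hb _) (ih _ ?_)
          rw [← hx]
          have : x.2 ≠ 0 := by rintro h; simp [h] at hx; exact hn0 hx.symm
          have : x.1 ≠ 0 := by rintro h; simp [h] at hx; exact hn0 hx.symm
          exact lt_mul_left (by omega) (by omega)
      have h3 : a n = ((Real.log n)⁻¹ : ℝ) * (b * a) n := by
        rw [← h1, ← mul_assoc, ← Complex.ofReal_mul, inv_mul_cancel₀ hlog.ne']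
        simp
      rw [h3]
      exact mul_nonneg (by exact_mod_cast (inv_pos.mpr hlog).le) h2

lemma prod_apply_one {ι : Type*} (S : Finset ι) (a : ι → ArithmeticFunction ℂ) :
    (∏ i ∈ S, a i) 1 = ∏ i ∈ S, a i 1 := by
  classical
  induction S using Finset.induction_on with
  | empty => simp
  | insert i S hi ih => simp [Finset.prod_insert hi, ih]

lemma LSeriesSummable_prod {ι : Type*} (S : Finset ι) (a : ι → ArithmeticFunction ℂ) {s : ℂ}
    (h : ∀ i ∈ S, LSeriesSummable (a i) s) :
    LSeriesSummable (∏ i ∈ S, a i : ArithmeticFunction ℂ) s := by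
  classical
  induction S using Finset.induction_on with
  | empty =>
    rw [Finset.prod_empty]
    change LSeriesSummable (fun n ↦ (1 : ArithmeticFunction ℂ) n) s
    rw [one_eq_delta]
    exact (hasSum_single 1 fun n hn ↦ by simp [LSeries.term, LSeries.delta, hn]).summable
  | insert i S hi ih =>
    rw [Finset.prod_insert hi]
    exact LSeriesSummable_mul (h i (by simp)) (ih fun j hj ↦ h j (by simp [hj]))

lemma LSeries_prod {ι : Type*} (S : Finset ι) (a : ι → ArithmeticFunction ℂ) {s : ℂ}
    (h : ∀ i ∈ S, LSeriesSummable (a i) s) :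
    LSeries (∏ i ∈ S, a i : ArithmeticFunction ℂ) s = ∏ i ∈ S, LSeries (a i) s := by
  classical
  induction S using Finset.induction_on with
  | empty => simp [one_eq_delta, LSeries_delta]
  | insert i S hi ih =>
    rw [Finset.prod_insert hi, Finset.prod_insert hi, LSeries_mul' (h i (by simp))
      (LSeriesSummable_prod S a fun j hj ↦ h j (by simp [hj])), ih fun j hj ↦ h j (by simp [hj])]

/-- If `b` is the logarithmic derivative of `a`, and the `L`-series of `a` times `(s - 1) ^ m`
extends analytically to a function nonvanishing at `1`, then `(s - 1) L(b, s) → m`. -/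
lemma tendsto_sub_one_mul_LSeries_logDeriv {a b : ArithmeticFunction ℂ}
    (h : a.logTwist = b * a) (ha : ∀ s : ℂ, 1 < s.re → LSeriesSummable a s)
    (hb : ∀ s : ℂ, 1 < s.re → LSeriesSummable b s) {H : ℂ → ℂ} (hH : Differentiable ℂ H)
    (hH1 : H 1 ≠ 0) (m : ℕ) (hHa : ∀ s : ℂ, 1 < s.re → H s = (s - 1) ^ m * LSeries a s) :
    Tendsto (fun s : ℝ ↦ ((s : ℂ) - 1) * LSeries b s) (𝓝[>] 1) (𝓝 m) := by
  have habs : LSeries.abscissaOfAbsConv a ≤ (1 : ℝ) :=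
    LSeries.abscissaOfAbsConv_le_of_forall_lt_LSeriesSummable fun y hy ↦ ha y (by simpa using hy)
  have hH' : Continuous (deriv H) := (hH.contDiff (n := 1)).continuous_deriv le_rfl
  have hcast : Tendsto (fun s : ℝ ↦ (s : ℂ)) (𝓝[>] 1) (𝓝 1) :=
    tendsto_nhdsWithin_of_tendsto_nhds (by simpa using Complex.continuous_ofReal.tendsto 1)
  have hne : ∀ᶠ s : ℝ in 𝓝[>] 1, H s ≠ 0 :=
    ((hH.continuous.tendsto 1).comp hcast).eventually_ne hH1
  have hlim : Tendsto (fun s : ℝ ↦ (m : ℂ) - ((s : ℂ) - 1) * deriv H s / H s) (𝓝[>] 1)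
      (𝓝 (m - (1 - 1) * deriv H 1 / H 1)) :=
    tendsto_const_nhds.sub (((hcast.sub tendsto_const_nhds).mul ((hH'.tendsto 1).comp hcast)).div
      ((hH.continuous.tendsto 1).comp hcast) hH1)
  simp only [sub_self, zero_mul, zero_div, sub_zero] at hlim
  refine hlim.congr' ?_
  filter_upwards [hne, self_mem_nhdsWithin] with s hs hs1
  have hs1 : 1 < s := hs1
  have hs1' : 1 < (s : ℂ).re := by simpa using hs1
  have hs0 : (s : ℂ) - 1 ≠ 0 := by
    rw [sub_ne_zero]; exact_mod_cast hs1.ne'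
  have hd := LSeries_hasDerivAt (f := a) (s := s) (habs.trans_lt (by exact_mod_cast hs1))
  have hlogmul : LSeries (LSeries.logMul a) s = LSeries b s * LSeries a s := by
    rw [← LSeries_mul' (hb _ hs1') (ha _ hs1'), ← h]
    rfl
  rw [hlogmul] at hd
  have hd2 : HasDerivAt (fun z : ℂ ↦ (z - 1) ^ m * LSeries a z)
      (m * (s - 1) ^ (m - 1) * LSeries a s + (s - 1) ^ m * -(LSeries b s * LSeries a s))
          (s : ℂ) := by
    have := (((hasDerivAt_id' (s : ℂ)).sub_const 1).fun_pow m).fun_mul hd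
    simpa only [mul_one] using this
  have hd3 : deriv H s =
      m * (s - 1) ^ (m - 1) * LSeries a s + (s - 1) ^ m * -(LSeries b s * LSeries a s) := by
    refine (hd2.congr_of_eventuallyEq ?_).deriv
    filter_upwards [(isOpen_lt continuous_const Complex.continuous_re).mem_nhds hs1'] with z hz
    exact hHa z hz
  have hHs := hHa s hs1'
  have hpow : ((s : ℂ) - 1) * (m * (s - 1) ^ (m - 1)) = m * (s - 1) ^ m := by
    rcases m with _ | m
    · simp
    · simp [pow_succ]; ring
  have : ((s : ℂ) - 1) * deriv H s = (m - (s - 1) * LSeries b s) * H s := by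
    rw [hd3, hHs]
    linear_combination LSeries a s * hpow
  rw [this]
  field_simp
  ring

end ArithmeticFunction

lemma Complex.exists_eq_sub_mul_of_differentiable {N : ℂ → ℂ} (hN : Differentiable ℂ N) {c : ℂ}
    (hc : N c = 0) : ∃ L : ℂ → ℂ, Differentiable ℂ L ∧ ∀ s, N s = (s - c) * L s := by
  refine ⟨dslope N c, ?_, fun s ↦ ?_⟩
  · rw [← differentiableOn_univ]
    exact (Complex.differentiableOn_dslope univ_mem).mpr hN.differentiableOn
  · have := sub_smul_dslope N c s
    simpa [hc] using this.symm

namespace ArithmeticFunction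

lemma finsetSum_apply {ι : Type*} (S : Finset ι) (f : ι → ArithmeticFunction ℂ) (n : ℕ) :
    (∑ i ∈ S, f i) n = ∑ i ∈ S, f i n := by
  induction S using Finset.cons_induction with
  | empty => simp
  | cons i S hi ih => rw [Finset.sum_cons, Finset.sum_cons, add_apply, ih]

section CharSum

variable {A : Type*} [AddCommGroup A] [Fintype A]

/-- The combination of a family of arithmetic functions indexed by a finite group with
coefficients the values of a character. -/
noncomputable def charSum (a : A → ArithmeticFunction ℂ) (ψ : AddChar A ℂ) :
    ArithmeticFunction ℂ := ∑ g, ψ g • a g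

lemma charSum_apply (a : A → ArithmeticFunction ℂ) (ψ : AddChar A ℂ) (n : ℕ) :
    charSum a ψ n = ∑ g, ψ g * a g n := by
  simp [charSum, finsetSum_apply]

lemma charSum_eq_sum (a : A → ArithmeticFunction ℂ) (ψ : AddChar A ℂ) :
    (charSum a ψ : ℕ → ℂ) = ∑ g, ψ g • (a g : ℕ → ℂ) := by
  ext n
  simp [charSum_apply]

lemma LSeriesSummable_charSum {a : A → ArithmeticFunction ℂ} {s : ℂ}
    (h : ∀ g, LSeriesSummable (a g) s) (ψ : AddChar A ℂ) : LSeriesSummable (charSum a ψ) s := by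
  rw [charSum_eq_sum]
  exact LSeriesSummable.sum fun g _ ↦ (h g).smul _

lemma LSeries_charSum {a : A → ArithmeticFunction ℂ} {s : ℂ}
    (h : ∀ g, LSeriesSummable (a g) s) (ψ : AddChar A ℂ) :
    LSeries (charSum a ψ) s = ∑ g, ψ g * LSeries (a g) s := by
  rw [charSum_eq_sum, LSeries_sum fun g _ ↦ (h g).smul _]
  simp [LSeries_smul]

lemma logTwist_charSum {a b : A → ArithmeticFunction ℂ}
    (h : ∀ g, (a g).logTwist = ∑ k, b k * a (g - k)) (ψ : AddChar A ℂ) :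
    (charSum a ψ).logTwist = charSum b ψ * charSum a ψ := by
  have h1 : (charSum a ψ).logTwist = ∑ g, ψ g • (a g).logTwist := by
    ext n
    have : (∑ g, ψ g • (a g).logTwist) n = ∑ g, ψ g * (a g).logTwist n :=
      charSum_apply (fun g ↦ (a g).logTwist) ψ n
    rw [this, logTwist_apply, charSum_apply, Finset.mul_sum]
    exact Finset.sum_congr rfl fun g _ ↦ by rw [logTwist_apply]; ring
  rw [h1, charSum, charSum, Finset.sum_mul_sum]
  simp only [h, Finset.smul_sum]
  rw [Finset.sum_comm]
  refine Finset.sum_congr rfl fun k _ ↦ ?_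
  refine Fintype.sum_equiv (Equiv.subRight k) _ _ fun g ↦ ?_
  rw [Equiv.subRight_apply, smul_mul_smul_comm, ← AddChar.map_add_eq_mul, add_sub_cancel]

/-- Orthogonality of characters, as inversion formula. -/
lemma sum_charSum (x : A → ℂ) (g : A) :
    ∑ ψ : AddChar A ℂ, ψ (-g) * ∑ k, ψ k * x k = Fintype.card A * x g := by
  classical
  simp only [Finset.mul_sum, ← mul_assoc, ← AddChar.map_add_eq_mul]
  rw [Finset.sum_comm]
  simp only [← Finset.sum_mul, AddChar.sum_apply_eq_ite, neg_add_eq_zero]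
  simp

/-- **Equidistribution from analytic continuation.** A family of Dirichlet series with nonnegative
coefficients indexed by a finite abelian group, whose logarithmic derivative is taken in the group
ring, with meromorphic continuations having the same simple pole at `1` and a common zero at
`-1`: then the logarithmic derivative is equidistributed at `1`. -/
theorem tendsto_sub_one_mul_LSeries_of_logTwist_eq_sum {a b : A → ArithmeticFunction ℂ}
    {G : A → ℂ → ℂ} {κ : ℂ} (hb : ∀ g n, 0 ≤ b g n) (ha1 : ∀ g, g ≠ 0 → a g 1 = 0)
    (ha0 : a 0 1 = 1)
    (hlog : ∀ g, (a g).logTwist = ∑ k, b k * a (g - k))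
    (has : ∀ g (s : ℂ), 1 < s.re → LSeriesSummable (a g) s)
    (hbs : ∀ g (s : ℂ), 1 < s.re → LSeriesSummable (b g) s)
    (hG : ∀ g, Differentiable ℂ (G g))
    (hGa : ∀ g (s : ℂ), 1 < s.re → G g s = (s - 1) * LSeries (a g) s)
    (hκ : κ ≠ 0) (hG1 : ∀ g, G g 1 = κ) (hGneg : ∀ g, G g (-1) = 0) (g : A) :
    Tendsto (fun s : ℝ ↦ ((s : ℂ) - 1) * LSeries (b g) s) (𝓝[>] 1)
      (𝓝 (1 / Fintype.card A)) := by
  classical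
  have hcard : (Fintype.card A : ℂ) ≠ 0 := by exact_mod_cast Fintype.card_ne_zero
  set N : AddChar A ℂ → ℂ → ℂ := fun ψ s ↦ ∑ g, ψ g * G g s with hN
  have hNd (ψ) : Differentiable ℂ (N ψ) :=
    Differentiable.fun_sum fun g _ ↦ (hG g).const_mul _
  have hNL (ψ) (s : ℂ) (hs : 1 < s.re) : N ψ s = (s - 1) * LSeries (charSum a ψ) s := by
    simp only [hN]
    rw [LSeries_charSum (fun g ↦ has g s hs), Finset.mul_sum]
    exact Finset.sum_congr rfl fun g _ ↦ by rw [hGa g s hs]; ring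
  have hN1 (ψ) : N ψ 1 = if ψ = 0 then Fintype.card A * κ else 0 := by
    simp only [hN, hG1, ← Finset.sum_mul, AddChar.sum_eq_ite]
    split_ifs <;> simp
  have hNneg (ψ) : N ψ (-1) = 0 := by simp [hN, hGneg]
  have has' (ψ) (s : ℂ) (hs : 1 < s.re) : LSeriesSummable (charSum a ψ) s :=
    LSeriesSummable_charSum (fun g ↦ has g s hs) ψ
  have hbs' (ψ) (s : ℂ) (hs : 1 < s.re) : LSeriesSummable (charSum b ψ) s :=
    LSeriesSummable_charSum (fun g ↦ hbs g s hs) ψ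
  have hex (ψ : AddChar A ℂ) : ∃ L : ℂ → ℂ, ψ ≠ 0 →
      Differentiable ℂ L ∧ ∀ s, N ψ s = (s - 1) * L s := by
    by_cases hψ : ψ = 0
    · exact ⟨0, fun h ↦ (h hψ).elim⟩
    · obtain ⟨L, hL⟩ := Complex.exists_eq_sub_mul_of_differentiable (hNd ψ) (c := 1)
        (by simp [hN1, hψ])
      exact ⟨L, fun _ ↦ hL⟩
  choose L hL using hex
  have hLL (ψ : AddChar A ℂ) (hψ : ψ ≠ 0) (s : ℂ) (hs : 1 < s.re) :
      L ψ s = LSeries (charSum a ψ) s := by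
    have h0 : s - 1 ≠ 0 := by
      rw [sub_ne_zero]; rintro rfl; simp at hs
    exact mul_left_cancel₀ h0 (((hL ψ hψ).2 s).symm.trans (hNL ψ s hs))
  have hnonvan (χ : AddChar A ℂ) (hχ : χ ≠ 0) : L χ 1 ≠ 0 := by
    intro hzero
    obtain ⟨M, hM, hLM⟩ := Complex.exists_eq_sub_mul_of_differentiable (hL χ hχ).1 hzero
    set P : ArithmeticFunction ℂ := ∏ ψ : AddChar A ℂ, charSum a ψ with hP
    have hP1 : P 1 = 1 := by
      rw [hP, prod_apply_one]
      refine Finset.prod_eq_one fun ψ _ ↦ ?_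
      rw [charSum_apply, Finset.sum_eq_single 0 (fun g _ hg ↦ by simp [ha1 g hg]) (by simp)]
      simp [ha0]
    have hPnonneg (n) : 0 ≤ P n := by
      refine nonneg_of_logTwist_eq_mul hP1 (b := ∑ ψ : AddChar A ℂ, charSum b ψ) (fun n ↦ ?_)
        (logTwist_prod _ _ _ fun ψ _ ↦ logTwist_charSum hlog ψ) n
      rw [finsetSum_apply]
      have h0 := sum_charSum (fun k ↦ b k n) 0
      simp only [neg_zero, AddChar.map_zero_eq_one, one_mul] at h0
      simp only [charSum_apply, h0]
      exact mul_nonneg (by exact_mod_cast Nat.zero_le _) (hb 0 n)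
    have hPs (s : ℂ) (hs : 1 < s.re) : LSeriesSummable P s :=
      LSeriesSummable_prod _ _ fun ψ _ ↦ has' ψ s hs
    have habs : LSeries.abscissaOfAbsConv P ≤ (1 : ℝ) :=
      LSeries.abscissaOfAbsConv_le_of_forall_lt_LSeriesSummable fun y hy ↦
        hPs y (by simpa using hy)
    set S : Finset (AddChar A ℂ) := (Finset.univ.erase 0).erase χ with hS
    have hd : Differentiable ℂ fun s ↦ N 0 s * (M s * ∏ ψ ∈ S, L ψ s) := by
      refine (hNd 0).fun_mul (hM.fun_mul (Differentiable.fun_finsetProd fun ψ hψ ↦ (hL ψ ?_).1))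
      simp [hS] at hψ
      exact hψ.2
    have heq : {s : ℂ | (1 : ℝ) < s.re}.EqOn (fun s ↦ N 0 s * (M s * ∏ ψ ∈ S, L ψ s))
        (LSeries P) := by
      intro s hs
      have hs : 1 < s.re := hs
      dsimp only
      rw [hP, LSeries_prod _ _ fun ψ _ ↦ has' ψ s hs,
        ← Finset.mul_prod_erase Finset.univ _ (Finset.mem_univ 0),
        ← Finset.mul_prod_erase (Finset.univ.erase 0) _
          (Finset.mem_erase.mpr ⟨hχ, Finset.mem_univ χ⟩),
        ← hLL χ hχ s hs, hLM, hNL 0 s hs]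
      rw [Finset.prod_congr rfl fun ψ hψ ↦ hLL ψ (by simp [hS] at hψ; exact hψ.2) s hs]
      ring
    have hpos := LSeries_positive_of_differentiable_of_eqOn (a := P) hPnonneg (by simp [hP1]) hd
      habs heq (-1)
    simp [hNneg] at hpos
  have hlim (ψ : AddChar A ℂ) :
      Tendsto (fun s : ℝ ↦ ((s : ℂ) - 1) * LSeries (charSum b ψ) s) (𝓝[>] 1)
        (𝓝 (if ψ = 0 then 1 else 0)) := by
    by_cases hψ : ψ = 0
    · have := tendsto_sub_one_mul_LSeries_logDeriv (logTwist_charSum hlog ψ) (has' ψ) (hbs' ψ)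
        (hNd ψ) (by simp [hN1, hψ, hκ]) 1 (by simpa using hNL ψ)
      simpa [hψ] using this
    · have := tendsto_sub_one_mul_LSeries_logDeriv (logTwist_charSum hlog ψ) (has' ψ) (hbs' ψ)
        (hL ψ hψ).1 (hnonvan ψ hψ) 0 (by simpa using hLL ψ hψ)
      simpa [hψ] using this
  have hsum := (tendsto_finsetSum Finset.univ fun ψ _ ↦
    (hlim ψ).const_mul (ψ (-g))).const_mul (Fintype.card A : ℂ)⁻¹
  have hval : (Fintype.card A : ℂ)⁻¹ * ∑ ψ : AddChar A ℂ, ψ (-g) * (if ψ = 0 then 1 else 0) =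
      1 / Fintype.card A := by simp
  rw [hval] at hsum
  refine hsum.congr' ?_
  filter_upwards [self_mem_nhdsWithin] with s hs
  have hs : 1 < (s : ℂ).re := by simpa using hs
  have := sum_charSum (fun k ↦ LSeries (b k) s) g
  simp only [← LSeries_charSum fun k ↦ hbs k s hs] at this
  rw [show ∑ ψ : AddChar A ℂ, ψ (-g) * (((s : ℂ) - 1) * LSeries (charSum b ψ) s) =
    ((s : ℂ) - 1) * ∑ ψ : AddChar A ℂ, ψ (-g) * LSeries (charSum b ψ) s by
      rw [Finset.mul_sum]; exact Finset.sum_congr rfl fun _ _ ↦ by ring, this]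
  field_simp

end CharSum

end ArithmeticFunction

section Theta

open HurwitzZeta Real

lemma hasSum_int_cosKernel_zero_sub_one {t : ℝ} (ht : 0 < t) :
    HasSum (fun n : ℤ ↦ if n = 0 then 0 else rexp (-π * n ^ 2 * t)) (cosKernel 0 t - 1) := by
  have := hasSum_int_cosKernel₀ 0 ht
  rw [← Complex.hasSum_ofReal]
  convert! this using 1
  · ext n
    split_ifs <;> simp
  · simp

lemma abs_cosKernel_sub_one_le (a : ℝ) {t : ℝ} (ht : 0 < t) :
    |cosKernel a t - 1| ≤ cosKernel 0 t - 1 := by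
  have h := (hasSum_int_cosKernel₀ a ht).norm_le_of_bounded
    (hasSum_int_cosKernel_zero_sub_one ht) fun n ↦ by
      split_ifs
      · simp
      · rw [norm_mul, Complex.norm_real, norm_eq_abs, abs_exp,
          show (2 * π * Complex.I * a * n : ℂ) = ((2 * π * a * n : ℝ) : ℂ) * Complex.I by
            push_cast; ring, Complex.norm_exp_ofReal_mul_I, one_mul]
  rw [← Complex.ofReal_one, ← Complex.ofReal_sub, Complex.norm_real] at h
  exact h

lemma cosKernel_zero_sub_one_nonneg {t : ℝ} (ht : 0 < t) : 0 ≤ cosKernel 0 t - 1 :=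
  (hasSum_int_cosKernel_zero_sub_one ht).nonneg fun n ↦ by split_ifs <;> positivity

lemma isBigO_cosKernel_zero_sub_one_rpow {c : ℝ} (hc : 0 < c) (r : ℝ) :
    (fun x ↦ cosKernel 0 (c * x) - 1) =O[atTop] (fun x : ℝ ↦ x ^ r) := by
  obtain ⟨p, hp, h⟩ := isBigO_atTop_cosKernel_sub 0
  have h1 := h.comp_tendsto (tendsto_id.const_mul_atTop hc)
  refine h1.trans ?_
  have h2 := (isLittleO_exp_neg_mul_rpow_atTop (a := p * c) (mul_pos hp hc) r).isBigO
  refine h2.congr_left fun x ↦ ?_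
  simp [mul_assoc]

/-- The theta series of a binary quadratic form. -/
noncomputable def binaryTheta (A B C t : ℝ) : ℝ :=
  ∑' p : ℤ × ℤ, rexp (-π * (A * p.1 ^ 2 + B * p.1 * p.2 + C * p.2 ^ 2) * t)

variable {A B C : ℝ}

lemma summable_binaryTheta_and_abs_sub_le (hC : 0 < C) (hD : 0 < 4 * A * C - B ^ 2) {t : ℝ}
    (ht : 0 < t) :
    Summable (fun p : ℤ × ℤ ↦ rexp (-π * (A * p.1 ^ 2 + B * p.1 * p.2 + C * p.2 ^ 2) * t)) ∧
    |binaryTheta A B C t - 2 / (t * √(4 * A * C - B ^ 2)) *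
        cosKernel 0 (4 * C / (4 * A * C - B ^ 2) * (1 / t))| ≤
      2 / (t * √(4 * A * C - B ^ 2)) * cosKernel 0 (4 * C / (4 * A * C - B ^ 2) * (1 / t)) *
        (cosKernel 0 (1 / C * (1 / t)) - 1) := by
  set D := 4 * A * C - B ^ 2 with hDdef
  set w := t * D / (4 * C) with hw
  have hw0 : 0 < w := by positivity
  have hu : 1 / C * (1 / t) = 1 / (t * C) := by field_simp
  have hw1 : 4 * C / D * (1 / t) = 1 / w := by rw [hw]; field_simp
  rw [hu, hw1]
  set k := 1 / (t * C) ^ (1 / 2 : ℝ) with hk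
  have hk0 : 0 < k := by positivity
  have hinner (x : ℤ) : HasSum
      (fun y : ℤ ↦ rexp (-π * (A * x ^ 2 + B * x * y + C * y ^ 2) * t))
      (rexp (-π * x ^ 2 * w) * (k * cosKernel (B * x / (2 * C) : ℝ) (1 / (t * C)))) := by
    have := (hasSum_int_evenKernel (B * x / (2 * C)) (t := t * C) (by positivity)).mul_left
      (rexp (-π * x ^ 2 * w))
    rw [evenKernel_functional_equation] at this
    refine this.congr_fun fun y ↦ ?_
    rw [← Real.exp_add]
    congr 1
    rw [hw, hDdef]
    field_simp
    ring
  have hout : HasSum (fun x : ℤ ↦ rexp (-π * x ^ 2 * w))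
      (1 / w ^ (1 / 2 : ℝ) * cosKernel 0 (1 / w)) := by
    have := hasSum_int_evenKernel 0 hw0
    simp only [add_zero, QuotientAddGroup.mk_zero] at this
    rwa [evenKernel_functional_equation] at this
  have hcos (x : ℤ) := abs_cosKernel_sub_one_le (B * x / (2 * C)) (t := 1 / (t * C)) (by positivity)
  have hE := cosKernel_zero_sub_one_nonneg (t := 1 / (t * C)) (by positivity)
  have hdiff : Summable fun x : ℤ ↦ rexp (-π * x ^ 2 * w) *
      (k * (cosKernel (B * x / (2 * C) : ℝ) (1 / (t * C)) - 1)) := by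
    refine Summable.of_norm_bounded
      (hout.summable.mul_right (k * (cosKernel 0 (1 / (t * C)) - 1))) fun x ↦ ?_
    rw [norm_mul, norm_mul, norm_eq_abs, norm_eq_abs, norm_eq_abs, abs_exp, abs_of_pos hk0]
    gcongr
    exact hcos x
  have hsum : Summable fun x : ℤ ↦ rexp (-π * x ^ 2 * w) *
      (k * cosKernel (B * x / (2 * C) : ℝ) (1 / (t * C))) := by
    refine (hdiff.add (hout.summable.mul_right k)).congr fun x ↦ ?_
    ring
  have hS : Summable (fun p : ℤ × ℤ ↦
      rexp (-π * (A * p.1 ^ 2 + B * p.1 * p.2 + C * p.2 ^ 2) * t)) := by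
    rw [summable_prod_of_nonneg fun p ↦ (Real.exp_pos _).le]
    refine ⟨fun x ↦ (hinner x).summable, ?_⟩
    simpa only [(hinner _).tsum_eq] using hsum
  refine ⟨hS, ?_⟩
  have hT : binaryTheta A B C t = ∑' x : ℤ, rexp (-π * x ^ 2 * w) *
      (k * cosKernel (B * x / (2 * C) : ℝ) (1 / (t * C))) := by
    rw [binaryTheta, hS.tsum_prod]
    simp only [(hinner _).tsum_eq]
  have hc : 2 / (t * √D) = k * (1 / w ^ (1 / 2 : ℝ)) := by
    rw [hk, hw, ← Real.sqrt_eq_rpow, ← Real.sqrt_eq_rpow, div_mul_div_comm, one_mul,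
      ← Real.sqrt_mul (by positivity),
      show t * C * (t * D / (4 * C)) = (t / 2) ^ 2 * D by field_simp; norm_num,
      Real.sqrt_mul (by positivity), Real.sqrt_sq (by positivity)]
    field_simp
  have hsub : binaryTheta A B C t - 2 / (t * √D) * cosKernel 0 (1 / w) =
      ∑' x : ℤ, rexp (-π * x ^ 2 * w) *
        (k * (cosKernel (B * x / (2 * C) : ℝ) (1 / (t * C)) - 1)) := by
    rw [hT, hc, mul_assoc, ← hout.tsum_eq, ← tsum_mul_left, ← hsum.tsum_sub
      (hout.summable.mul_left k)]
    refine tsum_congr fun x ↦ by ring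
  rw [hsub, hc]
  have hb := hdiff.hasSum.norm_le_of_bounded
    (hout.mul_right (k * (cosKernel 0 (1 / (t * C)) - 1))) fun x ↦ by
      rw [norm_mul, norm_mul, norm_eq_abs, norm_eq_abs, norm_eq_abs, abs_exp, abs_of_pos hk0]
      gcongr
      exact hcos x
  refine hb.trans (le_of_eq ?_)
  ring

lemma isBigO_binaryTheta_sub (hC : 0 < C) (hD : 0 < 4 * A * C - B ^ 2) (r : ℝ) :
    (fun x : ℝ ↦ binaryTheta A B C (1 / x) / x - 2 / √(4 * A * C - B ^ 2)) =O[atTop]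
      (fun x : ℝ ↦ x ^ r) := by
  set D := 4 * A * C - B ^ 2 with hDdef
  have hE1 := isBigO_cosKernel_zero_sub_one_rpow (c := 4 * C / D) (by positivity)
  have hE2 := isBigO_cosKernel_zero_sub_one_rpow (c := 1 / C) (by positivity) r
  have hE1' : (fun x ↦ cosKernel 0 (4 * C / D * x)) =O[atTop] (fun _ : ℝ ↦ (1 : ℝ)) := by
    have h := hE1 0
    simp only [rpow_zero] at h
    simpa using h.add (Asymptotics.isBigO_refl (fun _ : ℝ ↦ (1 : ℝ)) atTop)
  have hbound : (fun x : ℝ ↦ binaryTheta A B C (1 / x) / x - 2 / √D) =O[atTop]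
      (fun x ↦ ‖2 / √D * (cosKernel 0 (4 * C / D * x) * (cosKernel 0 (1 / C * x) - 1))‖ +
        ‖2 / √D * (cosKernel 0 (4 * C / D * x) - 1)‖) := by
    refine Asymptotics.IsBigO.of_bound 1 ?_
    filter_upwards [eventually_gt_atTop 0] with x hx
    have h := (summable_binaryTheta_and_abs_sub_le hC hD (t := 1 / x) (by positivity)).2
    rw [← hDdef, one_div_one_div] at h
    have h' := div_le_div_of_nonneg_right h hx.le
    rw [← abs_of_pos hx, ← abs_div, abs_of_pos hx, sub_div] at h'
    have e1 : 2 / (1 / x * √D) * cosKernel 0 (4 * C / D * x) / x =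
        2 / √D * cosKernel 0 (4 * C / D * x) := by field_simp
    have e2 : 2 / (1 / x * √D) * cosKernel 0 (4 * C / D * x) * (cosKernel 0 (1 / C * x) - 1) / x =
        2 / √D * (cosKernel 0 (4 * C / D * x) * (cosKernel 0 (1 / C * x) - 1)) := by field_simp
    rw [e1, e2] at h'
    rw [one_mul, norm_eq_abs, norm_of_nonneg (by positivity)]
    calc _ = |(binaryTheta A B C (1 / x) / x - 2 / √D * cosKernel 0 (4 * C / D * x)) +
          2 / √D * (cosKernel 0 (4 * C / D * x) - 1)| := by ring_nf
      _ ≤ _ := (abs_add_le _ _).trans (add_le_add (h'.trans (le_abs_self _)) le_rfl)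
  refine hbound.trans (Asymptotics.IsBigO.add ?_ ?_)
  · refine (Asymptotics.IsBigO.const_mul_left ?_ _).norm_left
    simpa using hE1'.mul hE2
  · exact ((hE1 r).const_mul_left _).norm_left

end Theta

section Continuation

open Set MeasureTheory Real

variable {a : ℕ → ℝ} {θ : ℝ → ℝ} {c : ℝ}

lemma continuousOn_of_hasSum_mul_exp (ha : ∀ n, 0 ≤ a n)
    (hθ : ∀ t, 0 < t → HasSum (fun n : ℕ ↦ a n * rexp (-π * n * t)) (θ t - 1)) :
    ContinuousOn θ (Ioi 0) := by
  have key (δ : ℝ) (hδ : 0 < δ) : ContinuousOn θ (Ici δ) := by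
    have : ContinuousOn (fun t ↦ ∑' n : ℕ, a n * rexp (-π * n * t)) (Ici δ) := by
      refine continuousOn_tsum (fun n ↦ by fun_prop) (hθ δ hδ).summable fun n t ht ↦ ?_
      have ht : δ ≤ t := ht
      rw [norm_eq_abs, abs_mul, abs_exp, abs_of_nonneg (ha n), neg_mul, neg_mul, neg_mul]
      have := ha n
      gcongr
    refine (this.add (continuousOn_const (c := (1 : ℝ)))).congr fun t ht ↦ ?_
    rw [Pi.add_apply, (hθ t (hδ.trans_le ht)).tsum_eq, sub_add_cancel]
  intro t ht
  have ht : 0 < t := ht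
  exact ((key (t / 2) (by positivity)).continuousAt (Ici_mem_nhds (by linarith))).continuousWithinAt

lemma isBigO_sub_one_of_hasSum_mul_exp (ha : ∀ n, 0 ≤ a n) (ha0 : a 0 = 0)
    (hθ : ∀ t, 0 < t → HasSum (fun n : ℕ ↦ a n * rexp (-π * n * t)) (θ t - 1)) (r : ℝ) :
    (fun x ↦ θ x - 1) =O[atTop] (fun x : ℝ ↦ x ^ r) := by
  have h2 := (isLittleO_exp_neg_mul_rpow_atTop (a := π) pi_pos r).isBigO
  refine Asymptotics.IsBigO.trans (Asymptotics.IsBigO.of_bound ((θ 1 - 1) * rexp π) ?_) h2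
  filter_upwards [eventually_ge_atTop 1] with t ht
  have h0 : 0 ≤ θ t - 1 :=
    (hθ t (by linarith)).nonneg fun n ↦ mul_nonneg (ha n) (exp_pos _).le
  rw [norm_of_nonneg h0, norm_of_nonneg (exp_pos _).le, mul_assoc]
  refine hasSum_le (fun n ↦ ?_) (hθ t (by linarith)) ((hθ 1 one_pos).mul_right _)
  rcases n.eq_zero_or_pos with rfl | hn
  · simp [ha0]
  · rw [mul_assoc (a n), ← Real.exp_add, ← Real.exp_add]
    refine mul_le_mul_of_nonneg_left (exp_le_exp.mpr ?_) (ha n)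
    have : (1 : ℝ) ≤ n := by exact_mod_cast hn
    nlinarith [mul_nonneg pi_pos.le (mul_nonneg (sub_nonneg.mpr this) (sub_nonneg.mpr ht))]

/-- A Dirichlet series whose theta function has the behaviour of that of a binary quadratic form
continues to the plane with a simple pole at `1` and vanishes at `-1`. -/
theorem exists_differentiable_eq_sub_one_mul_LSeries (ha : ∀ n, 0 ≤ a n) (ha0 : a 0 = 0)
    (hθ : ∀ t, 0 < t → HasSum (fun n : ℕ ↦ a n * rexp (-π * n * t)) (θ t - 1))
    (hc : ∀ r : ℝ, (fun x : ℝ ↦ θ (1 / x) / x - c) =O[atTop] (fun x : ℝ ↦ x ^ r))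
    (hsum : ∀ s : ℂ, 1 < s.re → LSeriesSummable (fun n ↦ (a n : ℂ)) s) :
    ∃ G : ℂ → ℂ, Differentiable ℂ G ∧
      (∀ s : ℂ, 1 < s.re → G s = (s - 1) * LSeries (fun n ↦ (a n : ℂ)) s) ∧ G (-1) = 0 := by
  have hcont := continuousOn_of_hasSum_mul_exp ha hθ
  obtain ⟨P, hPf, hPk, hPε, hPf₀, hPg₀⟩ : ∃ P : WeakFEPair ℂ, (P.f = fun t ↦ (θ t : ℂ)) ∧ P.k = 1 ∧
      P.ε = 1 ∧ P.f₀ = 1 ∧ P.g₀ = c :=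
    ⟨{
      f := fun t ↦ θ t
      g := fun t ↦ (θ (1 / t) / t : ℝ)
      k := 1
      ε := 1
      f₀ := 1
      g₀ := c
      hf_int := (Complex.continuous_ofReal.comp_continuousOn hcont).locallyIntegrableOn
        measurableSet_Ioi
      hg_int := by
        refine ContinuousOn.locallyIntegrableOn (Complex.continuous_ofReal.comp_continuousOn ?_)
          measurableSet_Ioi
        have h0 : ∀ x ∈ Ioi (0 : ℝ), x ≠ 0 := fun x hx ↦ ne_of_gt hx
        refine (hcont.comp (continuousOn_const.div continuousOn_id h0) fun x hx ↦ ?_).div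
          continuousOn_id h0
        exact one_div_pos.mpr (mem_Ioi.mp hx)
      hk := one_pos
      hε := one_ne_zero
      h_feq := fun x hx ↦ by
        have : (x : ℂ) ≠ 0 := by exact_mod_cast ne_of_gt hx
        simp
        field_simp
      hf_top := fun r ↦ by
        have := Complex.isBigO_ofReal_left.mpr (isBigO_sub_one_of_hasSum_mul_exp ha ha0 hθ r)
        simpa using this
      hg_top := fun r ↦ by
        have := Complex.isBigO_ofReal_left.mpr (hc r)
        simpa using this }, rfl, rfl, rfl, rfl, rfl⟩
  have hΛ (s : ℂ) (hs : 1 < s.re) :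
      P.Λ s = π ^ (-s) * Complex.Gamma s * LSeries (fun n ↦ (a n : ℂ)) s := by
    have h1 := (P.hasMellin (s := s) (by rwa [hPk])).2
    have hsum' : Summable fun n : ℕ ↦ ‖(a n : ℂ)‖ / (n : ℝ) ^ s.re := by
      refine (hsum s hs).norm.congr fun n ↦ ?_
      rw [LSeries.norm_term_eq]
      split_ifs with h
      · simp [h, ha0]
      · rfl
    have h2 := hasSum_mellin_pi_mul (a := fun n ↦ (a n : ℂ)) (q := fun n : ℕ ↦ (n : ℝ))
      (F := fun t ↦ (θ t : ℂ) - 1) (s := s) (fun n ↦ ?_) (by linarith) (fun t ht ↦ ?_) hsum'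
    · rw [← h1, hPf, hPf₀, ← h2.tsum_eq, LSeries, ← tsum_mul_left]
      refine tsum_congr fun n ↦ ?_
      rw [LSeries.term_def]
      split_ifs with h
      · simp [h, ha0]
      · simp [mul_div_assoc]
    · rcases n.eq_zero_or_pos with rfl | hn
      · exact Or.inl (by simp [ha0])
      · exact Or.inr (by exact_mod_cast hn)
    · have := Complex.hasSum_ofReal.mpr (hθ t ht)
      simpa using this
  have hπ : (π : ℂ) ≠ 0 := by exact_mod_cast pi_ne_zero
  refine ⟨fun s ↦ π ^ s * ((s - 1) * P.Λ₀ s * (Complex.Gamma s)⁻¹ -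
    (s - 1) * (Complex.Gamma (s + 1))⁻¹ + c * (Complex.Gamma s)⁻¹), ?_, fun s hs ↦ ?_, ?_⟩
  · have h1 : Differentiable ℂ fun s : ℂ ↦ (π : ℂ) ^ s := fun s ↦
      (differentiableAt_id.const_cpow (Or.inl hπ))
    have h2 := P.differentiable_Λ₀
    have h3 := Complex.differentiable_one_div_Gamma
    have h4 : Differentiable ℂ fun s : ℂ ↦ (Complex.Gamma (s + 1))⁻¹ :=
      h3.comp (differentiable_id.add_const 1)
    fun_prop
  · have hs0 : s ≠ 0 := by rintro rfl; simp at hs; linarith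
    have hs1 : 1 - s ≠ 0 := by rw [sub_ne_zero]; rintro rfl; simp at hs
    have hΓ : Complex.Gamma s ≠ 0 := Complex.Gamma_ne_zero_of_re_pos (by linarith)
    have hπs : (π : ℂ) ^ s ≠ 0 := by simp [hπ]
    have h := hΛ s hs
    dsimp only
    rw [P.Λ₀_eq, h, Complex.Gamma_add_one s hs0, hPk, hPε, hPf₀, hPg₀, Complex.cpow_neg]
    simp only [smul_eq_mul, Complex.ofReal_one]
    field_simp
    ring
  · have h1 : Complex.Gamma (-1) = 0 := by simpa using Complex.Gamma_neg_nat_eq_zero 1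
    simp [h1]

end Continuation

namespace NumberField

variable (K : Type*) [Field K] [NumberField K]

/-- The nonzero integral ideals of norm `n`. -/
noncomputable def normFiber (n : ℕ) : Finset (Ideal (𝓞 K))⁰ :=
  ((Ideal.finite_setOfPred_absNorm_eq n).preimage Subtype.coe_injective.injOn).toFinset

variable {K}

@[simp]
lemma mem_normFiber {n : ℕ} {I : (Ideal (𝓞 K))⁰} :
    I ∈ normFiber K n ↔ Ideal.absNorm (I : Ideal (𝓞 K)) = n := by
  simp [normFiber]

lemma normFiber_zero : normFiber K 0 = ∅ := by
  ext I
  simp [(Ideal.absNorm_pos_of_nonZeroDivisors I).ne']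

open Classical in
/-- The coefficients of the Dirichlet series `∑ w I / N(I) ^ s` over the ideals in a class. -/
noncomputable def classSum (w : (Ideal (𝓞 K))⁰ → ℝ) (C : Additive (ClassGroup (𝓞 K))) :
    ArithmeticFunction ℂ :=
  ⟨fun n ↦ ∑ I ∈ normFiber K n with Additive.ofMul (ClassGroup.mk0 I) = C, (w I : ℂ),
    by simp [normFiber_zero]⟩

open Classical in
lemma classSum_apply (w : (Ideal (𝓞 K))⁰ → ℝ) (C : Additive (ClassGroup (𝓞 K))) (n : ℕ) :
    classSum w C n =
      ∑ I ∈ normFiber K n, if Additive.ofMul (ClassGroup.mk0 I) = C then (w I : ℂ) else 0 := by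
  rw [← Finset.sum_filter]
  rfl

lemma finite_dvd (I : (Ideal (𝓞 K))⁰) : {J : (Ideal (𝓞 K))⁰ | J ∣ I}.Finite := by
  refine ((Finset.finite_toSet ((Nat.divisors (Ideal.absNorm (I : Ideal (𝓞 K)))).biUnion
    fun n ↦ normFiber K n))).subset fun J hJ ↦ ?_
  simp only [Finset.coe_biUnion, Set.mem_iUnion, Finset.mem_coe, mem_normFiber, exists_prop,
    exists_eq_right', Nat.mem_divisors]
  refine ⟨?_, (Ideal.absNorm_pos_of_nonZeroDivisors I).ne'⟩
  obtain ⟨L, hL⟩ := hJ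
  exact ⟨Ideal.absNorm (L : Ideal (𝓞 K)), by rw [hL, Submonoid.coe_mul, map_mul]⟩

lemma sum_classSum_mul_classSum_one (w : (Ideal (𝓞 K))⁰ → ℝ) (C : Additive (ClassGroup (𝓞 K))) :
    ∑ D, classSum w D * classSum 1 (C - D) =
      classSum (fun I ↦ ∑ J ∈ (finite_dvd I).toFinset, w J) C := by
  classical
  ext n
  rw [ArithmeticFunction.finsetSum_apply]
  simp only [ArithmeticFunction.mul_apply]
  rw [Finset.sum_comm]
  have h1 (x : ℕ × ℕ) : ∑ D, classSum w D x.1 * classSum 1 (C - D) x.2 =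
      ∑ J ∈ normFiber K x.1, ∑ L ∈ normFiber K x.2,
        if Additive.ofMul (ClassGroup.mk0 (J * L)) = C then (w J : ℂ) else 0 := by
    simp only [classSum_apply, Finset.sum_mul_sum]
    rw [Finset.sum_comm]
    refine Finset.sum_congr rfl fun J _ ↦ ?_
    rw [Finset.sum_comm]
    refine Finset.sum_congr rfl fun L _ ↦ ?_
    rw [Finset.sum_eq_single (Additive.ofMul (ClassGroup.mk0 J))]
    · simp [eq_sub_iff_add_eq']
    · intro D _ hD
      simp [hD.symm]
    · simp
  simp only [h1]
  rw [classSum_apply]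
  have h2 (I : (Ideal (𝓞 K))⁰) : (if Additive.ofMul (ClassGroup.mk0 I) = C then
      ((∑ J ∈ (finite_dvd I).toFinset, w J : ℝ) : ℂ) else 0) =
      ∑ J ∈ (finite_dvd I).toFinset,
        if Additive.ofMul (ClassGroup.mk0 I) = C then (w J : ℂ) else 0 := by
    split_ifs <;> simp
  simp only [h2]
  simp only [Finset.sum_sigma']
  refine Finset.sum_bij (fun x _ ↦ ⟨x.2.1 * x.2.2, x.2.1⟩) ?_ ?_ ?_ ?_
  · rintro ⟨⟨a, b⟩, J, L⟩ hx
    simp only [Finset.mem_sigma, Nat.mem_divisorsAntidiagonal, mem_normFiber] at hx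
    simp only [Finset.mem_sigma, mem_normFiber, Set.Finite.mem_toFinset, Set.mem_ofPred_eq,
      Submonoid.coe_mul, map_mul]
    exact ⟨by rw [hx.2.1, hx.2.2, hx.1.1], dvd_mul_right _ _⟩
  · rintro ⟨⟨a, b⟩, J, L⟩ hx ⟨⟨a', b'⟩, J', L'⟩ hx' h
    simp only [Finset.mem_sigma, Nat.mem_divisorsAntidiagonal, mem_normFiber] at hx hx'
    simp only [Sigma.mk.injEq, heq_eq_eq] at h
    obtain ⟨h, rfl⟩ := h
    obtain rfl := mul_left_cancel h
    obtain ⟨-, rfl, rfl⟩ := hx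
    obtain ⟨-, rfl, rfl⟩ := hx'
    rfl
  · rintro ⟨I, J⟩ hx
    simp only [Finset.mem_sigma, mem_normFiber, Set.Finite.mem_toFinset, Set.mem_ofPred_eq] at hx
    obtain ⟨rfl, L, rfl⟩ := hx
    refine ⟨⟨(Ideal.absNorm (J : Ideal (𝓞 K)), Ideal.absNorm (L : Ideal (𝓞 K))), J, L⟩, ?_, rfl⟩
    simp only [Finset.mem_sigma, Nat.mem_divisorsAntidiagonal, mem_normFiber, Submonoid.coe_mul,
      map_mul, and_self, and_true, true_and]
    exact mul_ne_zero (Ideal.absNorm_pos_of_nonZeroDivisors J).ne'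
      (Ideal.absNorm_pos_of_nonZeroDivisors L).ne'
  · rintro ⟨⟨a, b⟩, J, L⟩ hx
    rfl

lemma logTwist_classSum_one (C : Additive (ClassGroup (𝓞 K))) :
    (classSum 1 C).logTwist =
      classSum (fun I ↦ Real.log (Ideal.absNorm (I : Ideal (𝓞 K)))) C := by
  classical
  ext n
  rw [ArithmeticFunction.logTwist_apply, classSum_apply, classSum_apply, Finset.mul_sum]
  refine Finset.sum_congr rfl fun I hI ↦ ?_
  rw [mem_normFiber] at hI
  split_ifs <;> simp [hI]

open Classical in
/-- The von Mangoldt function on ideals: `log N(𝔮)` on powers of a prime `𝔮`, zero elsewhere. -/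
noncomputable def idealVonMangoldt (J : (Ideal (𝓞 K))⁰) : ℝ :=
  if h : IsPrimePow (J : Ideal (𝓞 K)) then Real.log (Ideal.absNorm h.choose) else 0

lemma idealVonMangoldt_of_eq_pow {J : (Ideal (𝓞 K))⁰} {q : Ideal (𝓞 K)} {k : ℕ} (hq : Prime q)
    (hk : 0 < k) (h : q ^ k = J) : idealVonMangoldt J = Real.log (Ideal.absNorm q) := by
  have hJ : IsPrimePow (J : Ideal (𝓞 K)) := ⟨q, k, hq, hk, h⟩
  obtain ⟨k', hq', hk', h'⟩ := hJ.choose_spec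
  rw [idealVonMangoldt, dif_pos hJ, eq_of_prime_pow_eq hq' hq hk' (h'.trans h.symm)]

lemma idealVonMangoldt_nonneg (J : (Ideal (𝓞 K))⁰) : 0 ≤ idealVonMangoldt J := by
  rw [idealVonMangoldt]
  split_ifs
  · exact Real.log_natCast_nonneg _
  · rfl

lemma sum_idealVonMangoldt (I : (Ideal (𝓞 K))⁰) :
    ∑ J ∈ (finite_dvd I).toFinset, idealVonMangoldt J =
      Real.log (Ideal.absNorm (I : Ideal (𝓞 K))) := by
  classical
  have hI0 : (I : Ideal (𝓞 K)) ≠ 0 := nonZeroDivisors.coe_ne_zero I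
  set F := UniqueFactorizationMonoid.normalizedFactors (I : Ideal (𝓞 K)) with hF
  have hlog : Real.log (Ideal.absNorm (I : Ideal (𝓞 K))) =
      ∑ q ∈ F.toFinset, ∑ _k ∈ Finset.range (F.count q), Real.log (Ideal.absNorm q) := by
    have h1 : F.prod = I := by
      rw [← associated_iff_eq]; exact UniqueFactorizationMonoid.prod_normalizedFactors hI0
    rw [← h1, Finset.prod_multiset_count, map_prod, Nat.cast_prod, Real.log_prod]
    · simp [Real.log_pow]
    · intro q hq
      have hq0 : q ≠ 0 := (UniqueFactorizationMonoid.prime_of_normalized_factor q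
        (by simpa using hq)).ne_zero
      simp only [map_pow, Nat.cast_pow]
      exact pow_ne_zero _ (by simpa [Ideal.absNorm_eq_zero_iff] using hq0)
  rw [hlog, Finset.sum_sigma']
  symm
  have hprime {q : Ideal (𝓞 K)} (hq : q ∈ F.toFinset) : Prime q :=
    UniqueFactorizationMonoid.prime_of_normalized_factor q (by simpa using hq)
  have hdvd {q : Ideal (𝓞 K)} (hq : Prime q) (k : ℕ) :
      q ^ (k + 1) ∣ I ↔ k < F.count q := by
    have := UniqueFactorizationMonoid.emultiplicity_eq_count_normalizedFactors hq.irreducible hI0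
    rw [pow_dvd_iff_le_emultiplicity, this, normalize_eq, ← hF, Nat.cast_le, Nat.succ_le_iff]
  refine Finset.sum_bij_ne_zero (fun x hx _ ↦ (⟨x.1 ^ (x.2 + 1), mem_nonZeroDivisors_of_ne_zero
    (pow_ne_zero _ (hprime (Finset.mem_sigma.mp hx).1).ne_zero)⟩ : (Ideal (𝓞 K))⁰)) ?_ ?_ ?_ ?_
  · rintro ⟨q, k⟩ hx -
    obtain ⟨hq, hk⟩ := Finset.mem_sigma.mp hx
    simp only [Set.Finite.mem_toFinset, Set.mem_ofPred_eq, nonZeroDivisors_dvd_iff_dvd_coe]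
    exact (hdvd (hprime hq) k).mpr (Finset.mem_range.mp hk)
  · rintro ⟨q, k⟩ hx - ⟨q', k'⟩ hx' - h
    have hq := hprime (Finset.mem_sigma.mp hx).1
    have hq' := hprime (Finset.mem_sigma.mp hx').1
    simp only [Subtype.mk.injEq] at h hq hq'
    obtain rfl := eq_of_prime_pow_eq hq hq' k.succ_pos h
    obtain rfl : k = k' := by
      simpa using pow_injective_of_not_isUnit hq.not_isUnit hq.ne_zero h
    rfl
  · intro J hJ hne
    rw [idealVonMangoldt] at hne
    obtain ⟨hJ', -⟩ := dite_ne_right_iff.mp hne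
    obtain ⟨q, k, hq, hk⟩ := (isPrimePow_iff_pow_succ _).mp hJ'
    simp only [Set.Finite.mem_toFinset, Set.mem_ofPred_eq, nonZeroDivisors_dvd_iff_dvd_coe,
      ← hk, hdvd hq] at hJ
    have hqF : q ∈ F.toFinset := by
      rw [Multiset.mem_toFinset, ← Multiset.count_pos]; omega
    refine ⟨⟨q, k⟩, Finset.mem_sigma.mpr ⟨hqF, Finset.mem_range.mpr hJ⟩, ?_, Subtype.ext hk⟩
    rwa [← idealVonMangoldt_of_eq_pow hq k.succ_pos hk, idealVonMangoldt]
  · rintro ⟨q, k⟩ hx -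
    exact (idealVonMangoldt_of_eq_pow (hprime (Finset.mem_sigma.mp hx).1) k.succ_pos rfl).symm

lemma classSum_nonneg {w : (Ideal (𝓞 K))⁰ → ℝ} (hw : ∀ I, 0 ≤ w I)
    (C : Additive (ClassGroup (𝓞 K))) (n : ℕ) : 0 ≤ classSum w C n := by
  classical
  rw [classSum_apply]
  exact Finset.sum_nonneg fun I _ ↦ by
    split_ifs
    · exact_mod_cast hw I
    · rfl

lemma classSum_le_classSum {w v : (Ideal (𝓞 K))⁰ → ℝ} (h : ∀ I, w I ≤ v I)
    (C : Additive (ClassGroup (𝓞 K))) (n : ℕ) : classSum w C n ≤ classSum v C n := by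
  classical
  rw [classSum_apply, classSum_apply]
  exact Finset.sum_le_sum fun I _ ↦ by
    split_ifs
    · exact_mod_cast h I
    · rfl

lemma logTwist_classSum_one_eq_sum (C : Additive (ClassGroup (𝓞 K))) :
    (classSum 1 C).logTwist = ∑ D, classSum idealVonMangoldt D * classSum 1 (C - D) := by
  rw [sum_classSum_mul_classSum_one, logTwist_classSum_one]
  simp only [sum_idealVonMangoldt]

open Classical in
lemma classSum_one_apply_one (C : Additive (ClassGroup (𝓞 K))) :
    classSum 1 C 1 = if C = 0 then 1 else 0 := by
  have : normFiber K 1 = {1} := by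
    ext I
    rw [mem_normFiber, Ideal.absNorm_eq_one_iff, Finset.mem_singleton, ← Ideal.one_eq_top,
      ← Submonoid.coe_one, Subtype.coe_inj]
  rw [classSum_apply, this, Finset.sum_singleton, map_one, ofMul_one]
  simp only [eq_comm (a := C), Pi.one_apply, Complex.ofReal_one]

lemma idealVonMangoldt_le (I : (Ideal (𝓞 K))⁰) :
    idealVonMangoldt I ≤ Real.log (Ideal.absNorm (I : Ideal (𝓞 K))) := by
  rw [← sum_idealVonMangoldt]
  exact Finset.single_le_sum (f := idealVonMangoldt) (fun J _ ↦ idealVonMangoldt_nonneg J) (by simp)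

open Classical in
/-- The number of ideals of norm `n` in a given class. -/
noncomputable def classCount (C : Additive (ClassGroup (𝓞 K))) (n : ℕ) : ℕ :=
  (normFiber K n |>.filter fun I ↦ Additive.ofMul (ClassGroup.mk0 I) = C).card

lemma classSum_one_eq (C : Additive (ClassGroup (𝓞 K))) :
    (classSum 1 C : ℕ → ℂ) = fun n ↦ ((classCount C n : ℝ) : ℂ) := by
  classical
  ext n
  rw [classSum_apply, ← Finset.sum_filter, classCount]
  simp

lemma sum_classCount (C : Additive (ClassGroup (𝓞 K))) (n : ℕ) :
    ∑ k ∈ Finset.Icc 1 n, classCount C k = Nat.card {I : (Ideal (𝓞 K))⁰ //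
      (Ideal.absNorm (I : Ideal (𝓞 K)) : ℝ) ≤ n ∧ ClassGroup.mk0 I = C.toMul} := by
  classical
  have h : ∀ I : (Ideal (𝓞 K))⁰, (I ∈ (Finset.Icc 1 n).biUnion fun k ↦ (normFiber K k).filter
      fun I ↦ Additive.ofMul (ClassGroup.mk0 I) = C) ↔
      ((Ideal.absNorm (I : Ideal (𝓞 K)) : ℝ) ≤ n ∧ ClassGroup.mk0 I = C.toMul) := by
    intro I
    have := Ideal.absNorm_pos_of_nonZeroDivisors I
    simp only [Finset.mem_biUnion, Finset.mem_Icc, Finset.mem_filter, mem_normFiber, Nat.cast_le]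
    constructor
    · rintro ⟨k, hk, rfl, rfl⟩
      exact ⟨hk.2, rfl⟩
    · rintro ⟨h1, h2⟩
      exact ⟨_, ⟨this, h1⟩, rfl, by rw [h2]; rfl⟩
  rw [Nat.subtype_card _ h, Finset.card_biUnion]
  · rfl
  · intro a _ b _ hab
    rw [Function.onFun, Finset.disjoint_left]
    simp only [Finset.mem_filter, mem_normFiber, not_and]
    rintro I ⟨rfl, -⟩ h
    exact (hab h).elim

variable (K) in
/-- The density of integral ideals, in each class. -/
lemma exists_tendsto_sum_classCount_div : ∃ κ : ℝ, 0 < κ ∧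
    ∀ C : Additive (ClassGroup (𝓞 K)), Tendsto (fun n : ℕ ↦
      (∑ k ∈ Finset.Icc 1 n, (classCount C k : ℝ)) / n) atTop (𝓝 κ) := by
  refine ⟨(2 ^ InfinitePlace.nrRealPlaces K * (2 * Real.pi) ^ InfinitePlace.nrComplexPlaces K *
    Units.regulator K) / (Units.torsionOrder K * √|discr K|), ?_, fun C ↦ ?_⟩
  · have := Units.regulator_pos K
    have := Units.torsionOrder_pos K
    have := NumberField.discr_ne_zero K
    positivity
  · have := (Ideal.tendsto_norm_le_and_mk_eq_div_atTop K C.toMul).comp tendsto_natCast_atTop_atTop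
    refine this.congr fun n ↦ ?_
    rw [← Nat.cast_sum, sum_classCount]
    rfl

lemma LSeriesSummable_classSum_one (C : Additive (ClassGroup (𝓞 K))) {s : ℂ} (hs : 1 < s.re) :
    LSeriesSummable (classSum 1 C) s := by
  obtain ⟨κ, -, h⟩ := exists_tendsto_sum_classCount_div K
  rw [classSum_one_eq]
  refine LSeriesSummable_of_sum_norm_bigO_and_nonneg (r := 1) ?_ (fun n ↦ Nat.cast_nonneg _)
    zero_le_one hs
  exact Asymptotics.isBigO_atTop_natCast_rpow_of_tendsto_div_rpow (a := κ) (by simpa using h C)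

variable (K) in
lemma exists_tendsto_sub_one_mul_LSeries_classSum_one : ∃ κ : ℂ, κ ≠ 0 ∧
    ∀ C : Additive (ClassGroup (𝓞 K)), Tendsto (fun s : ℝ ↦ (s - 1) * LSeries (classSum 1 C) s)
      (𝓝[>] 1) (𝓝 κ) := by
  obtain ⟨κ, hκ, h⟩ := exists_tendsto_sum_classCount_div K
  refine ⟨κ, by exact_mod_cast hκ.ne', fun C ↦ ?_⟩
  rw [classSum_one_eq]
  exact LSeries_tendsto_sub_mul_nhds_one_of_tendsto_sum_div_and_nonneg _ (h C)
    fun n ↦ Nat.cast_nonneg _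

lemma LSeriesSummable_classSum_idealVonMangoldt (C : Additive (ClassGroup (𝓞 K))) {s : ℂ}
    (hs : 1 < s.re) : LSeriesSummable (classSum idealVonMangoldt C) s := by
  have habs : LSeries.abscissaOfAbsConv (classSum 1 C) ≤ (1 : ℝ) :=
    LSeries.abscissaOfAbsConv_le_of_forall_lt_LSeriesSummable fun y hy ↦
      LSeriesSummable_classSum_one C (by simpa using hy)
  have h := LSeriesSummable_logMul_of_lt_re (habs.trans_lt (by exact_mod_cast hs))
  change LSeriesSummable (classSum 1 C).logTwist s at h
  rw [logTwist_classSum_one] at h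
  refine h.norm.of_norm_bounded fun n ↦ LSeries.norm_term_le s ?_
  exact CStarAlgebra.norm_le_norm_of_nonneg_of_le (classSum_nonneg idealVonMangoldt_nonneg C n)
    (classSum_le_classSum idealVonMangoldt_le C n)

/-- Elements of `J` of norm `n * N(J)` correspond, up to units, to ideals of norm `n` in the
inverse class of `J`. -/
lemma natCard_mem_and_absNorm_span_eq (J : (Ideal (𝓞 K))⁰) {n : ℕ} (hn : 0 < n) :
    Nat.card {x : 𝓞 K // x ∈ (J : Ideal (𝓞 K)) ∧
      Ideal.absNorm (Ideal.span {x}) = n * Ideal.absNorm (J : Ideal (𝓞 K))} =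
    Nat.card (𝓞 K)ˣ * classCount (Additive.ofMul (ClassGroup.mk0 J)⁻¹) n := by
  classical
  have hJ : (J : Ideal (𝓞 K)) ≠ 0 := nonZeroDivisors.coe_ne_zero J
  have hNJ : Ideal.absNorm (J : Ideal (𝓞 K)) ≠ 0 := by simpa [Ideal.absNorm_eq_zero_iff] using hJ
  have key : ∀ I : {I // I ∈ (normFiber K n).filter
      fun I ↦ Additive.ofMul (ClassGroup.mk0 I) = Additive.ofMul (ClassGroup.mk0 J)⁻¹},
      ∃ x : 𝓞 K, x ≠ 0 ∧ ((I : (Ideal (𝓞 K))⁰) : Ideal (𝓞 K)) * J = Ideal.span {x} := by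
    rintro ⟨I, hI⟩
    have h1 : ClassGroup.mk0 (I * J) = 1 := by
      have := (Finset.mem_filter.1 hI).2
      rw [map_mul, Additive.ofMul.injective this, inv_mul_cancel]
    obtain ⟨x, hx⟩ := (ClassGroup.mk0_eq_one_iff (I * J).2).1 h1
    refine ⟨x, ?_, hx⟩
    rintro rfl
    refine nonZeroDivisors.coe_ne_zero (I * J) ?_
    rw [hx]; simp
  choose g hg0 hg using key
  have hmem : ∀ I, g I ∈ (J : Ideal (𝓞 K)) := fun I ↦ by
    have : Ideal.span {g I} ≤ J := hg I ▸ Ideal.mul_le_right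
    exact this (Ideal.mem_span_singleton_self _)
  have hspan : ∀ (u : (𝓞 K)ˣ) (x : 𝓞 K), Ideal.span {(u : 𝓞 K) * x} = Ideal.span {x} := fun u x ↦
    Ideal.span_singleton_mul_left_unit u.isUnit x
  rw [classCount, ← Nat.card_eq_finsetCard, ← Nat.card_prod]
  symm
  refine Nat.card_eq_of_bijective (fun p ↦ ⟨p.1 * g p.2, Ideal.mul_mem_left _ _ (hmem _), ?_⟩)
    ⟨?_, ?_⟩
  · rw [hspan, ← hg, map_mul, mem_normFiber.1 (Finset.mem_filter.1 p.2.2).1]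
  · rintro ⟨u, I⟩ ⟨v, I'⟩ h
    have h : (u : 𝓞 K) * g I = v * g I' := congrArg Subtype.val h
    have hI : I = I' := by
      have h3 := congrArg (fun x ↦ Ideal.span {x}) h
      simp only [hspan, ← hg] at h3
      exact Subtype.ext (Subtype.ext (mul_right_cancel₀ hJ h3))
    subst hI
    rw [Prod.mk.injEq]
    exact ⟨Units.ext (mul_right_cancel₀ (hg0 I) h), rfl⟩
  · rintro ⟨x, hxJ, hx⟩
    obtain ⟨I, hI⟩ : (J : Ideal (𝓞 K)) ∣ Ideal.span {x} := by
      rwa [Ideal.dvd_span_singleton]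
    have hIn : Ideal.absNorm I = n := by
      rw [hI, map_mul, mul_comm] at hx
      exact Nat.eq_of_mul_eq_mul_right (Nat.pos_of_ne_zero hNJ) hx
    have hI0 : I ∈ (Ideal (𝓞 K))⁰ := by
      refine mem_nonZeroDivisors_of_ne_zero fun h ↦ hn.ne ?_
      rw [← hIn, h]; simp
    have hcl : ClassGroup.mk0 (⟨I, hI0⟩ : (Ideal (𝓞 K))⁰) = (ClassGroup.mk0 J)⁻¹ := by
      rw [eq_inv_iff_mul_eq_one, ← map_mul]
      refine (ClassGroup.mk0_eq_one_iff (_ * J).2).2 ⟨x, ?_⟩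
      rw [Submonoid.coe_mul, mul_comm]
      exact hI.symm
    let I' : {I // I ∈ (normFiber K n).filter
      fun I ↦ Additive.ofMul (ClassGroup.mk0 I) = Additive.ofMul (ClassGroup.mk0 J)⁻¹} :=
      ⟨⟨I, hI0⟩, Finset.mem_filter.2 ⟨mem_normFiber.2 hIn, by rw [hcl]⟩⟩
    have h4 : Ideal.span {g I'} = Ideal.span {x} := by
      rw [← hg, hI, mul_comm]
    obtain ⟨u, hu⟩ := Ideal.span_singleton_eq_span_singleton.1 h4
    exact ⟨(u, I'), Subtype.ext ((mul_comm _ _).trans hu)⟩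

lemma card_infinitePlace_eq_one (h2 : Module.finrank ℚ K = 2)
    (himag : ∀ v : InfinitePlace K, v.IsComplex) : Fintype.card (InfinitePlace K) = 1 := by
  have h1 := InfinitePlace.card_add_two_mul_card_eq_rank K
  have h3 := InfinitePlace.card_eq_nrRealPlaces_add_nrComplexPlaces K
  have h4 : InfinitePlace.nrRealPlaces K = 0 :=
    nrRealPlaces_eq_zero_iff.2 ⟨himag⟩
  lia

lemma finite_units_of_imaginary_quadratic (h2 : Module.finrank ℚ K = 2)
    (himag : ∀ v : InfinitePlace K, v.IsComplex) : Finite (𝓞 K)ˣ := by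
  have hrank : Units.rank K = 0 := by
    rw [Units.rank, card_infinitePlace_eq_one h2 himag]
  have : IsEmpty (Fin (Units.rank K)) := by rw [hrank]; infer_instance
  refine Finite.of_surjective (fun x : Units.torsion K ↦ (x : (𝓞 K)ˣ)) fun u ↦ ?_
  obtain ⟨⟨x, e⟩, hxu, -⟩ := Units.exist_unique_eq_mul_prod _ u
  exact ⟨x, by simp [hxu]⟩

lemma exists_absNorm_span_singleton_eq_norm_sq (h2 : Module.finrank ℚ K = 2)
    (himag : ∀ v : InfinitePlace K, v.IsComplex) : ∃ φ : K →+* ℂ, (∃ z, (φ z).im ≠ 0) ∧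
      ∀ x : 𝓞 K, (Ideal.absNorm (Ideal.span {x}) : ℝ) = ‖φ x‖ ^ 2 := by
  obtain ⟨v, hv⟩ := Fintype.card_eq_one_iff.1 (card_infinitePlace_eq_one h2 himag)
  refine ⟨v.embedding, ?_, fun x ↦ ?_⟩
  · by_contra! h
    refine InfinitePlace.isComplex_iff.1 (himag v) (RingHom.ext fun z ↦ ?_)
    exact Complex.conj_eq_iff_im.2 (h z)
  · have h1 := InfinitePlace.prod_eq_abs_norm (x : K)
    have : (Finset.univ : Finset (InfinitePlace K)) = {v} := by ext w; simp [hv w]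
    rw [this, Finset.prod_singleton, InfinitePlace.mult, if_neg
      (InfinitePlace.not_isReal_iff_isComplex.2 (himag v)), ← v.norm_embedding_eq] at h1
    rw [h1, Ideal.absNorm_span_singleton, ← Algebra.coe_norm_int]
    norm_cast
    simp

lemma exists_forall_hasSum_classCount_mul_exp (h2 : Module.finrank ℚ K = 2)
    (himag : ∀ v : InfinitePlace K, v.IsComplex) (D : Additive (ClassGroup (𝓞 K))) :
    ∃ A B C : ℝ, 0 < C ∧ 0 < 4 * A * C - B ^ 2 ∧ ∀ t : ℝ, 0 < t →
      HasSum (fun n : ℕ ↦ (Nat.card (𝓞 K)ˣ * classCount D n : ℝ) * Real.exp (-Real.pi * n * t))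
        (binaryTheta A B C t - 1) := by
  obtain ⟨J, hJD⟩ := ClassGroup.mk0_surjective D.toMul⁻¹
  have hD : D = Additive.ofMul (ClassGroup.mk0 J)⁻¹ := by rw [hJD, inv_inv]; rfl
  have hJ : (J : Ideal (𝓞 K)) ≠ 0 := nonZeroDivisors.coe_ne_zero J
  set N := Ideal.absNorm (J : Ideal (𝓞 K)) with hN
  have hNJ : 0 < N := Nat.pos_of_ne_zero (by simpa [hN, Ideal.absNorm_eq_zero_iff] using hJ)
  have hNR : (0 : ℝ) < N := by exact_mod_cast hNJ
  obtain ⟨φ, ⟨z, hz⟩, hφ⟩ := exists_absNorm_span_singleton_eq_norm_sq h2 himag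
  let b := Ideal.selfBasis (Module.finBasisOfFinrankEq ℤ (𝓞 K) ((RingOfIntegers.rank K).trans h2))
    (J : Ideal (𝓞 K)) hJ
  let e : ℤ × ℤ ≃ (J : Ideal (𝓞 K)) := (finTwoArrowEquiv ℤ).symm.trans b.equivFun.symm.toEquiv
  set β : Fin 2 → ℂ := fun i ↦ φ ((b i : 𝓞 K) : K) with hβ
  have he : ∀ p, φ ((e p : 𝓞 K) : K) = p.1 * β 0 + p.2 * β 1 := fun p ↦ by
    simp [e, hβ, Module.Basis.equivFun_symm_apply, Fin.sum_univ_two]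
  have hβ1 : β 1 ≠ 0 := by
    simpa [hβ] using b.ne_zero 1
  have him : (β 0 * (starRingEnd ℂ) (β 1)).im ≠ 0 := by
    intro h0
    have hreal : ∀ x : 𝓞 K, (φ x).im = 0 := fun x ↦ by
      obtain ⟨p, hp⟩ := e.surjective ⟨x * b 1, Ideal.mul_mem_left _ _ (b 1).2⟩
      have h1 := he p
      rw [hp] at h1
      simp only [map_mul] at h1
      change φ x * β 1 = _ at h1
      have h3 := congrArg (fun w ↦ (w * (starRingEnd ℂ) (β 1)).im) h1
      simp only [add_mul, mul_assoc, Complex.mul_conj, Complex.add_im] at h3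
      rw [← Complex.ofReal_intCast, ← Complex.ofReal_intCast, Complex.im_ofReal_mul, h0,
        ← Complex.ofReal_mul, Complex.ofReal_im, Complex.im_mul_ofReal] at h3
      simpa [hβ1] using h3
    obtain ⟨x, y, -, rfl⟩ := IsFractionRing.div_surjective (A := 𝓞 K) z
    refine hz ?_
    have hx := Complex.conj_eq_iff_im.2 (hreal x)
    have hy := Complex.conj_eq_iff_im.2 (hreal y)
    rw [map_div₀, ← Complex.conj_eq_iff_im, map_div₀]
    exact congrArg₂ _ hx hy
  choose ν hν using fun x : (J : Ideal (𝓞 K)) ↦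
    (Ideal.absNorm_dvd_absNorm_of_le ((Ideal.span_singleton_le_iff_mem _).2 x.2))
  have hq : ∀ p, Complex.normSq (β 0) / N * p.1 ^ 2 +
      2 * (β 0 * (starRingEnd ℂ) (β 1)).re / N * p.1 * p.2 +
      Complex.normSq (β 1) / N * p.2 ^ 2 = ν (e p) := fun p ↦ by
    have h1 := hφ (e p)
    rw [hν, he, ← Complex.normSq_eq_norm_sq, Nat.cast_mul] at h1
    rw [eq_comm, ← mul_right_inj' hNR.ne', h1]
    simp only [Complex.normSq_apply, Complex.mul_re, Complex.conj_re, Complex.conj_im,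
      Complex.add_re, Complex.add_im, Complex.mul_im, Complex.intCast_re, Complex.intCast_im]
    field_simp
    ring
  have hC : 0 < Complex.normSq (β 1) / N := div_pos (Complex.normSq_pos.2 hβ1) hNR
  have hdisc : 0 < 4 * (Complex.normSq (β 0) / N) * (Complex.normSq (β 1) / N) -
      (2 * (β 0 * (starRingEnd ℂ) (β 1)).re / N) ^ 2 := by
    have : 0 < (2 * (β 0 * (starRingEnd ℂ) (β 1)).im / N) ^ 2 := by positivity
    refine this.trans_eq ?_
    simp only [Complex.normSq_apply, Complex.mul_re, Complex.conj_re, Complex.conj_im,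
      Complex.mul_im]
    field_simp
    ring
  refine ⟨_, _, _, hC, hdisc, fun t ht ↦ ?_⟩
  have h1 := (summable_binaryTheta_and_abs_sub_le hC hdisc ht).1.hasSum
  rw [← binaryTheta] at h1
  simp_rw [hq] at h1
  have h3 := ((e.hasSum_iff (f := fun x ↦ Real.exp (-Real.pi * ν x * t))).1 h1).tsum_fiberwise ν
  have h4 := h3.sub (hasSum_ite_eq 0 (1 : ℝ))
  refine h4.congr_fun fun n ↦ ?_
  have h5 : ∑' x : ν ⁻¹' {n}, Real.exp (-Real.pi * ν x * t) =
      Nat.card (ν ⁻¹' {n}) * Real.exp (-Real.pi * n * t) := by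
    rw [tsum_congr fun x : ν ⁻¹' {n} ↦ by rw [show ν x = n from x.2], tsum_const, nsmul_eq_mul]
  rw [h5]
  rcases n.eq_zero_or_pos with rfl | hn
  · have : Nat.card (ν ⁻¹' {0}) = 1 := by
      rw [Nat.card_eq_one_iff_unique]
      refine ⟨⟨fun x y ↦ ?_⟩, ⟨⟨0, ?_⟩⟩⟩
      · have h6 : ∀ x : ν ⁻¹' {0}, x.1 = 0 := fun x ↦ by
          have h7 := hν x
          rw [show ν x = 0 from x.2, mul_zero, Ideal.absNorm_eq_zero_iff,
            Ideal.span_singleton_eq_bot] at h7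
          exact Subtype.ext h7
        exact Subtype.ext ((h6 x).trans (h6 y).symm)
      · have h7 := hν 0
        simpa [← hN, hNJ.ne'] using h7
    simp [this, classCount, normFiber_zero]
  · rw [if_neg hn.ne', sub_zero, hD, ← Nat.cast_mul, ← natCard_mem_and_absNorm_span_eq J hn]
    congr 2
    refine Nat.card_congr ⟨fun x ↦ ⟨⟨x.1, x.2.1⟩, ?_⟩, fun x ↦ ⟨x.1, x.1.2, ?_⟩, fun _ ↦ rfl,
      fun _ ↦ rfl⟩
    · have h7 := hν ⟨x.1, x.2.1⟩
      exact (Nat.eq_of_mul_eq_mul_left hNJ ((mul_comm _ _).trans (x.2.2.symm.trans h7))).symm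
    · rw [hν, show ν x.1 = n from x.2, mul_comm]

lemma exists_differentiable_eq_sub_one_mul_LSeries_classSum (h2 : Module.finrank ℚ K = 2)
    (himag : ∀ v : InfinitePlace K, v.IsComplex) (D : Additive (ClassGroup (𝓞 K))) :
    ∃ G : ℂ → ℂ, Differentiable ℂ G ∧
      (∀ s, 1 < s.re → G s = (s - 1) * LSeries (classSum 1 D) s) ∧ G (-1) = 0 := by
  obtain ⟨A, B, C, hC, hD, h⟩ := exists_forall_hasSum_classCount_mul_exp h2 himag D
  have := finite_units_of_imaginary_quadratic h2 himag
  have hw : (Nat.card (𝓞 K)ˣ : ℂ) ≠ 0 := by exact_mod_cast Nat.card_pos.ne'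
  have heq : (fun n : ℕ ↦ ((Nat.card (𝓞 K)ˣ * classCount D n : ℝ) : ℂ)) =
      (Nat.card (𝓞 K)ˣ : ℂ) • (classSum 1 D : ℕ → ℂ) := by
    ext n
    simp [classSum_one_eq]
  obtain ⟨G, hG, hGs, hG1⟩ := exists_differentiable_eq_sub_one_mul_LSeries
    (a := fun n ↦ Nat.card (𝓞 K)ˣ * classCount D n) (θ := binaryTheta A B C)
    (fun n ↦ by positivity) (by simp [classCount, normFiber_zero]) h (isBigO_binaryTheta_sub hC hD)
    (fun s hs ↦ by rw [heq]; exact (LSeriesSummable_classSum_one D hs).smul _)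
  refine ⟨fun s ↦ (Nat.card (𝓞 K)ˣ : ℂ)⁻¹ * G s, hG.const_mul _, fun s hs ↦ ?_, by simp [hG1]⟩
  simp only [hGs s hs, heq, LSeries_smul]
  field_simp

/-- The prime powers of an imaginary quadratic field, counted with von Mangoldt weights, are
equidistributed among the ideal classes. -/
lemma tendsto_sub_one_mul_LSeries_classSum_idealVonMangoldt (h2 : Module.finrank ℚ K = 2)
    (himag : ∀ v : InfinitePlace K, v.IsComplex) (D : Additive (ClassGroup (𝓞 K))) :
    Tendsto (fun s : ℝ ↦ ((s : ℂ) - 1) * LSeries (classSum idealVonMangoldt D) s) (𝓝[>] 1)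
      (𝓝 (1 / Fintype.card (Additive (ClassGroup (𝓞 K))))) := by
  choose G hG hGs hG1 using exists_differentiable_eq_sub_one_mul_LSeries_classSum h2 himag
  obtain ⟨κ, hκ, hlim⟩ := exists_tendsto_sub_one_mul_LSeries_classSum_one K
  refine ArithmeticFunction.tendsto_sub_one_mul_LSeries_of_logTwist_eq_sum
    (fun g n ↦ classSum_nonneg idealVonMangoldt_nonneg g n) (fun g hg ↦ ?_) ?_
    logTwist_classSum_one_eq_sum (fun g s hs ↦ LSeriesSummable_classSum_one g hs)
    (fun g s hs ↦ LSeriesSummable_classSum_idealVonMangoldt g hs) hG hGs hκ (fun g ↦ ?_) hG1 D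
  · rw [classSum_one_apply_one, if_neg hg]
  · rw [classSum_one_apply_one, if_pos rfl]
  · have h1 : Tendsto (fun s : ℝ ↦ G g s) (𝓝[>] 1) (𝓝 (G g 1)) := by
      have := ((hG g).continuous.comp Complex.continuous_ofReal).tendsto 1
      simpa [Function.comp_def] using this.mono_left nhdsWithin_le_nhds
    refine tendsto_nhds_unique h1 ((hlim g).congr' ?_)
    filter_upwards [self_mem_nhdsWithin] with s hs
    rw [hGs g s (by simpa using hs)]

end NumberField

lemma tendsto_sub_one_mul_LSeries_of_summable_div {f : ℕ → ℂ}
    (h : Summable fun n : ℕ ↦ ‖f n‖ / n) :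
    Tendsto (fun s : ℝ ↦ ((s : ℂ) - 1) * LSeries f s) (𝓝[>] 1) (𝓝 0) := by
  have hbd : ∀ s : ℝ, 1 < s → ‖LSeries f s‖ ≤ ∑' n : ℕ, ‖f n‖ / n := fun s hs ↦ by
    refine tsum_of_norm_bounded h.hasSum fun n ↦ ?_
    rw [LSeries.norm_term_eq]
    split_ifs with hn
    · positivity
    · have h1 : (1 : ℝ) ≤ n := by exact_mod_cast Nat.one_le_iff_ne_zero.2 hn
      rw [Complex.ofReal_re]
      gcongr
      exact Real.self_le_rpow_of_one_le h1 hs.le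
  have h0 : Tendsto (fun s : ℝ ↦ (s : ℂ) - 1) (𝓝[>] 1) (𝓝 0) := by
    have : Continuous fun s : ℝ ↦ (s : ℂ) - 1 := by fun_prop
    simpa using (this.tendsto 1).mono_left nhdsWithin_le_nhds
  refine h0.zero_mul_isBoundedUnder_le (isBoundedUnder_of_eventually_le
    (a := ∑' n : ℕ, ‖f n‖ / n) ?_)
  filter_upwards [self_mem_nhdsWithin] with s hs using hbd s hs

namespace NumberField

variable {K : Type*} [Field K] [NumberField K]

lemma absNorm_span_natCast (m : ℕ) :
    Ideal.absNorm (Ideal.span {(m : 𝓞 K)}) = m ^ Module.finrank ℚ K := by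
  have : Algebra.norm ℤ (m : 𝓞 K) = (m : ℤ) ^ Module.finrank ℚ K := by
    rw [← RingOfIntegers.rank K, Module.finrank_eq_card_basis (RingOfIntegers.basis K),
      ← Algebra.norm_algebraMap_of_basis (RingOfIntegers.basis K)]
    simp
  rw [Ideal.absNorm_span_singleton, this, Int.natAbs_pow, Int.natAbs_natCast]

lemma sum_normFiber_idealVonMangoldt_le (n : ℕ) :
    ∑ I ∈ normFiber K n, idealVonMangoldt I ≤
      Module.finrank ℚ K * ArithmeticFunction.vonMangoldt n := by
  classical
  let S : Finset (Ideal (𝓞 K))⁰ := (normFiber K n).filter fun I ↦ IsPrimePow (I : Ideal (𝓞 K))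
  have hsum : ∑ I ∈ normFiber K n, idealVonMangoldt I = ∑ I ∈ S, idealVonMangoldt I := by
    symm
    refine Finset.sum_filter_of_ne fun I _ h ↦ ?_
    by_contra h'
    exact h (by rw [idealVonMangoldt, dif_neg h'])
  rw [hsum]
  rcases S.eq_empty_or_nonempty with h0 | ⟨I₀, hI₀⟩
  · rw [h0, Finset.sum_empty]
    exact mul_nonneg (Nat.cast_nonneg _) ArithmeticFunction.vonMangoldt_nonneg
  have hdata : ∀ I ∈ S, ∃ q : Ideal (𝓞 K), ∃ k p : ℕ, Prime q ∧ 0 < k ∧ q ^ k = I ∧ p.Prime ∧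
      (p : 𝓞 K) ∈ q ∧ ∃ m, m ≠ 0 ∧ n = p ^ m := fun I hI ↦ by
    obtain ⟨hIn, q, k, hq, hk, hqk⟩ := Finset.mem_filter.1 hI
    have : q.IsPrime := Ideal.isPrime_of_prime hq
    have : q.IsMaximal := this.isMaximal hq.ne_zero
    obtain ⟨p, f, hf, hpq, hp, hN⟩ := Ideal.exists_prime_and_absNorm_eq_pow q
    refine ⟨q, k, p, hq, hk, hqk, hp, by simpa using hpq, f * k, (Nat.mul_pos hf hk).ne', ?_⟩
    rw [← mem_normFiber.1 hIn, ← hqk, map_pow, hN, pow_mul]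
  obtain ⟨-, -, p, -, -, -, hp, -, m, hm, hn⟩ := hdata I₀ hI₀
  have hdata' : ∀ I : (Ideal (𝓞 K))⁰, ∃ (q : (Ideal (𝓞 K))⁰) (k : ℕ), I ∈ S →
      Prime (q : Ideal (𝓞 K)) ∧ 0 < k ∧ (q : Ideal (𝓞 K)) ^ k = I ∧
        (p : 𝓞 K) ∈ (q : Ideal (𝓞 K)) := fun I ↦ by
    by_cases hI : I ∈ S
    · obtain ⟨q, k, p', hq, hk, hqk, hp', hpq, m', hm', hn'⟩ := hdata I hI
      obtain rfl : p = p' := (Nat.prime_dvd_prime_iff_eq hp hp').1 (hp.dvd_of_dvd_pow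
        (((dvd_pow_self p hm).trans hn.symm.dvd).trans hn'.dvd))
      exact ⟨⟨q, mem_nonZeroDivisors_of_ne_zero hq.ne_zero⟩, k, fun _ ↦ ⟨hq, hk, hqk, hpq⟩⟩
    · exact ⟨1, 0, fun h ↦ (hI h).elim⟩
  choose q k hqk using hdata'
  have hinj : Set.InjOn q S := fun I hI I' hI' h ↦ by
    obtain ⟨hq, -, h1, -⟩ := hqk I hI
    obtain ⟨-, -, h1', -⟩ := hqk I' hI'
    have h2 := mem_normFiber.1 (Finset.mem_filter.1 hI).1
    have h2' := mem_normFiber.1 (Finset.mem_filter.1 hI').1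
    rw [← h1, map_pow] at h2
    rw [← h1', ← h, map_pow, ← h2] at h2'
    have h3 : 1 < Ideal.absNorm (q I : Ideal (𝓞 K)) := by
      have h5 : Ideal.absNorm (q I : Ideal (𝓞 K)) ≠ 0 := by
        simpa [Ideal.absNorm_eq_zero_iff] using hq.ne_zero
      have h6 : Ideal.absNorm (q I : Ideal (𝓞 K)) ≠ 1 := by
        rw [Ne, Ideal.absNorm_eq_one_iff]
        exact (Ideal.isPrime_of_prime hq).ne_top
      lia
    have h4 := Nat.pow_right_injective h3 h2'
    exact Subtype.ext (by rw [← h1, ← h1', ← h, h4])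
  let P : (Ideal (𝓞 K))⁰ := ⟨Ideal.span {(p : 𝓞 K)}, mem_nonZeroDivisors_of_ne_zero
    (by simpa using hp.ne_zero)⟩
  calc ∑ I ∈ S, idealVonMangoldt I = ∑ I ∈ S, idealVonMangoldt (q I) :=
        Finset.sum_congr rfl fun I hI ↦ by
          obtain ⟨hq, hk, h1, -⟩ := hqk I hI
          rw [idealVonMangoldt_of_eq_pow hq hk h1,
            idealVonMangoldt_of_eq_pow hq one_pos (pow_one _)]
    _ = ∑ J ∈ S.image q, idealVonMangoldt J := (Finset.sum_image hinj).symm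
    _ ≤ ∑ J ∈ (finite_dvd P).toFinset, idealVonMangoldt J := by
        refine Finset.sum_le_sum_of_subset_of_nonneg (fun J hJ ↦ ?_) fun J _ _ ↦
          idealVonMangoldt_nonneg J
        obtain ⟨I, hI, rfl⟩ := Finset.mem_image.1 hJ
        simp only [Set.Finite.mem_toFinset, Set.mem_ofPred_eq, nonZeroDivisors_dvd_iff_dvd_coe]
        exact Ideal.dvd_span_singleton.2 (hqk I hI).2.2.2
    _ = Module.finrank ℚ K * ArithmeticFunction.vonMangoldt n := by
        rw [sum_idealVonMangoldt, hn, ArithmeticFunction.vonMangoldt_apply_pow hm,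
          ArithmeticFunction.vonMangoldt_apply_prime hp, absNorm_span_natCast, Nat.cast_pow,
          Real.log_pow]

lemma norm_classSum_idealVonMangoldt_le (D : Additive (ClassGroup (𝓞 K))) (n : ℕ) :
    ‖classSum idealVonMangoldt D n‖ ≤
      Module.finrank ℚ K * ArithmeticFunction.vonMangoldt n := by
  classical
  refine le_trans ?_ (sum_normFiber_idealVonMangoldt_le n)
  rw [classSum_apply]
  refine norm_sum_le_of_le _ fun I _ ↦ ?_
  split_ifs
  · exact (Complex.norm_of_nonneg (idealVonMangoldt_nonneg I)).le
  · simpa using idealVonMangoldt_nonneg I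

/-- Every ideal class of an imaginary quadratic field contains degree-one primes of arbitrarily
large norm. -/
lemma exists_mk0_eq_and_prime_absNorm_and_lt (h2 : Module.finrank ℚ K = 2)
    (himag : ∀ v : InfinitePlace K, v.IsComplex) (C : ClassGroup (𝓞 K)) (B : ℕ) :
    ∃ I : (Ideal (𝓞 K))⁰, ClassGroup.mk0 I = C ∧ (Ideal.absNorm (I : Ideal (𝓞 K))).Prime ∧
      B < Ideal.absNorm (I : Ideal (𝓞 K)) := by
  classical
  by_contra! h
  have h0 : ∀ n : ℕ, n.Prime → B < n → classSum idealVonMangoldt (Additive.ofMul C) n = 0 := by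
    intro n hn hB
    rw [classSum_apply]
    refine Finset.sum_eq_zero fun I hI ↦ if_neg fun hIC ↦ ?_
    have hIn := mem_normFiber.1 hI
    have := h I (Additive.ofMul.injective hIC) (hIn ▸ hn)
    lia
  have hsum : Summable fun n : ℕ ↦ ‖classSum idealVonMangoldt (Additive.ofMul C) n‖ / n := by
    have h1 := (ArithmeticFunction.vonMangoldt.summable_residueClass_non_primes_div
      (0 : ZMod 1)).mul_left (Module.finrank ℚ K : ℝ)
    rw [← summable_nat_add_iff (B + 1)] at h1 ⊢
    refine h1.of_nonneg_of_le (fun n ↦ by positivity) fun n ↦ ?_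
    by_cases hp : (n + (B + 1)).Prime
    · rw [h0 _ hp (by lia)]
      simp [hp]
    · rw [if_neg hp, ← mul_div_assoc, ArithmeticFunction.vonMangoldt.residueClass,
        Set.indicator_of_mem (Set.mem_ofPred_eq ▸ Subsingleton.elim _ _)]
      gcongr
      exact norm_classSum_idealVonMangoldt_le _ _
  have := tendsto_nhds_unique (tendsto_sub_one_mul_LSeries_of_summable_div hsum)
    (tendsto_sub_one_mul_LSeries_classSum_idealVonMangoldt h2 himag _)
  simp [eq_comm (a := (0 : ℂ))] at this

end NumberField

end

lemma exists_natCast_sub_mem_of_prime_absNorm {R : Type*} [CommRing R] [IsDedekindDomain R]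
    [Module.Free ℤ R] {I : Ideal R} (hI : (Ideal.absNorm I).Prime) (x : R) :
    ∃ n : ℕ, x - n ∈ I := by
  have hcard : Nat.card (R ⧸ I) = Ideal.absNorm I := rfl
  have : Finite (R ⧸ I) := Nat.finite_of_card_ne_zero (hcard ▸ hI.ne_zero)
  have := Fintype.ofFinite (R ⧸ I)
  have : NeZero (Ideal.absNorm I) := ⟨hI.ne_zero⟩
  obtain ⟨a, ha⟩ := (ZMod.ringEquivOfPrime (R ⧸ I) hI
    (Nat.card_eq_fintype_card.symm.trans hcard)).surjective (Ideal.Quotient.mk I x)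
  refine ⟨a.val, Ideal.Quotient.eq.1 ?_⟩
  rw [← ha, map_natCast, ← map_natCast (ZMod.ringEquivOfPrime (R ⧸ I) hI _), ZMod.natCast_zmod_val]

/-- In an imaginary quadratic field, every ideal class contains a degree-one prime `𝔭`
lying above a rational prime `p` that splits: `p𝓞 = 𝔭·σ(𝔭)` with `𝔭 ≠ σ(𝔭)`. -/
theorem stmt_2 (F : Type*) [Field F] [NumberField F]
    (h2 : Module.finrank ℚ F = 2)
    (himag : ∀ v : InfinitePlace F, v.IsComplex)
    (σ : F ≃ₐ[ℚ] F) (hσ : σ ≠ 1)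
    (C : ClassGroup (𝓞 F)) :
    ∃ (𝔭 : (Ideal (𝓞 F))⁰) (p : ℕ), p.Prime ∧ (𝔭 : Ideal (𝓞 F)).IsPrime ∧
      Ideal.absNorm (𝔭 : Ideal (𝓞 F)) = p ∧
      Ideal.span {(p : 𝓞 F)}
        = (𝔭 : Ideal (𝓞 F)) * Ideal.map (galRestrict ℤ ℚ F (𝓞 F) σ) (𝔭 : Ideal (𝓞 F)) ∧
      (𝔭 : Ideal (𝓞 F)) ≠ Ideal.map (galRestrict ℤ ℚ F (𝓞 F) σ) (𝔭 : Ideal (𝓞 F)) ∧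
      ClassGroup.mk0 𝔭 = C := by
  set τ := galRestrict ℤ ℚ F (𝓞 F) σ
  obtain ⟨x, hx⟩ : ∃ x : 𝓞 F, τ x ≠ x := by
    by_contra! h
    refine hσ ((galRestrict ℤ ℚ F (𝓞 F)).injective ?_)
    rw [map_one]
    exact AlgEquiv.ext h
  have hd : Ideal.absNorm (Ideal.span {τ x - x}) ≠ 0 := by
    simpa [Ideal.absNorm_eq_zero_iff, sub_eq_zero] using hx
  obtain ⟨𝔭, hC, hp, hlt⟩ := exists_mk0_eq_and_prime_absNorm_and_lt h2 himag C
    (Ideal.absNorm (Ideal.span {τ x - x}))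
  set p := Ideal.absNorm (𝔭 : Ideal (𝓞 F)) with hpdef
  have hprime : (𝔭 : Ideal (𝓞 F)).IsPrime := Ideal.isPrime_of_irreducible_absNorm hp
  have hmem : (p : 𝓞 F) ∈ (𝔭 : Ideal (𝓞 F)) := Ideal.absNorm_mem _
  have hne : (𝔭 : Ideal (𝓞 F)) ≠ Ideal.map τ (𝔭 : Ideal (𝓞 F)) := by
    intro h
    obtain ⟨n, hn⟩ := exists_natCast_sub_mem_of_prime_absNorm hp x
    have h1 : τ x - n ∈ (𝔭 : Ideal (𝓞 F)) := by
      have := Ideal.mem_map_of_mem τ hn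
      rwa [← h, map_sub, map_natCast] at this
    have h3 : τ x - x ∈ (𝔭 : Ideal (𝓞 F)) := by
      simpa using Ideal.sub_mem _ h1 hn
    exact hlt.not_ge (Nat.le_of_dvd (Nat.pos_of_ne_zero hd)
      (Ideal.absNorm_dvd_absNorm_of_le ((Ideal.span_singleton_le_iff_mem _).2 h3)))
  have hprime' : (Ideal.map τ (𝔭 : Ideal (𝓞 F))).IsPrime := Ideal.map_isPrime_of_equiv τ
  have hmem' : (p : 𝓞 F) ∈ Ideal.map τ (𝔭 : Ideal (𝓞 F)) := by
    simpa using Ideal.mem_map_of_mem τ hmem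
  have h𝔭0 : (𝔭 : Ideal (𝓞 F)) ≠ ⊥ := nonZeroDivisors.coe_ne_zero 𝔭
  have h𝔭0' : Ideal.map τ (𝔭 : Ideal (𝓞 F)) ≠ ⊥ := fun h ↦ by
    rw [h, Ideal.mem_bot, Nat.cast_eq_zero] at hmem'
    exact hp.ne_zero hmem'
  have hcop : IsCoprime (𝔭 : Ideal (𝓞 F)) (Ideal.map τ (𝔭 : Ideal (𝓞 F))) :=
    Ideal.isCoprime_iff_sup_eq.2 ((hprime.isMaximal h𝔭0).coprime_of_ne
      (hprime'.isMaximal h𝔭0') hne)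
  obtain ⟨I, hI⟩ := hcop.mul_dvd (Ideal.dvd_span_singleton.2 hmem)
    (Ideal.dvd_span_singleton.2 hmem')
  have hnorm : Ideal.absNorm (Ideal.map τ (𝔭 : Ideal (𝓞 F))) * Ideal.absNorm I = p := by
    have h3 := congrArg Ideal.absNorm hI
    rw [absNorm_span_natCast, h2, map_mul, map_mul, ← hpdef, sq, mul_assoc] at h3
    exact (Nat.eq_of_mul_eq_mul_left hp.pos h3).symm
  have hI1 : I = 1 := by
    rcases Nat.prime_mul_iff.1 (hnorm ▸ hp) with ⟨-, h⟩ | ⟨-, h⟩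
    · rw [Ideal.one_eq_top, ← Ideal.absNorm_eq_one_iff, h]
    · exact (hprime'.ne_top (Ideal.absNorm_eq_one_iff.1 h)).elim
  exact ⟨𝔭, p, hp, hprime, rfl, by rw [hI, hI1, mul_one], hne, hC⟩
end

section
/- Let O be the ring of integers of a number field K and I a nonzero ideal of O. The reduction map SL_n(O) → SL_n(O/I) is surjective for every n ≥ 1. -/
open NumberField

open Matrix

theorem IsArtinianRing.exists_isUnit_add_mul {S : Type*} [CommRing S] [IsArtinianRing S] {a b : S}
    (h : IsCoprime a b) : ∃ t, IsUnit (a + t * b) := by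
  classical
  obtain ⟨t, ht⟩ := Ideal.exists_forall_sub_mem_ideal
    (I := fun m : MaximalSpectrum S ↦ m.asIdeal)
    (fun m m' hne ↦ Ideal.isCoprime_of_isMaximal fun h ↦ hne (MaximalSpectrum.ext h))
    (fun m ↦ if a ∈ m.asIdeal then 1 else 0)
  refine ⟨t, not_not.mp fun hu ↦ ?_⟩
  obtain ⟨m, hm, hmem⟩ := exists_max_ideal_of_mem_nonunits hu
  have hs := ht ⟨m, hm⟩
  dsimp only at hs
  split_ifs at hs with ha
  · have hb : b ∈ m := by
      have := m.sub_mem (m.sub_mem hmem ha) (m.mul_mem_right b hs)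
      ring_nf at this
      exact this
    obtain ⟨c, d, hcd⟩ := h
    exact hm.ne_top ((Ideal.eq_top_iff_one m).mpr
      (hcd ▸ m.add_mem (m.mul_mem_left c ha) (m.mul_mem_left d hb)))
  · rw [sub_zero] at hs
    exact ha (by simpa using m.sub_mem hmem (m.mul_mem_right b hs))

namespace Matrix.SpecialLinearGroup

variable {R S : Type*} [CommRing R] [CommRing S]

/-- The matrix `1 + u vᵀ`, which has determinant one when `u` and `v` are orthogonal. -/
def oneAddVecMulVec {m : Type*} [Fintype m] [DecidableEq m] (u v : m → R) (h : v ⬝ᵥ u = 0) :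
    SpecialLinearGroup m R :=
  ⟨1 + vecMulVec u v, by
    rw [vecMulVec_eq Unit, det_one_add_replicateCol_mul_replicateRow, h, add_zero]⟩

theorem coe_oneAddVecMulVec {m : Type*} [Fintype m] [DecidableEq m] (u v : m → R)
    (h : v ⬝ᵥ u = 0) : (oneAddVecMulVec u v h : Matrix m m R) = 1 + vecMulVec u v :=
  rfl

theorem map_apply_apply {m : Type*} [Fintype m] [DecidableEq m] (f : R →+* S)
    (A : SpecialLinearGroup m R) (i j : m) : map f A i j = f (A i j) :=
  rfl

theorem oneAddVecMulVec_mul_apply {m : Type*} [Fintype m] [DecidableEq m] (u v : m → R)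
    (h : v ⬝ᵥ u = 0) (A : SpecialLinearGroup m R) (i j : m) :
    (oneAddVecMulVec u v h * A) i j = A i j + u i * ∑ k, v k * A k j := by
  simp [coe_oneAddVecMulVec, add_mul, vecMulVec_mul, vecMulVec_apply, vecMul, dotProduct]

variable {f : R →+* S} {n : ℕ}

theorem oneAddVecMulVec_mem_range_map (hf : Function.Surjective f) {u v : Fin (n + 1) → S}
    (h : v ⬝ᵥ u = 0) (huv : u = Pi.single 0 1 ∨ v = Pi.single 0 1) :
    oneAddVecMulVec u v h ∈ (map (n := Fin (n + 1)) f).range := by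
  obtain ⟨g, hg⟩ := hf.hasRightInverse
  obtain rfl | rfl := huv
  · refine ⟨oneAddVecMulVec (Pi.single 0 1) (Fin.cons 0 fun i ↦ g (v i.succ)) (by simp), ?_⟩
    have hv : v 0 = 0 := by simpa using h
    ext i j
    cases j using Fin.cases <;> cases i using Fin.cases <;>
      simp [map_apply_apply, coe_oneAddVecMulVec, vecMulVec_apply, one_apply, hv, hg _, apply_ite f]
  · refine ⟨oneAddVecMulVec (Fin.cons 0 fun i ↦ g (u i.succ)) (Pi.single 0 1) (by simp), ?_⟩
    have hu : u 0 = 0 := by simpa using h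
    ext i j
    cases j using Fin.cases <;> cases i using Fin.cases <;>
      simp [map_apply_apply, coe_oneAddVecMulVec, vecMulVec_apply, one_apply, hu, hg _, apply_ite f]

/-- Adding multiples of the other rows to the first row. -/
theorem exists_mem_range_map_mul_row_zero (hf : Function.Surjective f)
    (A : SpecialLinearGroup (Fin (n + 1)) S) (w : Fin n → S) :
    ∃ g ∈ (map (n := Fin (n + 1)) f).range,
      (g * A) 0 0 = A 0 0 + ∑ i, w i * A i.succ 0 ∧ ∀ i : Fin n, (g * A) i.succ 0 = A i.succ 0 :=
  ⟨oneAddVecMulVec (Pi.single 0 1) (Fin.cons 0 w) (by simp),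
    oneAddVecMulVec_mem_range_map hf _ (.inl rfl),
    by simp [oneAddVecMulVec_mul_apply, Fin.sum_univ_succ],
    fun i ↦ by simp [oneAddVecMulVec_mul_apply]⟩

/-- Adding multiples of the first row to the other rows. -/
theorem exists_mem_range_map_mul_row_succ (hf : Function.Surjective f)
    (A : SpecialLinearGroup (Fin (n + 1)) S) (w : Fin n → S) :
    ∃ g ∈ (map (n := Fin (n + 1)) f).range,
      (g * A) 0 0 = A 0 0 ∧ ∀ i : Fin n, (g * A) i.succ 0 = A i.succ 0 + w i * A 0 0 :=
  ⟨oneAddVecMulVec (Fin.cons 0 w) (Pi.single 0 1) (by simp),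
    oneAddVecMulVec_mem_range_map hf _ (.inr rfl),
    by simp [oneAddVecMulVec_mul_apply],
    fun i ↦ by simp [oneAddVecMulVec_mul_apply, Fin.sum_univ_succ]⟩

theorem exists_mem_range_map_mul_apply_zero_zero_eq_one [IsArtinianRing S]
    (hf : Function.Surjective f) (A : SpecialLinearGroup (Fin (n + 1)) S) :
    ∃ g ∈ (map (n := Fin (n + 1)) f).range, (g * A) 0 0 = 1 := by
  obtain _ | n := n
  · exact ⟨1, one_mem _, by simpa using A.det_coe⟩
  have hsum : ∑ i, A⁻¹ 0 i * A i 0 = 1 := by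
    have := congrArg (fun B : SpecialLinearGroup (Fin (n + 2)) S ↦ B 0 0) (inv_mul_cancel A)
    rwa [coe_mul, mul_apply, coe_one, one_apply_eq] at this
  rw [Fin.sum_univ_succ] at hsum
  obtain ⟨t, u, ht⟩ := IsArtinianRing.exists_isUnit_add_mul (a := A 0 0)
    (b := ∑ i : Fin (n + 1), A⁻¹ 0 i.succ * A i.succ 0) ⟨A⁻¹ 0 0, 1, by rw [one_mul, hsum]⟩
  obtain ⟨g₁, hg₁, h₁, -⟩ := exists_mem_range_map_mul_row_zero hf A fun i ↦ t * A⁻¹ 0 i.succ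
  simp only [mul_assoc, ← Finset.mul_sum, ← ht] at h₁
  obtain ⟨g₂, hg₂, h₂, h₂'⟩ := exists_mem_range_map_mul_row_succ hf (g₁ * A)
    fun i ↦ (1 - (g₁ * A) i.succ 0) * (u⁻¹ : Sˣ)
  obtain ⟨g₃, hg₃, h₃, -⟩ := exists_mem_range_map_mul_row_zero hf (g₂ * (g₁ * A))
    (Pi.single 0 (1 - u))
  refine ⟨g₃ * g₂ * g₁, mul_mem (mul_mem hg₃ hg₂) hg₁, ?_⟩
  rw [mul_assoc, mul_assoc, h₃, Finset.sum_eq_single 0 (by simp +contextual) (by simp), h₂', h₂, h₁]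
  simp

theorem map_surjective_of_isArtinianRing [IsArtinianRing S] (hf : Function.Surjective f) :
    Function.Surjective (map (n := Fin n) f) := by
  induction n with
  | zero => exact fun A ↦ ⟨1, Subsingleton.elim _ _⟩
  | succ n ih =>
    intro A
    obtain ⟨g₁, hg₁, h₁⟩ := exists_mem_range_map_mul_apply_zero_zero_eq_one hf A
    obtain ⟨g₂, hg₂, h₂, h₂'⟩ := exists_mem_range_map_mul_row_succ hf (g₁ * A)
      fun i ↦ -(g₁ * A) i.succ 0
    suffices hmem : g₂ * (g₁ * A) ∈ (map (n := Fin (n + 1)) f).range by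
      rwa [Subgroup.mul_mem_cancel_left _ hg₂, Subgroup.mul_mem_cancel_left _ hg₁] at hmem
    generalize g₂ * (g₁ * A) = B at h₂ h₂'
    simp only [h₁, mul_one, add_neg_cancel] at h₂ h₂'
    obtain ⟨C, hC⟩ := ih ⟨(B : Matrix _ _ S).submatrix Fin.succ Fin.succ, by
      have := B.det_coe
      rw [det_succ_column_zero, Fin.sum_univ_succ] at this
      simpa [h₂, h₂'] using this⟩
    obtain ⟨g, hg⟩ := hf.hasRightInverse
    let M : Matrix (Fin (n + 1)) (Fin (n + 1)) R :=
      of (Fin.cons (Fin.cons 1 fun j ↦ g (B 0 j.succ)) fun i ↦ Fin.cons 0 (C i))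
    have hM : M.det = 1 := by
      have : M.submatrix Fin.succ Fin.succ = C := by
        ext
        simp [M]
      rw [det_succ_column_zero, Fin.sum_univ_succ]
      simp [this, M]
    obtain ⟨D, hD⟩ : ∃ D : SpecialLinearGroup (Fin (n + 1)) R, (D : Matrix _ _ R) = M :=
      ⟨⟨M, hM⟩, rfl⟩
    refine ⟨D, SpecialLinearGroup.ext _ _ fun i j ↦ ?_⟩
    rw [map_apply_apply, hD]
    cases i using Fin.cases with
    | zero => cases j using Fin.cases <;> simp [M, h₂, hg _]
    | succ i =>
      cases j using Fin.cases with
      | zero => simp [M, h₂']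
      | succ j => simpa [M] using congrArg (fun D : SpecialLinearGroup (Fin n) S ↦ D i j) hC

end Matrix.SpecialLinearGroup

/-- Strong approximation: for a nonzero ideal `I` of the ring of integers of a number
field, the reduction map `SL_n(𝓞 F) → SL_n(𝓞 F / I)` is surjective. -/
theorem stmt_4 (F : Type*) [Field F] [NumberField F]
    (I : Ideal (𝓞 F)) (hI : I ≠ ⊥) (n : ℕ) (hn : 1 ≤ n) :
    Function.Surjective
      (Matrix.SpecialLinearGroup.map (n := Fin n) (Ideal.Quotient.mk I)) := by
  have : Finite (𝓞 F ⧸ I) := Ideal.finiteQuotientOfFreeOfNeBot I hI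
  exact Matrix.SpecialLinearGroup.map_surjective_of_isArtinianRing Ideal.Quotient.mk_surjective
end

section
/- Let p be an odd prime, E the unramified quadratic extension of ℚ_p with ring of integers R and conjugation x ↦ x̄, and let J = [[0,−I₂],[I₂,0]] ∈ M₄(E). Let U = {g ∈ GL₄(E) : g J g* = J} be the quasi-split unitary group and 𝒦 = U ∩ GL₄(R). Then the double coset 𝒦 · diag(1,1,p,p) · 𝒦 is a disjoint union of exactly (p+1)(p³+1) = p⁴ + p³ + p + 1 left 𝒦-cosets. -/
open Matrix
open scoped Pointwise

namespace HermitianHecke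

section Ring

variable {A : Type*} [CommRing A] [StarRing A]

/-- The skew-Hermitian pairing `r J s*` on row vectors, `J = [[0,-I₂],[I₂,0]]`. -/
def pairing (r s : Fin 4 → A) : A :=
  r 2 * star (s 0) + r 3 * star (s 1) - r 0 * star (s 2) - r 1 * star (s 3)

variable (A) in
/-- The matrix `[[0,-I₂],[I₂,0]]`. -/
def skewForm : Matrix (Fin 4) (Fin 4) A :=
  !![0, 0, -1, 0; 0, 0, 0, -1; 1, 0, 0, 0; 0, 1, 0, 0]

lemma mul_skewForm_mul_apply (g t : Matrix (Fin 4) (Fin 4) A) (i j : Fin 4) :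
    (g * skewForm A * tᴴ) i j = pairing (g i) (t j) := by
  simp [Matrix.mul_apply, Fin.sum_univ_four, skewForm, pairing]
  ring

omit [StarRing A] in
lemma skewForm_mul_self : skewForm A * skewForm A = -1 := by
  ext i j
  fin_cases i <;> fin_cases j <;> simp [skewForm, Matrix.mul_apply, Fin.sum_univ_four]

lemma skewForm_conjTranspose : (skewForm A)ᴴ = -skewForm A := by
  ext i j
  fin_cases i <;> fin_cases j <;> simp [skewForm]

/-- The matrices `g` with `g J g* = q J`. -/
def similitudes (q : A) : Set (Matrix (Fin 4) (Fin 4) A) :=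
  {g | g * skewForm A * gᴴ = q • skewForm A}

lemma mem_similitudes {q : A} {g : Matrix (Fin 4) (Fin 4) A} :
    g ∈ similitudes q ↔ g * skewForm A * gᴴ = q • skewForm A := Iff.rfl

lemma mul_mem_similitudes {q r : A} {g h : Matrix (Fin 4) (Fin 4) A}
    (hg : g ∈ similitudes q) (hh : h ∈ similitudes r) : g * h ∈ similitudes (r * q) := by
  rw [mem_similitudes] at *
  calc g * h * skewForm A * (g * h)ᴴ = g * (h * skewForm A * hᴴ) * gᴴ := by
        simp only [conjTranspose_mul, Matrix.mul_assoc]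
    _ = _ := by
        rw [hh, Matrix.mul_smul, Matrix.smul_mul, hg, smul_smul]

/-- The first kind of coset representatives, with `b = b*` and `d = d*`. -/
def repA (q b d c : A) : Matrix (Fin 4) (Fin 4) A :=
  !![1, 0, b, c; 0, 1, star c, d; 0, 0, q, 0; 0, 0, 0, q]

/-- The second kind of coset representatives, with `e = e*`. -/
def repB (q e : A) : Matrix (Fin 4) (Fin 4) A :=
  !![q, 0, 0, 0; 0, 1, 0, e; 0, 0, 1, 0; 0, 0, 0, q]

/-- The third kind of coset representatives, with `b = b*`. -/
def repC (q a b : A) : Matrix (Fin 4) (Fin 4) A :=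
  !![1, a, b, 0; 0, q, 0, 0; 0, 0, q, 0; 0, 0, -star a, 1]

/-- The last coset representative. -/
def repD (q : A) : Matrix (Fin 4) (Fin 4) A :=
  !![q, 0, 0, 0; 0, q, 0, 0; 0, 0, 1, 0; 0, 0, 0, 1]

/-- The exchange of the first and third coordinates, with signs, unitary if `s s* = 1`. -/
def swapFst (s : A) : Matrix (Fin 4) (Fin 4) A :=
  !![0, 0, -s, 0; 0, 1, 0, 0; s, 0, 0, 0; 0, 0, 0, 1]

/-- The exchange of the second and fourth coordinates, with signs, unitary if `s s* = 1`. -/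
def swapSnd (s : A) : Matrix (Fin 4) (Fin 4) A :=
  !![1, 0, 0, 0; 0, 0, 0, -s; 0, 0, 1, 0; 0, s, 0, 0]

lemma swapFst_mem {s : A} (hs : s * star s = 1) : swapFst s ∈ similitudes 1 := by
  rw [mem_similitudes]
  ext i j
  rw [mul_skewForm_mul_apply]
  fin_cases i <;> fin_cases j <;> simp [swapFst, pairing, skewForm, hs]

lemma swapSnd_mem {s : A} (hs : s * star s = 1) : swapSnd s ∈ similitudes 1 := by
  rw [mem_similitudes]
  ext i j
  rw [mul_skewForm_mul_apply]
  fin_cases i <;> fin_cases j <;> simp [swapSnd, pairing, skewForm, hs]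

lemma diagonal_mem {q : A} (hq : star q = q) :
    diagonal ![1, 1, q, q] ∈ similitudes q := by
  rw [mem_similitudes]
  ext i j
  rw [mul_skewForm_mul_apply]
  fin_cases i <;> fin_cases j <;> simp [pairing, skewForm, hq]

lemma skewForm_mem : skewForm A ∈ similitudes 1 := by
  rw [mem_similitudes, skewForm_conjTranspose, skewForm_mul_self]
  simp

lemma repA_one_mem {b d : A} (hb : star b = b) (hd : star d = d) (c : A) :
    repA 1 b d c ∈ similitudes 1 := by
  rw [mem_similitudes]
  ext i j
  rw [mul_skewForm_mul_apply]
  fin_cases i <;> fin_cases j <;> simp [pairing, repA, skewForm, hb, hd]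

lemma repC_one_mem {b : A} (hb : star b = b) (a : A) :
    repC 1 a b ∈ similitudes 1 := by
  rw [mem_similitudes]
  ext i j
  rw [mul_skewForm_mul_apply]
  fin_cases i <;> fin_cases j <;> simp [pairing, repC, skewForm, hb]

lemma neg_mem_similitudes {q : A} {g : Matrix (Fin 4) (Fin 4) A} (hg : g ∈ similitudes q) :
    -g ∈ similitudes q := by
  simpa [mem_similitudes] using hg

lemma repA_mem (q : A) {b d : A} (hb : star b = b) (hd : star d = d) (c : A) :
    repA q b d c ∈ similitudes 1 * {diagonal ![1, 1, q, q]} * similitudes (1 : A) := by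
  refine ⟨_, ⟨1, ?_, _, rfl, rfl⟩, repA 1 b d c, repA_one_mem hb hd c, ?_⟩
  · simp [mem_similitudes]
  · ext i j
    fin_cases i <;> fin_cases j <;> simp [repA]

lemma repB_mem (q : A) {e : A} (he : star e = e) :
    repB q e ∈ similitudes 1 * {diagonal ![1, 1, q, q]} * similitudes (1 : A) := by
  refine ⟨_, ⟨swapFst (-1), swapFst_mem (by simp), _, rfl, rfl⟩, swapFst 1 * repA 1 0 e 0,
    by simpa using mul_mem_similitudes (swapFst_mem (by simp)) (repA_one_mem (star_zero A) he 0), ?_⟩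
  ext i j
  fin_cases i <;> fin_cases j <;>
    simp [repB, repA, swapFst, Matrix.mul_apply, Fin.sum_univ_four, vecMul_diagonal]

lemma repC_mem (q : A) {b : A} (hb : star b = b) (a : A) :
    repC q a b ∈ similitudes 1 * {diagonal ![1, 1, q, q]} * similitudes (1 : A) := by
  refine ⟨_, ⟨swapSnd (-1), swapSnd_mem (by simp), _, rfl, rfl⟩, swapSnd 1 * repC 1 a b,
    by simpa using mul_mem_similitudes (swapSnd_mem (by simp)) (repC_one_mem hb a), ?_⟩
  ext i j
  fin_cases i <;> fin_cases j <;>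
    simp [repC, swapSnd, Matrix.mul_apply, Fin.sum_univ_four, vecMul_diagonal]

lemma repD_mem (q : A) :
    repD q ∈ similitudes 1 * {diagonal ![1, 1, q, q]} * similitudes (1 : A) := by
  refine ⟨_, ⟨-skewForm A, neg_mem_similitudes skewForm_mem, _, rfl, rfl⟩, skewForm A,
    skewForm_mem, ?_⟩
  ext i j
  fin_cases i <;> fin_cases j <;>
    simp [repD, skewForm, Matrix.mul_apply, Fin.sum_univ_four, vecMul_diagonal]

omit [StarRing A] in
lemma skewForm_mul_cancel {g h : Matrix (Fin 4) (Fin 4) A}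
    (H : skewForm A * g = skewForm A * h) : g = h := by
  have := congrArg (skewForm A * ·) H
  simpa [← Matrix.mul_assoc, skewForm_mul_self] using this

/-- Unitary matrices are invertible, with inverse `-J g* J`. -/
lemma mul_inv_of_mem {g : Matrix (Fin 4) (Fin 4) A} (hg : g ∈ similitudes 1) :
    g * -(skewForm A * gᴴ * skewForm A) = 1 := by
  rw [mem_similitudes, one_smul] at hg
  rw [Matrix.mul_neg, ← Matrix.mul_assoc, ← Matrix.mul_assoc, hg, skewForm_mul_self, neg_neg]

lemma conjTranspose_mul_skewForm_mul {g : Matrix (Fin 4) (Fin 4) A} (hg : g ∈ similitudes 1) :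
    gᴴ * skewForm A * g = skewForm A := by
  have h := mul_eq_one_comm.mp (mul_inv_of_mem hg)
  apply skewForm_mul_cancel
  rw [skewForm_mul_self, ← h]
  simp [Matrix.mul_assoc]

lemma exists_inv_mem {g : Matrix (Fin 4) (Fin 4) A} (hg : g ∈ similitudes 1) :
    ∃ h ∈ similitudes (1 : A), h * g = 1 := by
  have h := mul_inv_of_mem hg
  refine ⟨_, ?_, mul_eq_one_comm.mp h⟩
  rw [mem_similitudes]
  simp only [conjTranspose_neg, conjTranspose_mul, conjTranspose_conjTranspose,
    skewForm_conjTranspose]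
  rw [one_smul]
  calc _ = skewForm A * gᴴ * (skewForm A * skewForm A) * skewForm A * g * skewForm A := by
        simp [Matrix.mul_assoc]
    _ = -(skewForm A * (gᴴ * skewForm A * g) * skewForm A) := by
        rw [skewForm_mul_self]; simp [Matrix.mul_assoc]
    _ = _ := by rw [conjTranspose_mul_skewForm_mul hg, skewForm_mul_self]; simp

/-- Two similitudes of the same multiplier `q` lie in the same coset as soon as their rows pair
to multiples of `q`. -/
lemma mem_coset [IsDomain A] {q : A} (hq : q ≠ 0) {g t : Matrix (Fin 4) (Fin 4) A}
    (hg : g ∈ similitudes q) (ht : t ∈ similitudes q)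
    (h : ∀ i j, q ∣ pairing (g i) (t j)) : g ∈ similitudes (1 : A) * {t} := by
  obtain ⟨X, hX⟩ : ∃ X : Matrix (Fin 4) (Fin 4) A, g * skewForm A * tᴴ = q • X := by
    choose X hX using h
    refine ⟨Matrix.of X, ?_⟩
    ext i j
    rw [mul_skewForm_mul_apply, hX]
    simp
  rw [mem_similitudes] at hg ht
  have hinj : Function.Injective (fun M : Matrix (Fin 4) (Fin 4) A => q • M) :=
    smul_right_injective _ hq
  have htt : skewForm A * tᴴ * -(skewForm A * t) = q • 1 := by
    have hdet : t.det ≠ 0 := by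
      intro h0
      have := congrArg det ht
      rw [det_mul, det_mul, h0, zero_mul, zero_mul, det_smul] at this
      have h1 : (skewForm A).det * (skewForm A).det = 1 := by
        rw [← det_mul, skewForm_mul_self, det_neg, det_one]; norm_num [Fintype.card_fin]
      have h2 : (skewForm A).det ≠ 0 := left_ne_zero_of_mul_eq_one h1
      exact mul_ne_zero (pow_ne_zero _ hq) h2 this.symm
    have hinjt : Function.Injective (fun M : Matrix (Fin 4) (Fin 4) A => t * M) := by
      intro M N hMN
      have := congrArg (t.adjugate * ·) hMN
      simp only [← Matrix.mul_assoc, adjugate_mul, Matrix.smul_mul, Matrix.one_mul] at this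
      exact smul_right_injective _ hdet this
    apply hinjt
    calc t * (skewForm A * tᴴ * -(skewForm A * t))
        = -(t * skewForm A * tᴴ * skewForm A * t) := by simp [Matrix.mul_assoc]
      _ = t * (q • 1) := by rw [ht]; simp [skewForm_mul_self]
  obtain ⟨k, rfl⟩ : ∃ k, g = k * t := by
    refine ⟨X * -skewForm A, hinj ?_⟩
    calc q • g = g * (skewForm A * tᴴ * -(skewForm A * t)) := by rw [htt]; simp
      _ = (g * skewForm A * tᴴ) * -(skewForm A * t) := by simp only [Matrix.mul_assoc]
      _ = _ := by rw [hX]; simp [Matrix.mul_assoc]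
  refine ⟨k, ?_, t, rfl, rfl⟩
  rw [mem_similitudes]
  apply hinj
  calc q • (k * skewForm A * kᴴ) = k * (t * skewForm A * tᴴ) * kᴴ := by rw [ht]; simp
    _ = k * t * skewForm A * (k * t)ᴴ := by
      rw [conjTranspose_mul]; simp only [Matrix.mul_assoc]
    _ = _ := by rw [hg, one_smul]

/-- If two cosets meet, the rows of their representatives pair to multiples of `q`. -/
lemma dvd_pairing_of_not_disjoint {q : A} {g t : Matrix (Fin 4) (Fin 4) A}
    (ht : t ∈ similitudes q)
    (h : ¬ Disjoint (similitudes 1 * {g}) (similitudes (1 : A) * {t})) (i j : Fin 4) :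
    q ∣ pairing (g i) (t j) := by
  obtain ⟨x, ⟨k, hk, g', hg', rfl⟩, l, hl, t', ht', hx⟩ := Set.not_disjoint_iff.mp h
  rw [Set.mem_singleton_iff] at hg' ht'
  subst hg' ht'
  obtain ⟨k', -, hkk⟩ := exists_inv_mem hk
  have hg : g' = k' * l * t' := by
    rw [Matrix.mul_assoc]
    simp only at hx
    rw [hx, ← Matrix.mul_assoc, hkk, Matrix.one_mul]
  rw [← mul_skewForm_mul_apply, hg]
  rw [mem_similitudes] at ht
  rw [Matrix.mul_assoc (k' * l), Matrix.mul_assoc (k' * l), ht]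
  simp

end Ring

section Reps

variable {A F : Type*} [CommRing A] [StarRing A] [Field F] [StarRing F]

variable (F) in
/-- The index set of the coset representatives; `F` plays the role of the residue field. -/
abbrev RepIndex : Type _ :=
  ({x : F // star x = x} × {x : F // star x = x} × F) ⊕ {x : F // star x = x} ⊕
    (F × {x : F // star x = x}) ⊕ Unit

/-- The coset representatives, the parameters being lifted along `s`. -/
def rep (s : F → A) (q : A) : RepIndex F → Matrix (Fin 4) (Fin 4) A
  | .inl (b, d, c) => repA q (s b) (s d) (s c)
  | .inr (.inl e) => repB q (s e)
  | .inr (.inr (.inl (a, b))) => repC q (s a) (s b)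
  | .inr (.inr (.inr _)) => repD q

lemma rep_mem {s : F → A} (hs : ∀ x, star x = x → star (s x) = s x) (q : A) (i : RepIndex F) :
    rep s q i ∈ similitudes 1 * {diagonal ![1, 1, q, q]} * similitudes (1 : A) := by
  rcases i with ⟨b, d, c⟩ | e | ⟨a, b⟩ | _
  · exact repA_mem q (hs _ b.2) (hs _ d.2) _
  · exact repB_mem q (hs _ e.2)
  · exact repC_mem q (hs _ b.2) _
  · exact repD_mem q

lemma map_repA {π : A →+* F} (hπ : ∀ x, π (star x) = star (π x)) (q b d c : A) :
    (repA q b d c).map π = repA (π q) (π b) (π d) (π c) := by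
  ext i j
  fin_cases i <;> fin_cases j <;> simp [repA, hπ]

omit [StarRing A] [StarRing F] in
lemma map_repB {π : A →+* F} (q e : A) :
    (repB q e).map π = repB (π q) (π e) := by
  ext i j
  fin_cases i <;> fin_cases j <;> simp [repB]

lemma map_repC {π : A →+* F} (hπ : ∀ x, π (star x) = star (π x)) (q a b : A) :
    (repC q a b).map π = repC (π q) (π a) (π b) := by
  ext i j
  fin_cases i <;> fin_cases j <;> simp [repC, hπ]

omit [StarRing A] [StarRing F] in
lemma map_repD {π : A →+* F} (q : A) :
    (repD q).map π = repD (π q) := by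
  ext i j
  fin_cases i <;> fin_cases j <;> simp [repD]

lemma map_rep {π : A →+* F} (hπ : ∀ x, π (star x) = star (π x)) {s : F → A}
    (hs : ∀ x, π (s x) = x) {q : A} (hq : π q = 0) (i : RepIndex F) :
    (rep s q i).map π = rep id 0 i := by
  rcases i with ⟨b, d, c⟩ | e | ⟨a, b⟩ | _
  · simp only [rep, map_repA hπ, hs, hq, id]
  · simp only [rep, map_repB, hs, hq, id]
  · simp only [rep, map_repC hπ, hs, hq, id]
  · simp only [rep, map_repD, hq]

lemma map_pairing {π : A →+* F} (hπ : ∀ x, π (star x) = star (π x)) (r s : Fin 4 → A) :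
    π (pairing r s) = pairing (fun i => π (r i)) (fun i => π (s i)) := by
  simp [pairing, hπ]

lemma pairing_repA_repB (b d c e' : F) :
    pairing (repA (0 : F) b d c 0) (repB (0 : F) e' 2) ≠ 0 := by
  simp [repA, repB, pairing]

lemma pairing_repB_repA (b d c e' : F) :
    pairing (repB (0 : F) e' 2) (repA (0 : F) b d c 0) ≠ 0 := by
  simp [repA, repB, pairing]

lemma pairing_repA_repC (b d c a' b' : F) :
    pairing (repA (0 : F) b d c 1) (repC (0 : F) a' b' 3) ≠ 0 := by
  simp [repA, repC, pairing]

lemma pairing_repC_repA (b d c a' b' : F) :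
    pairing (repC (0 : F) a' b' 3) (repA (0 : F) b d c 1) ≠ 0 := by
  simp [repA, repC, pairing]

lemma pairing_repA_repD (b d c : F) :
    pairing (repA (0 : F) b d c 0) (repD (0 : F) 2) ≠ 0 := by
  simp [repA, repD, pairing]

lemma pairing_repD_repA (b d c : F) :
    pairing (repD (0 : F) 2) (repA (0 : F) b d c 0) ≠ 0 := by
  simp [repA, repD, pairing]

lemma pairing_repB_repC (e a' b' : F) :
    pairing (repB (0 : F) e 2) (repC (0 : F) a' b' 0) ≠ 0 := by
  simp [repB, repC, pairing]

lemma pairing_repC_repB (e a' b' : F) :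
    pairing (repC (0 : F) a' b' 0) (repB (0 : F) e 2) ≠ 0 := by
  simp [repB, repC, pairing]

lemma pairing_repB_repD (e : F) :
    pairing (repB (0 : F) e 1) (repD (0 : F) 3) ≠ 0 := by
  simp [repB, repD, pairing]

lemma pairing_repD_repB (e : F) :
    pairing (repD (0 : F) 3) (repB (0 : F) e 1) ≠ 0 := by
  simp [repB, repD, pairing]

lemma pairing_repC_repD (a b : F) :
    pairing (repC (0 : F) a b 0) (repD (0 : F) 2) ≠ 0 := by
  simp [repC, repD, pairing]

lemma pairing_repD_repC (a b : F) :
    pairing (repD (0 : F) 2) (repC (0 : F) a b 0) ≠ 0 := by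
  simp [repC, repD, pairing]

lemma repA_separated {b d c b' d' c' : F} (hb' : star b' = b') (hd' : star d' = d')
    (h : ∀ j k, pairing (repA 0 b d c j) (repA 0 b' d' c' k) = 0) :
    b = b' ∧ d = d' ∧ c = c' := by
  have h₁ := h 0 0
  have h₂ := h 0 1
  have h₃ := h 1 1
  simp [repA, pairing, hb', hd', sub_eq_zero] at h₁ h₂ h₃
  exact ⟨h₁, h₃, h₂⟩

lemma repB_separated {e e' : F} (he' : star e' = e')
    (h : ∀ j k, pairing (repB 0 e j) (repB 0 e' k) = 0) : e = e' := by
  have h₁ := h 1 1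
  simpa [repB, pairing, he', sub_eq_zero] using h₁

lemma repC_separated {a b a' b' : F} (hb' : star b' = b')
    (h : ∀ j k, pairing (repC 0 a b j) (repC 0 a' b' k) = 0) : a = a' ∧ b = b' := by
  have h₁ := h 0 3
  have h₂ := h 0 0
  simp [repC, pairing, hb', sub_eq_zero] at h₁ h₂
  exact ⟨h₁.symm, h₂⟩

lemma rep_separated {i i' : RepIndex F}
    (h : ∀ j k, pairing (rep id 0 i j) (rep id 0 i' k) = 0) : i = i' := by
  rcases i with ⟨⟨b, hb⟩, ⟨d, hd⟩, c⟩ | ⟨e, he⟩ | ⟨a, ⟨b, hb⟩⟩ | _ <;>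
  rcases i' with ⟨⟨b', hb'⟩, ⟨d', hd'⟩, c'⟩ | ⟨e', he'⟩ | ⟨a', ⟨b', hb'⟩⟩ | _
  · obtain ⟨rfl, rfl, rfl⟩ := repA_separated hb' hd' h
    rfl
  · exact absurd (h _ _) (pairing_repA_repB _ _ _ _)
  · exact absurd (h _ _) (pairing_repA_repC _ _ _ _ _)
  · exact absurd (h _ _) (pairing_repA_repD _ _ _)
  · exact absurd (h _ _) (pairing_repB_repA _ _ _ _)
  · obtain rfl := repB_separated he' h
    rfl
  · exact absurd (h _ _) (pairing_repB_repC _ _ _)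
  · exact absurd (h _ _) (pairing_repB_repD _)
  · exact absurd (h _ _) (pairing_repC_repA _ _ _ _ _)
  · exact absurd (h _ _) (pairing_repC_repB _ _ _)
  · obtain ⟨rfl, rfl⟩ := repC_separated hb' h
    rfl
  · exact absurd (h _ _) (pairing_repC_repD _ _)
  · exact absurd (h _ _) (pairing_repD_repA _ _ _)
  · exact absurd (h _ _) (pairing_repD_repB _)
  · exact absurd (h _ _) (pairing_repD_repC _ _)
  · rfl

lemma exists_repA_mem {W : Submodule F (Fin 4 → F)} (hW : ∀ v ∈ W, ∀ w ∈ W, pairing v w = 0)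
    {v w : Fin 4 → F} (hv : v ∈ W) (hw : w ∈ W) (v0 : v 0 = 1) (v1 : v 1 = 0) (w0 : w 0 = 0)
    (w1 : w 1 = 1) : ∃ i : RepIndex F, ∀ j, rep id 0 i j ∈ W := by
  have vv := hW _ hv _ hv
  have vw := hW _ hv _ hw
  have wv := hW _ hw _ hv
  have ww := hW _ hw _ hw
  simp only [pairing, v0, v1, w0, w1, star_one, star_zero, mul_zero, mul_one, zero_mul,
    one_mul, add_zero, zero_add, sub_zero] at vv vw wv ww
  have ev : v = ![1, 0, v 2, v 3] := by
    ext j; fin_cases j <;> simp [v0, v1]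
  have ew : w = ![0, 1, star (v 3), w 3] := by
    ext j; fin_cases j <;> simp [w0, w1]
    linear_combination wv
  have z : ![(0 : F), 0, 0, 0] ∈ W := by
    convert W.zero_mem using 1
    ext j; fin_cases j <;> rfl
  rw [ev] at hv
  rw [ew] at hw
  refine ⟨.inl (⟨v 2, by linear_combination -vv⟩, ⟨w 3, by linear_combination -ww⟩, v 3),
    fun j => ?_⟩
  fin_cases j
  exacts [hv, hw, z, z]

lemma exists_repC_mem {W : Submodule F (Fin 4 → F)} (hW : ∀ v ∈ W, ∀ w ∈ W, pairing v w = 0)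
    {y₁ y₂ : F} (hy : ![0, 0, y₁, y₂] ∈ W) (hyne : y₁ ≠ 0 ∨ y₂ ≠ 0)
    {w : Fin 4 → F} (hw : w ∈ W) (hw0 : w 0 ≠ 0) :
    ∃ i : RepIndex F, ∀ j, rep id 0 i j ∈ W := by
  obtain ⟨a, b, c, hwn⟩ : ∃ a b c : F, ![1, a, b, c] ∈ W := by
    refine ⟨w 1 / w 0, w 2 / w 0, w 3 / w 0, ?_⟩
    convert W.smul_mem (w 0)⁻¹ hw using 1
    ext j; fin_cases j <;> simp [hw0, div_eq_inv_mul]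
  have p₁ : y₁ + y₂ * star a = 0 := by simpa [pairing] using hW _ hy _ hwn
  have hy₂ : y₂ ≠ 0 := by
    rintro rfl
    simp_all
  have hy' : ![0, 0, -star a, 1] ∈ W := by
    convert W.smul_mem y₂⁻¹ hy using 1
    have : y₂⁻¹ * y₁ = -star a := by
      field_simp
      linear_combination p₁
    simp [this, hy₂]
  obtain ⟨b', hw'⟩ : ∃ b', ![1, a, b', 0] ∈ W := by
    refine ⟨b - c * -star a, ?_⟩
    convert W.sub_mem hwn (W.smul_mem c hy') using 1
    simp
  have hb : star b' = b' := by
    have := hW _ hw' _ hw'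
    simp [pairing] at this
    linear_combination -this
  have z : ![(0 : F), 0, 0, 0] ∈ W := by
    convert W.zero_mem using 1
    ext j; fin_cases j <;> rfl
  refine ⟨.inr (.inr (.inl (a, ⟨_, hb⟩))), fun j => ?_⟩
  fin_cases j
  exacts [hw', z, z, hy']

lemma exists_repB_mem {W : Submodule F (Fin 4 → F)} (hW : ∀ v ∈ W, ∀ w ∈ W, pairing v w = 0)
    {y₁ y₂ : F} (hy : ![0, 0, y₁, y₂] ∈ W) (hyne : y₁ ≠ 0 ∨ y₂ ≠ 0)
    {w : Fin 4 → F} (hw : w ∈ W) (hw0 : w 0 = 0) (hw1 : w 1 ≠ 0) :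
    ∃ i : RepIndex F, ∀ j, rep id 0 i j ∈ W := by
  obtain ⟨b, c, hwn⟩ : ∃ b c : F, ![0, 1, b, c] ∈ W := by
    refine ⟨w 2 / w 1, w 3 / w 1, ?_⟩
    convert W.smul_mem (w 1)⁻¹ hw using 1
    ext j; fin_cases j <;> simp [hw0, hw1, div_eq_inv_mul]
  obtain rfl : y₂ = 0 := by simpa [pairing] using hW _ hy _ hwn
  have hy₁ : y₁ ≠ 0 := by simpa using hyne
  have hy' : ![0, 0, 1, 0] ∈ W := by
    convert W.smul_mem y₁⁻¹ hy using 1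
    simp [hy₁]
  have hw' : ![0, 1, 0, c] ∈ W := by
    convert W.sub_mem hwn (W.smul_mem b hy') using 1
    simp
  have he : star c = c := by
    have := hW _ hw' _ hw'
    simp [pairing] at this
    linear_combination -this
  have z : ![(0 : F), 0, 0, 0] ∈ W := by
    convert W.zero_mem using 1
    ext j; fin_cases j <;> rfl
  refine ⟨.inr (.inl ⟨_, he⟩), fun j => ?_⟩
  fin_cases j
  exacts [z, hw', hy', z]

/-- A totally isotropic plane is orthogonal to the rows of one of the representatives modulo
`q`. -/
lemma exists_rep_of_isotropic {r₁ r₂ : Fin 4 → F} (h₁₁ : pairing r₁ r₁ = 0)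
    (h₁₂ : pairing r₁ r₂ = 0) (h₂₁ : pairing r₂ r₁ = 0) (h₂₂ : pairing r₂ r₂ = 0)
    (hli : ∀ u v : F, u • r₁ + v • r₂ = 0 → u = 0 ∧ v = 0) :
    ∃ i : RepIndex F, ∀ j, pairing r₁ (rep id 0 i j) = 0 ∧ pairing r₂ (rep id 0 i j) = 0 := by
  set W := Submodule.span F {r₁, r₂} with hWdef
  have m₁ : r₁ ∈ W := Submodule.subset_span (by simp)
  have m₂ : r₂ ∈ W := Submodule.subset_span (by simp)
  have hW : ∀ v ∈ W, ∀ w ∈ W, pairing v w = 0 := by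
    intro v hv w hw
    obtain ⟨a, b, rfl⟩ := Submodule.mem_span_pair.mp hv
    obtain ⟨c, d, rfl⟩ := Submodule.mem_span_pair.mp hw
    have : pairing (a • r₁ + b • r₂) (c • r₁ + d • r₂) =
        a * star c * pairing r₁ r₁ + a * star d * pairing r₁ r₂ +
        b * star c * pairing r₂ r₁ + b * star d * pairing r₂ r₂ := by
      simp [pairing]; ring
    rw [this, h₁₁, h₁₂, h₂₁, h₂₂]; simp
  have key : (∃ i : RepIndex F, ∀ j, rep id 0 i j ∈ W) → ∃ i : RepIndex F, ∀ j,
      pairing r₁ (rep id 0 i j) = 0 ∧ pairing r₂ (rep id 0 i j) = 0 :=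
    fun ⟨i, hi⟩ => ⟨i, fun j => ⟨hW _ m₁ _ (hi j), hW _ m₂ _ (hi j)⟩⟩
  by_cases hdet : r₁ 0 * r₂ 1 - r₁ 1 * r₂ 0 = 0
  · obtain ⟨y₁, y₂, hy, hyne⟩ : ∃ y₁ y₂ : F, ![0, 0, y₁, y₂] ∈ W ∧ (y₁ ≠ 0 ∨ y₂ ≠ 0) := by
      obtain ⟨v, hv, hv0⟩ := Matrix.exists_vecMul_eq_zero_iff
        (M := !![r₁ 0, r₁ 1; r₂ 0, r₂ 1]).mpr (by rw [det_fin_two_of, hdet])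
      have e0 := congrFun hv0 0
      have e1 := congrFun hv0 1
      simp [Matrix.vecMul, dotProduct, Fin.sum_univ_two] at e0 e1
      refine ⟨v 0 * r₁ 2 + v 1 * r₂ 2, v 0 * r₁ 3 + v 1 * r₂ 3,
        Submodule.mem_span_pair.mpr ⟨v 0, v 1, ?_⟩, ?_⟩
      · ext j; fin_cases j <;> simp [e0, e1]
      · by_contra! hc
        refine hv ?_
        obtain ⟨a, b⟩ := hli (v 0) (v 1)
          (by ext j; fin_cases j <;> simp [e0, e1, hc.1, hc.2])
        ext j; fin_cases j <;> simp [a, b]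
    by_cases h0 : ∃ w ∈ W, w 0 ≠ 0
    · obtain ⟨w, hw, hw0⟩ := h0
      exact key (exists_repC_mem hW hy hyne hw hw0)
    · push Not at h0
      by_cases h1 : ∃ w ∈ W, w 1 ≠ 0
      · obtain ⟨w, hw, hw1⟩ := h1
        exact key (exists_repB_mem hW hy hyne hw (h0 w hw) hw1)
      · push Not at h1
        refine ⟨.inr (.inr (.inr ())), fun j => ?_⟩
        fin_cases j <;> simp [rep, repD, pairing, h0 _ m₁, h0 _ m₂, h1 _ m₁, h1 _ m₂]
  · set δ := r₁ 0 * r₂ 1 - r₁ 1 * r₂ 0 with hδ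
    have hv := W.sub_mem (W.smul_mem (r₂ 1 / δ) m₁) (W.smul_mem (r₁ 1 / δ) m₂)
    have hw := W.sub_mem (W.smul_mem (r₁ 0 / δ) m₂) (W.smul_mem (r₂ 0 / δ) m₁)
    set v := (r₂ 1 / δ) • r₁ - (r₁ 1 / δ) • r₂ with hvd
    set w := (r₁ 0 / δ) • r₂ - (r₂ 0 / δ) • r₁ with hwd
    refine key (exists_repA_mem hW hv hw ?_ ?_ ?_ ?_)
    · simp only [hvd, Pi.sub_apply, Pi.smul_apply, smul_eq_mul]
      field_simp
      rw [hδ]; ring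
    · simp only [hvd, Pi.sub_apply, Pi.smul_apply, smul_eq_mul]
      field_simp
      ring
    · simp only [hwd, Pi.sub_apply, Pi.smul_apply, smul_eq_mul]
      field_simp
      ring
    · simp only [hwd, Pi.sub_apply, Pi.smul_apply, smul_eq_mul]
      field_simp
      rw [hδ]; ring

/-- The decomposition of the double coset of `diag(1,1,q,q)`, where `F` is the residue field
modulo `q`. -/
theorem exists_coset_reps [IsDomain A] {π : A →+* F} (hπ : ∀ x, π (star x) = star (π x))
    (hsurj : Function.Surjective π) {q : A} (hq : q ≠ 0) (hqs : star q = q)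
    (hker : ∀ x, π x = 0 ↔ q ∣ x)
    (hlift : ∀ x : F, star x = x → ∃ y, star y = y ∧ π y = x) :
    ∃ f : RepIndex F → Matrix (Fin 4) (Fin 4) A,
      similitudes 1 * {diagonal ![1, 1, q, q]} * similitudes (1 : A) =
        ⋃ i, similitudes 1 * {f i} ∧
      Pairwise fun i j => Disjoint (similitudes 1 * {f i}) (similitudes (1 : A) * {f j}) := by
  obtain ⟨s, hs⟩ : ∃ s : F → A, ∀ x, (star x = x → star (s x) = s x) ∧ π (s x) = x := by
    suffices h : ∀ x : F, ∃ y : A, (star x = x → star y = y) ∧ π y = x from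
      Classical.skolem.mp h
    intro x
    by_cases hx : star x = x
    · obtain ⟨y, hy, rfl⟩ := hlift x hx
      exact ⟨y, fun _ => hy, rfl⟩
    · obtain ⟨y, rfl⟩ := hsurj x
      exact ⟨y, fun h => absurd h hx, rfl⟩
  have hq0 : π q = 0 := (hker q).mpr dvd_rfl
  have hrow : ∀ i j, (fun k => π (rep s q i j k)) = rep id 0 i j := fun i j =>
    congrFun (map_rep hπ (fun x => (hs x).2) hq0 i) j
  have hsim : ∀ g ∈ similitudes 1 * {diagonal ![1, 1, q, q]} * similitudes (1 : A),
      g ∈ similitudes q := by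
    rintro _ ⟨_, ⟨k, hk, _, rfl, rfl⟩, l, hl, rfl⟩
    simpa using mul_mem_similitudes (mul_mem_similitudes hk (diagonal_mem hqs)) hl
  have hrep := rep_mem (s := s) (fun x => (hs x).1) q
  refine ⟨rep s q, Set.Subset.antisymm ?_ ?_, fun i j hij => ?_⟩
  · rintro _ ⟨_, ⟨k, hk, _, rfl, rfl⟩, l, hl, rfl⟩
    rw [Set.mem_iUnion]
    have hl' : ∀ i j, pairing (fun k => π (l i k)) (fun k => π (l j k)) =
        π (skewForm A i j) := by
      intro i j
      rw [← map_pairing hπ, ← mul_skewForm_mul_apply, mem_similitudes.mp hl, one_smul]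
    obtain ⟨l', hl'mem, hll⟩ := exists_inv_mem hl
    have hll' := mul_eq_one_comm.mp hll
    obtain ⟨i, hi⟩ := exists_rep_of_isotropic (r₁ := fun k => π (l 0 k))
      (r₂ := fun k => π (l 1 k)) (by simp [hl', skewForm]) (by simp [hl', skewForm])
      (by simp [hl', skewForm]) (by simp [hl', skewForm]) (by
        intro u v huv
        have hmul : (l.map π) * (l'.map π) = 1 := by
          rw [← Matrix.map_mul, hll']; simp
        have h0 : ![u, v, 0, 0] ᵥ* l.map π = 0 := by
          ext j
          simpa [Matrix.vecMul, dotProduct, Fin.sum_univ_four] using congrFun huv j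
        have h1 := congrArg (· ᵥ* l'.map π) h0
        simp only [vecMul_vecMul, hmul, vecMul_one, zero_vecMul] at h1
        exact ⟨congrFun h1 0, congrFun h1 1⟩)
    refine ⟨i, ?_⟩
    have hDl : diagonal ![1, 1, q, q] * l ∈ similitudes (1 : A) * {rep s q i} := by
      refine mem_coset hq ?_ (hsim _ (hrep i)) fun a b => ?_
      · simpa using mul_mem_similitudes (diagonal_mem hqs) hl
      · rw [← hker, map_pairing hπ, hrow]
        have hz : ∀ t, pairing (fun _ => (0 : F)) t = 0 := by simp [pairing]
        fin_cases a
        · simpa using (hi b).1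
        · simpa using (hi b).2
        · simpa [hq0] using hz _
        · simpa [hq0] using hz _
    obtain ⟨m, hm, t, ht, hmt⟩ := hDl
    rw [Set.mem_singleton_iff] at ht
    subst ht
    refine ⟨k * m, by simpa using mul_mem_similitudes hk hm, _, rfl, ?_⟩
    simp only at hmt ⊢
    rw [Matrix.mul_assoc, hmt, Matrix.mul_assoc]
  · refine Set.iUnion_subset fun i => ?_
    rintro _ ⟨k, hk, _, rfl, rfl⟩
    obtain ⟨_, ⟨m, hm, _, rfl, rfl⟩, l, hl, hml⟩ := hrep i
    refine ⟨_, ⟨k * m, by simpa using mul_mem_similitudes hk hm, _, rfl, rfl⟩, l, hl, ?_⟩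
    simp only at hml ⊢
    rw [← hml]
    simp only [Matrix.mul_assoc]
  · by_contra hd
    refine hij (rep_separated fun a b => ?_)
    rw [← hrow, ← hrow, ← map_pairing hπ, hker]
    exact dvd_pairing_of_not_disjoint (hsim _ (hrep j)) hd a b

/-- The number of representatives. -/
lemma card_repIndex {p : ℕ} [Finite F] (hF : Nat.card F = p ^ 2)
    (hF₀ : Nat.card {x : F // star x = x} = p) :
    Nat.card (RepIndex F) = p ^ 4 + p ^ 3 + p + 1 := by
  simp only [RepIndex, Nat.card_sum, Nat.card_prod, hF, hF₀, Nat.card_unique]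
  ring

end Reps

section Involution

/-- An involutive endomorphism of a commutative ring makes it a star ring. -/
abbrev starRingOfInvolutive {A : Type*} [CommRing A] (τ : A →+* A)
    (hτ : Function.Involutive τ) : StarRing A where
  star := τ
  star_involutive := hτ
  star_mul r s := by rw [mul_comm r s, map_mul]
  star_add := map_add τ

lemma exists_finset_of_pairwise_disjoint {α β I : Type*} [Finite I] {f : I → α} {C : α → Set β}
    (hC : ∀ i, (C (f i)).Nonempty) (hdisj : Pairwise fun i j => Disjoint (C (f i)) (C (f j))) :
    ∃ T : Finset α, T.card = Nat.card I ∧ ⋃ t ∈ (T : Set α), C t = ⋃ i, C (f i) ∧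
      (T : Set α).PairwiseDisjoint C := by
  classical
  have := Fintype.ofFinite I
  have hinj : Function.Injective f := by
    intro i j hij
    by_contra hne
    have : Disjoint (C (f i)) (C (f j)) := hdisj hne
    rw [hij, disjoint_self] at this
    exact (hC j).ne_empty this
  refine ⟨Finset.univ.image f, ?_, by simp, ?_⟩
  · rw [Finset.card_image_of_injective _ hinj, Finset.card_univ, Nat.card_eq_fintype_card]
  · simp only [Finset.coe_image, Finset.coe_univ, Set.image_univ]
    rintro _ ⟨i, rfl⟩ _ ⟨j, rfl⟩ hij
    exact hdisj fun h => hij (congrArg f h)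

lemma similitudes_one_nonempty {A : Type*} [CommRing A] [StarRing A] :
    (similitudes (1 : A)).Nonempty :=
  ⟨1, by simp [mem_similitudes]⟩

/-- The decomposition of the double coset of `diag(1,1,p,p)` when the residue ring modulo `p` is
a field with `p ^ 2` elements on which the elements fixed by the involution are integers. -/
theorem exists_finset_coset_reps {A : Type*} [CommRing A] [IsDomain A] [StarRing A] {p : ℕ}
    (hp : p.Prime) (hodd : Odd p) (hp0 : (p : A) ≠ 0) (hmax : (Ideal.span {(p : A)}).IsMaximal)
    (hcard : Nat.card (A ⧸ Ideal.span {(p : A)}) = p ^ 2)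
    (hfix : ∀ x : A, star x = x → ∃ n : ℕ, (p : A) ∣ x - n) :
    ∃ T : Finset (Matrix (Fin 4) (Fin 4) A), T.card = p ^ 4 + p ^ 3 + p + 1 ∧
      similitudes 1 * {diagonal ![1, 1, (p : A), (p : A)]} * similitudes (1 : A) =
        ⋃ t ∈ (T : Set (Matrix (Fin 4) (Fin 4) A)), similitudes 1 * {t} ∧
      (T : Set (Matrix (Fin 4) (Fin 4) A)).PairwiseDisjoint
        (fun t => similitudes (1 : A) * {t}) := by
  classical
  set I := Ideal.span {(p : A)} with hI
  let := Ideal.Quotient.field I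
  have hcomap : I ≤ I.comap (starRingEnd A) := by
    rw [hI, Ideal.span_le]
    rintro _ rfl
    simp
  let τ : A ⧸ I →+* A ⧸ I := Ideal.quotientMap I (starRingEnd A) hcomap
  have hτ : Function.Involutive τ := by
    intro x
    obtain ⟨y, rfl⟩ := Ideal.Quotient.mk_surjective x
    simp [τ]
  let : StarRing (A ⧸ I) := starRingOfInvolutive τ hτ
  have hπ : ∀ x, Ideal.Quotient.mk I (star x) = star (Ideal.Quotient.mk I x) :=
    fun x => (Ideal.quotientMap_mk (f := starRingEnd A) (H := hcomap)).symm
  have hker : ∀ x, Ideal.Quotient.mk I x = 0 ↔ (p : A) ∣ x := fun x => by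
    rw [Ideal.Quotient.eq_zero_iff_mem, hI, Ideal.mem_span_singleton]
  have hpF : (p : A ⧸ I) = 0 := by simpa using (hker p).mpr dvd_rfl
  have hlift : ∀ x : A ⧸ I, star x = x → ∃ y, star y = y ∧ Ideal.Quotient.mk I y = x := by
    intro x hx
    obtain ⟨y, rfl⟩ := Ideal.Quotient.mk_surjective x
    obtain ⟨k, hk⟩ := hodd
    refine ⟨(k + 1 : ℕ) * (y + star y), by simp [add_comm], ?_⟩
    rw [map_mul, map_add, hπ, hx, map_natCast]
    have : ((2 * k + 1 : ℕ) : A ⧸ I) = 0 := by rw [← hk, hpF]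
    push_cast at this ⊢
    linear_combination (Ideal.Quotient.mk I y) * this
  have : CharP (A ⧸ I) p := (CharP.charP_iff_prime_eq_zero hp).mpr hpF
  have : Fact p.Prime := ⟨hp⟩
  have : Finite (A ⧸ I) := Nat.finite_of_card_ne_zero (by rw [hcard]; positivity [hp.pos])
  have hfixed : Nat.card {x : A ⧸ I // star x = x} = p := by
    let φ : ZMod p → {x : A ⧸ I // star x = x} := fun n =>
      ⟨ZMod.castHom dvd_rfl (A ⧸ I) n, by
        obtain ⟨m, rfl⟩ := ZMod.natCast_zmod_surjective n
        simp⟩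
    have hφ : Function.Bijective φ := by
      refine ⟨fun m n h => (ZMod.castHom dvd_rfl (A ⧸ I)).injective (congrArg Subtype.val h), ?_⟩
      rintro ⟨x, hx⟩
      obtain ⟨y, hy, rfl⟩ := hlift x hx
      obtain ⟨n, hn⟩ := hfix y hy
      refine ⟨n, Subtype.ext ?_⟩
      rw [← hker, map_sub, map_natCast, sub_eq_zero] at hn
      simp [φ, hn]
    rw [← Nat.card_eq_of_bijective φ hφ, Nat.card_zmod]
  obtain ⟨f, hf, hdisj⟩ := exists_coset_reps hπ Ideal.Quotient.mk_surjective hp0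
    (star_natCast p) hker hlift
  obtain ⟨T, hT, hTU, hTd⟩ := exists_finset_of_pairwise_disjoint
    (C := fun t => similitudes (1 : A) * {t})
    (fun i => Set.Nonempty.mul (similitudes_one_nonempty (A := A)) (Set.singleton_nonempty (f i)))
    hdisj
  exact ⟨T, hT.trans (card_repIndex hcard hfixed), hf.trans hTU.symm, hTd⟩

end Involution

section Quadratic

variable {p : ℕ} [Fact p.Prime] {E : Type*} [Field E] [Algebra ℚ_[p] E]

lemma quadratic_involutive (h2 : Module.finrank ℚ_[p] E = 2) {σ : E ≃ₐ[ℚ_[p]] E} (hσ : σ ≠ 1) :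
    Function.Involutive σ ∧ ∀ x, σ x = x → x ∈ Set.range (algebraMap ℚ_[p] E) := by
  classical
  have : FiniteDimensional ℚ_[p] E := Module.finite_of_finrank_eq_succ h2
  have hle := AlgEquiv.card_le (F := ℚ_[p]) (K := E)
  have hall : ∀ τ : E ≃ₐ[ℚ_[p]] E, τ = 1 ∨ τ = σ := by
    intro τ
    by_contra! h
    have := Finset.card_le_univ ({1, σ, τ} : Finset (E ≃ₐ[ℚ_[p]] E))
    rw [Finset.card_eq_three.mpr ⟨1, σ, τ, hσ.symm, h.1.symm, h.2.symm, rfl⟩] at this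
    omega
  have hge := Finset.card_le_univ ({1, σ} : Finset (E ≃ₐ[ℚ_[p]] E))
  rw [Finset.card_pair hσ.symm] at hge
  have hgal : IsGalois ℚ_[p] E := IsGalois.of_card_aut_eq_finrank _ _ (by
    rw [Nat.card_eq_fintype_card]; omega)
  constructor
  · intro x
    rcases hall (σ * σ) with h | h
    · exact DFunLike.congr_fun h x
    · exact absurd (mul_eq_left.mp h) hσ
  · intro x hx
    refine (IsGalois.mem_range_algebraMap_iff_fixed x).mpr fun τ => ?_
    rcases hall τ with rfl | rfl
    · rfl
    · exact hx

lemma card_quotient_map_maximalIdeal {R S : Type*} [CommRing R] [IsLocalRing R] [CommRing S]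
    [Algebra R S] [Module.Free R S] [Module.Finite R S] :
    Nat.card (S ⧸ (IsLocalRing.maximalIdeal R).map (algebraMap R S)) =
      Nat.card (R ⧸ IsLocalRing.maximalIdeal R) ^ Module.finrank R S := by
  let := Ideal.Quotient.field (IsLocalRing.maximalIdeal R)
  have : Module.Finite (R ⧸ IsLocalRing.maximalIdeal R)
      (S ⧸ (IsLocalRing.maximalIdeal R).map (algebraMap R S)) :=
    Module.Finite.of_restrictScalars_finite R _ _
  rw [← IsLocalRing.finrank_quotient_map (R := R) (S := S)]
  exact Module.natCard_eq_pow_finrank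

variable [Algebra ℤ_[p] E] [IsScalarTower ℤ_[p] ℚ_[p] E]

lemma card_quotient_integralClosure (h2 : Module.finrank ℚ_[p] E = 2) :
    Nat.card (integralClosure ℤ_[p] E ⧸ Ideal.span {(p : integralClosure ℤ_[p] E)}) =
      p ^ 2 := by
  have : FiniteDimensional ℚ_[p] E := Module.finite_of_finrank_eq_succ h2
  have : Module.IsTorsionFree ℤ_[p] E := .trans_faithfulSMul ℤ_[p] ℚ_[p] E
  have := IsIntegralClosure.finite ℤ_[p] ℚ_[p] E (integralClosure ℤ_[p] E)
  have := IsIntegralClosure.module_free ℤ_[p] ℚ_[p] E (integralClosure ℤ_[p] E)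
  have hrank := IsIntegralClosure.rank ℤ_[p] ℚ_[p] E (integralClosure ℤ_[p] E)
  have hmap : Ideal.map (algebraMap ℤ_[p] (integralClosure ℤ_[p] E))
      (IsLocalRing.maximalIdeal ℤ_[p]) = Ideal.span {(p : integralClosure ℤ_[p] E)} := by
    rw [PadicInt.maximalIdeal_eq_span_p, Ideal.map_span]
    simp
  rw [← hmap]
  have e : ℤ_[p] ⧸ IsLocalRing.maximalIdeal ℤ_[p] ≃+* ZMod p := PadicInt.residueField
  rw [card_quotient_map_maximalIdeal, hrank, h2, Nat.card_congr e.toEquiv, Nat.card_zmod]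

lemma exists_dvd_sub_natCast {x : integralClosure ℤ_[p] E}
    (hx : (x : E) ∈ Set.range (algebraMap ℚ_[p] E)) :
    ∃ n : ℕ, (p : integralClosure ℤ_[p] E) ∣ x - n := by
  obtain ⟨y, hy⟩ := hx
  have hint : IsIntegral ℤ_[p] y :=
    (isIntegral_algebraMap_iff (algebraMap ℚ_[p] E).injective).mp (hy ▸ x.2)
  obtain ⟨z, rfl⟩ := IsIntegrallyClosed.isIntegral_iff.mp hint
  obtain ⟨n, -, hn⟩ := PadicInt.exists_mem_range z
  rw [PadicInt.maximalIdeal_eq_span_p, Ideal.mem_span_singleton] at hn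
  have hxz : x = algebraMap ℤ_[p] (integralClosure ℤ_[p] E) z := by
    apply Subtype.ext
    rw [← hy, ← IsScalarTower.algebraMap_apply]
    rfl
  refine ⟨n, ?_⟩
  simpa [hxz] using map_dvd (algebraMap ℤ_[p] (integralClosure ℤ_[p] E)) hn

end Quadratic

end HermitianHecke

open HermitianHecke in
/-- Let `E` be the unramified quadratic extension of `ℚ_p` (`p` odd) with ring of integers
`R` and conjugation `σ`, `J = [[0,-I₂],[I₂,0]]`, `U = {g : g J g* = J}` the quasi-split
unitary group and `𝒦 = U ∩ GL₄(R)`.  The double coset `𝒦 · diag(1,1,p,p) · 𝒦` is a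
disjoint union of exactly `p⁴ + p³ + p + 1` left `𝒦`-cosets. -/
theorem stmt_8 (p : ℕ) [Fact p.Prime] (hodd : Odd p)
    (E : Type*) [Field E] [Algebra ℚ_[p] E] [Algebra ℤ_[p] E]
    [IsScalarTower ℤ_[p] ℚ_[p] E]
    (h2 : Module.finrank ℚ_[p] E = 2)
    (R : Subalgebra ℤ_[p] E) (hR : R = integralClosure ℤ_[p] E)
    (hunram : (Ideal.span {(p : R)}).IsMaximal)
    (σ : E ≃ₐ[ℚ_[p]] E) (hσ : σ ≠ 1)
    (J : Matrix (Fin 4) (Fin 4) E)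
    (hJ : J = !![0, 0, -1, 0; 0, 0, 0, -1; 1, 0, 0, 0; 0, 1, 0, 0])
    (𝒦 : Set (Matrix (Fin 4) (Fin 4) E))
    (h𝒦 : 𝒦 = {g | g * J * (Matrix.of fun i j => σ (g j i)) = J ∧ ∀ i j, g i j ∈ R})
    (D : Matrix (Fin 4) (Fin 4) E)
    (hD : D = Matrix.diagonal ![1, 1, (p : E), (p : E)]) :
    ∃ T : Finset (Matrix (Fin 4) (Fin 4) E),
      T.card = p ^ 4 + p ^ 3 + p + 1 ∧
      𝒦 * {D} * 𝒦 = ⋃ t ∈ (T : Set (Matrix (Fin 4) (Fin 4) E)), 𝒦 * {t} ∧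
      (T : Set (Matrix (Fin 4) (Fin 4) E)).PairwiseDisjoint (fun t => 𝒦 * {t}) := by
  classical
  subst hR
  obtain ⟨hinv, hfixed⟩ := quadratic_involutive h2 hσ
  have hmem : ∀ x : integralClosure ℤ_[p] E, σ x ∈ integralClosure ℤ_[p] E :=
    fun x => IsIntegral.map (σ.toAlgHom.restrictScalars ℤ_[p]) x.2
  let τ : integralClosure ℤ_[p] E →+* integralClosure ℤ_[p] E :=
    ((σ : E →+* E).comp (integralClosure ℤ_[p] E).val.toRingHom).codRestrict _ hmem
  have hτ : Function.Involutive τ := fun x => Subtype.ext (hinv x)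
  let : StarRing (integralClosure ℤ_[p] E) := starRingOfInvolutive τ hτ
  have hchar : CharZero E := charZero_of_injective_algebraMap (algebraMap ℚ_[p] E).injective
  have hp : p.Prime := Fact.out
  obtain ⟨T, hT, hTU, hTd⟩ := exists_finset_coset_reps hp hodd
    (fun h => hp.ne_zero (by exact_mod_cast congrArg Subtype.val h)) hunram
    (card_quotient_integralClosure h2)
    (fun x hx => exists_dvd_sub_natCast (hfixed _ (congrArg Subtype.val hx)))
  let ι : Matrix (Fin 4) (Fin 4) (integralClosure ℤ_[p] E) →+* Matrix (Fin 4) (Fin 4) E :=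
    (integralClosure ℤ_[p] E).val.toRingHom.mapMatrix
  have hι : Function.Injective ι := Matrix.map_injective Subtype.val_injective
  have hιJ : ι (skewForm _) = J := by
    rw [hJ]
    ext i j
    fin_cases i <;> fin_cases j <;> simp [ι, skewForm]
  have hιD : ι (diagonal ![1, 1, (p : integralClosure ℤ_[p] E), p]) = D := by
    rw [hD]
    ext i j
    fin_cases i <;> fin_cases j <;> simp [ι]
  have hιK : 𝒦 = ι '' similitudes 1 := by
    have hconj : ∀ g, Matrix.of (fun i j => σ (ι g j i)) = ι gᴴ := fun g => rfl
    rw [h𝒦]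
    ext g
    constructor
    · rintro ⟨h, hg⟩
      obtain ⟨g, rfl⟩ : ∃ g', g = ι g' := ⟨Matrix.of fun i j => ⟨g i j, hg i j⟩, rfl⟩
      refine ⟨g, hι ?_, rfl⟩
      rw [hconj, ← hιJ, ← map_mul, ← map_mul] at h
      rw [h, one_smul]
    · rintro ⟨g, hg, rfl⟩
      refine ⟨?_, fun i j => (g i j).2⟩
      rw [hconj, ← hιJ, ← map_mul, ← map_mul, mem_similitudes.mp hg, one_smul]
  have hcoset : ∀ t, 𝒦 * {ι t} = ι '' (similitudes 1 * {t}) := fun t => by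
    rw [Set.image_mul, Set.image_singleton, hιK]
  refine ⟨T.image ι, by rw [Finset.card_image_of_injective _ hι, hT], ?_, ?_⟩
  · rw [← hιD, hcoset, hιK, ← Set.image_mul, hTU, Set.image_iUnion₂,
      Finset.coe_image, Set.biUnion_image, ← hιK]
    exact Set.iUnion₂_congr fun t _ => (hcoset t).symm
  · rw [Finset.coe_image]
    rintro _ ⟨s, hs, rfl⟩ _ ⟨t, ht, rfl⟩ hst
    simp only [Function.onFun, hcoset]
    exact (Set.disjoint_image_iff hι).mpr (hTd hs ht fun h => hst (congrArg ι h))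
end

section
/- Let K be an imaginary quadratic field with ring of integers O_K, n ≥ 1, J = [[0,−I_n],[I_n,0]], and U_n(ℤ) = {A ∈ GL_{2n}(O_K) : A J Ā^t = J} the integral points of the quasi-split unitary group. Then det U_n(ℤ) = {u² : u ∈ O_K^×}, i.e., the determinants of elements of U_n(ℤ) are exactly the squares of units of O_K. -/
open Matrix NumberField

section Involution

variable {O : Type*} [CommRing O] [CharZero O] (s : O →+* O)

/-- In a ring with a positive definite integral involution `s`, the differences `x - s x` are the
integer multiples of a single one of them. -/
theorem exists_generator_sub_involution (hs : ∀ x, s (s x) = x)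
    (hfix : ∀ x, s x = x → ∃ m : ℤ, (m : O) = x)
    (hpos : ∀ x, x ≠ 0 → ∃ m : ℤ, 0 < m ∧ (m : O) = x * s x)
    (hne : ∃ x, s x ≠ x) :
    ∃ θ, θ - s θ ≠ 0 ∧ ∀ x, ∃ k : ℤ, x - s x = k * (θ - s θ) := by
  classical
  have hex : ∃ m : ℕ, 0 < m ∧ ∃ θ, θ - s θ ≠ 0 ∧ (m : O) = (θ - s θ) * s (θ - s θ) := by
    obtain ⟨x, hx⟩ := hne
    have hx' : x - s x ≠ 0 := fun h => hx (sub_eq_zero.mp h).symm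
    obtain ⟨m, hm, hmx⟩ := hpos _ hx'
    lift m to ℕ using hm.le
    exact ⟨m, by exact_mod_cast hm, x, hx', by simpa using hmx⟩
  obtain ⟨hm0, θ, hθ, hm⟩ := Nat.find_spec hex
  have hmin : ∀ k : ℕ, (0 < k ∧ ∃ θ, θ - s θ ≠ 0 ∧ (k : O) = (θ - s θ) * s (θ - s θ)) →
      Nat.find hex ≤ k := fun k hk => Nat.find_min' hex hk
  generalize Nat.find hex = m at hm0 hm hmin
  refine ⟨θ, hθ, fun x => ?_⟩
  obtain ⟨j, hj⟩ := hfix ((x - s x) * s (θ - s θ)) (by simp only [map_mul, map_sub, hs]; ring)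
  refine ⟨j / m, ?_⟩
  by_contra hcon
  set k : ℤ := j / m with hk
  have hy : (x - k * θ) - s (x - k * θ) ≠ 0 := by
    intro h
    apply hcon
    simp only [map_sub, map_mul, map_intCast] at h
    linear_combination h
  obtain ⟨q, hq0, hq⟩ := hpos _ hy
  have hqm : (m : ℤ) ≤ q := by
    lift q to ℕ using hq0.le
    exact_mod_cast hmin q ⟨by exact_mod_cast hq0, _, hy, by simpa using hq⟩
  have hm' : (0 : ℤ) < m := by exact_mod_cast hm0
  have hr0 : 0 ≤ j - k * m := by
    have := Int.emod_nonneg j hm'.ne'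
    rw [Int.emod_def] at this; rw [hk]; linarith
  have hr1 : j - k * m < m := by
    have := Int.emod_lt_of_pos j hm'
    rw [Int.emod_def] at this; rw [hk]; linarith
  have key : ((j - k * m) ^ 2 : ℤ) = q * m := by
    have : (((j - k * m) ^ 2 : ℤ) : O) = ((q * m : ℤ) : O) := by
      push_cast
      rw [hj, hq, hm]
      simp only [map_sub, map_mul, map_intCast, hs]
      ring
    exact_mod_cast this
  nlinarith

/-- An element of norm one that is congruent to one modulo the different is the square of a
unit. -/
theorem exists_unit_sq_eq_of_sub_one_mem [IsDomain O] (hs : ∀ x, s (s x) = x)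
    (hfix : ∀ x, s x = x → ∃ m : ℤ, (m : O) = x)
    (hpos : ∀ x, x ≠ 0 → ∃ m : ℤ, 0 < m ∧ (m : O) = x * s x)
    (hne : ∃ x, s x ≠ x) {d : O} (hd : d * s d = 1)
    (hmem : d - 1 ∈ Ideal.span (Set.range fun x => x - s x)) :
    ∃ u : Oˣ, d = (u : O) ^ 2 := by
  obtain ⟨θ, hθ, hgen⟩ := exists_generator_sub_involution s hs hfix hpos hne
  have hnonneg : ∀ x, ∃ m : ℤ, 0 ≤ m ∧ (m : O) = x * s x := fun x => by
    by_cases hx : x = 0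
    · exact ⟨0, le_rfl, by simp [hx]⟩
    · obtain ⟨m, hm, h⟩ := hpos x hx
      exact ⟨m, hm.le, h⟩
  have hle : Ideal.span (Set.range fun x => x - s x) ≤ Ideal.span {θ - s θ} := by
    rw [Ideal.span_le]
    rintro _ ⟨x, rfl⟩
    obtain ⟨k, hk⟩ := hgen x
    exact Ideal.mem_span_singleton'.mpr ⟨k, hk.symm⟩
  obtain ⟨z, hz⟩ := Ideal.mem_span_singleton'.mp (hle hmem)
  obtain ⟨T, hT⟩ := hfix (θ + s θ) (by simp only [map_add, hs]; ring)
  obtain ⟨P, hP⟩ := hfix (θ * s θ) (by simp only [map_mul, hs]; ring)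
  obtain ⟨t, ht⟩ := hfix (d + s d) (by simp only [map_add, hs]; ring)
  obtain ⟨m, hm0, hm⟩ := hpos _ hθ
  obtain ⟨w, hw0, hw⟩ := hnonneg z
  obtain ⟨p, hp0, hp⟩ := hnonneg (1 + d)
  have e1 : m = 4 * P - T ^ 2 := by
    have : (m : O) = ((4 * P - T ^ 2 : ℤ) : O) := by
      push_cast
      rw [hm, hT, hP]; simp only [map_sub, hs]; ring
    exact_mod_cast this
  have e2 : 2 - t = w * m := by
    have hz' : s z * (s θ - θ) = s d - 1 := by
      have := congrArg s hz
      simpa only [map_mul, map_sub, map_one, hs] using this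
    have : ((2 - t : ℤ) : O) = ((w * m : ℤ) : O) := by
      push_cast
      rw [ht, hw, hm]; simp only [map_sub, hs]
      linear_combination (-1 : O) * hd - (s z * (s θ - θ)) * hz - (d - 1) * hz'
    exact_mod_cast this
  have e3 : p = 2 + t := by
    have : (p : O) = ((2 + t : ℤ) : O) := by
      push_cast
      rw [hp, ht]; simp only [map_add, map_one]; linear_combination hd
    exact_mod_cast this
  have hm3 : 3 ≤ m := by
    rcases Int.even_or_odd' T with ⟨c, rfl | rfl⟩ <;> ring_nf at e1 <;> omega
  have hwm : w * m ≤ 4 := by omega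
  have hw1 : w ≤ 1 := by nlinarith
  obtain rfl | rfl : w = 0 ∨ w = 1 := by omega
  · have hz0 : z * s z = 0 := by rw [← hw]; simp
    have hz0 : z = 0 := by
      rcases mul_eq_zero.mp hz0 with h | h
      · exact h
      · rw [← hs z, h, map_zero]
    refine ⟨1, ?_⟩
    rw [hz0, zero_mul] at hz
    simp only [Units.val_one, one_pow]
    linear_combination -hz
  obtain rfl | rfl : m = 3 ∨ m = 4 := by omega
  · have ht' : t = -1 := by omega
    subst ht'
    push_cast at ht
    have h3 : d ^ 2 + d + 1 = 0 := by linear_combination (-d) * ht - hd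
    refine ⟨⟨d ^ 2, d, ?_, ?_⟩, ?_⟩
    · linear_combination (d - 1) * h3
    · linear_combination (d - 1) * h3
    · show d = (d ^ 2) ^ 2
      linear_combination -(d ^ 2 - d) * h3
  · have ht' : t = -2 := by omega
    subst ht'
    push_cast at ht
    have hd1 : d = -1 := by
      have : (d + 1) ^ 2 = 0 := by linear_combination (-d) * ht - hd
      exact eq_neg_of_add_eq_zero_left (pow_eq_zero_iff two_ne_zero |>.mp this)
    obtain ⟨c, rfl | rfl⟩ := Int.even_or_odd' T
    · have hPc : P = c ^ 2 + 1 := by ring_nf at e1; omega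
      subst hPc
      push_cast at hT hP
      have hu : (θ - c) ^ 2 = -1 := by linear_combination (-θ) * hT + hP
      refine ⟨⟨θ - c, -(θ - c), ?_, ?_⟩, ?_⟩
      · linear_combination -hu
      · linear_combination -hu
      · show d = (θ - c) ^ 2
        rw [hu, hd1]
    · ring_nf at e1; omega

/-- The determinant of a matrix that is unitary for the standard skew-hermitian form is congruent
to one modulo the ideal generated by the differences `x - s x`. -/
theorem det_sub_one_mem_of_mul_J_mul {R l : Type*} [CommRing R] [Fintype l] [DecidableEq l]
    (s : R →+* R) (A : Matrix (l ⊕ l) (l ⊕ l) R) (hA : A * J l R * (A.map s)ᵀ = J l R) :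
    A.det - 1 ∈ Ideal.span (Set.range fun x => x - s x) := by
  set I := Ideal.span (Set.range fun x => x - s x)
  let π := Ideal.Quotient.mk I
  have hπ : ∀ x, π (s x) = π x := fun x => by
    have hx : x - s x ∈ I := Ideal.subset_span ⟨x, rfl⟩
    exact ((Ideal.Quotient.mk_eq_mk_iff_sub_mem _ _).mpr hx).symm
  have hB : A.map π ∈ symplecticGroup l (R ⧸ I) := by
    rw [SymplecticGroup.mem_iff]
    have h := congrArg (fun M => M.map π) hA
    have hmap : ((A.map s)ᵀ).map π = (A.map π)ᵀ := by
      ext i j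
      simp [hπ]
    simpa only [Matrix.map_mul, hmap, map_J] using h
  have h1 := SymplecticGroup.det_eq_one hB
  rw [← Ideal.Quotient.mk_eq_mk_iff_sub_mem, map_one]
  exact (RingHom.map_det π A).trans h1

end Involution

section ImaginaryQuadratic

variable {F : Type*} [Field F] [NumberField F]

/-- A nontrivial automorphism of an imaginary quadratic field is complex conjugation under every
embedding. -/
theorem embedding_apply_eq_conj (h2 : Module.finrank ℚ F = 2)
    (himag : ∀ v : InfinitePlace F, v.IsComplex) (σ : F ≃ₐ[ℚ] F) (hσ : σ ≠ 1)
    (φ : F →+* ℂ) (x : F) : φ (σ x) = starRingEnd ℂ (φ x) := by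
  classical
  have hφ : ComplexEmbedding.conjugate φ ≠ φ := by
    have h := InfinitePlace.isComplex_mk_iff.mp (himag (InfinitePlace.mk φ))
    exact fun h' => h (ComplexEmbedding.isReal_iff.mpr h')
  have hσφ : φ.comp (σ : F →+* F) ≠ φ := fun h => hσ <| by
    ext y
    exact φ.injective (RingHom.congr_fun h y)
  have hcard : Fintype.card (F →+* ℂ) = 2 := by rw [Embeddings.card, h2]
  have heq : φ.comp (σ : F →+* F) = ComplexEmbedding.conjugate φ := by
    by_contra hne
    have h3 : ({φ, φ.comp (σ : F →+* F), ComplexEmbedding.conjugate φ} :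
        Finset (F →+* ℂ)).card = 3 :=
      Finset.card_eq_three.mpr ⟨_, _, _, hσφ.symm, hφ.symm, hne, rfl⟩
    have := Finset.card_le_univ ({φ, φ.comp (σ : F →+* F), ComplexEmbedding.conjugate φ} :
        Finset (F →+* ℂ))
    omega
  exact RingHom.congr_fun heq x

/-- An algebraic integer in a quadratic field fixed by a nontrivial automorphism is a rational
integer. -/
theorem exists_int_eq_of_fixed (h2 : Module.finrank ℚ F = 2) (σ : F ≃ₐ[ℚ] F) (hσ : σ ≠ 1)
    (x : 𝓞 F) (hx : σ x = x) : ∃ m : ℤ, (m : 𝓞 F) = x := by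
  have hsimple : IsSimpleOrder (IntermediateField ℚ F) :=
    IntermediateField.isSimpleOrder_of_finrank_prime ℚ F (h2 ▸ Nat.prime_two)
  have hmem : (x : F) ∈ IntermediateField.fixedField (Subgroup.zpowers σ) := by
    rintro ⟨g, hg⟩
    have hle : Subgroup.zpowers σ ≤ MulAction.stabilizer (F ≃ₐ[ℚ] F) (x : F) := by
      rw [Subgroup.zpowers_le]
      exact hx
    exact hle hg
  have hbot : IntermediateField.fixedField (Subgroup.zpowers σ) = ⊥ := by
    refine (eq_bot_or_eq_top _).resolve_right fun h => hσ ?_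
    ext y
    have hy : y ∈ IntermediateField.fixedField (Subgroup.zpowers σ) := h ▸ trivial
    exact hy ⟨σ, Subgroup.mem_zpowers σ⟩
  rw [hbot, IntermediateField.mem_bot] at hmem
  obtain ⟨q, hq⟩ := hmem
  have hint : IsIntegral ℤ q := by
    have : IsIntegral ℤ (x : F) := x.isIntegral_coe
    rw [← hq] at this
    exact (isIntegral_algebraMap_iff (algebraMap ℚ F).injective).mp this
  obtain ⟨m, hm⟩ := IsIntegrallyClosed.isIntegral_iff.mp hint
  refine ⟨m, RingOfIntegers.ext ?_⟩
  rw [← hq, ← hm]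
  simp

end ImaginaryQuadratic

/-- Theorem of Hel Braun: for an imaginary quadratic field `F`, the determinants of the
elements of the integral quasi-split unitary group `U_n(ℤ) = {A ∈ GL_{2n}(𝓞 F) : A J Āᵗ = J}`
are exactly the squares of units of `𝓞 F`. -/
theorem stmt_13 (F : Type*) [Field F] [NumberField F]
    (h2 : Module.finrank ℚ F = 2)
    (himag : ∀ v : InfinitePlace F, v.IsComplex)
    (σ : F ≃ₐ[ℚ] F) (hσ : σ ≠ 1)
    (n : ℕ) (hn : 1 ≤ n) :
    {d : 𝓞 F | ∃ A : Matrix (Fin n ⊕ Fin n) (Fin n ⊕ Fin n) (𝓞 F),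
        IsUnit A ∧
        A * Matrix.fromBlocks 0 (-1) 1 0 * ((A.map ⇑(galRestrict ℤ ℚ F (𝓞 F) σ))ᵀ)
          = Matrix.fromBlocks 0 (-1) 1 0 ∧
        A.det = d}
      = {d : 𝓞 F | ∃ u : (𝓞 F)ˣ, d = (u : 𝓞 F) ^ 2} := by
  set τ := galRestrict ℤ ℚ F (𝓞 F) σ
  let s : 𝓞 F →+* 𝓞 F := (τ : 𝓞 F →+* 𝓞 F)
  have hcoe : ∀ x : 𝓞 F, ((s x : 𝓞 F) : F) = σ x := fun x =>
    algebraMap_galRestrict_apply ℤ σ x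
  obtain ⟨φ⟩ : Nonempty (F →+* ℂ) := inferInstance
  have hconj := embedding_apply_eq_conj h2 himag σ hσ φ
  have hs : ∀ x, s (s x) = x := fun x => RingOfIntegers.ext <| φ.injective <| by
    rw [hcoe, hconj, hcoe, hconj, Complex.conj_conj]
  have hfix : ∀ x, s x = x → ∃ m : ℤ, (m : 𝓞 F) = x := fun x hx =>
    exists_int_eq_of_fixed h2 σ hσ x (by rw [← hcoe, hx])
  have hpos : ∀ x, x ≠ 0 → ∃ m : ℤ, 0 < m ∧ (m : 𝓞 F) = x * s x := fun x hx => by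
    obtain ⟨m, hm⟩ := hfix (x * s x) (by rw [map_mul, hs, mul_comm])
    refine ⟨m, ?_, hm⟩
    have h : (m : ℂ) = (Complex.normSq (φ x) : ℂ) := by
      rw [← Complex.mul_conj, ← hconj, ← hcoe, ← map_mul, ← map_mul, ← hm]
      simp
    have hm' : (m : ℝ) = Complex.normSq (φ x) := by exact_mod_cast h
    have : 0 < Complex.normSq (φ x) := Complex.normSq_pos.mpr <|
      (map_ne_zero φ).mpr (RingOfIntegers.coe_ne_zero_iff.mpr hx)
    rw [← hm'] at this
    exact_mod_cast this
  have hne : ∃ x, s x ≠ x := by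
    by_contra! h
    refine hσ ((map_eq_one_iff _ (galRestrict ℤ ℚ F (𝓞 F)).injective).mp ?_)
    ext1 x
    exact h x
  ext d
  constructor
  · rintro ⟨A, -, hA, rfl⟩
    have hA' : A * J (Fin n) (𝓞 F) * (A.map s)ᵀ = J (Fin n) (𝓞 F) := hA
    refine exists_unit_sq_eq_of_sub_one_mem s hs hfix hpos hne ?_
      (det_sub_one_mem_of_mul_J_mul s A hA')
    have hdet := congrArg det hA'
    have hsA : (A.map s).det = s A.det := (RingHom.map_det s A).symm
    rw [det_mul, det_mul, det_transpose, hsA] at hdet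
    refine (isUnit_det_J (Fin n) (𝓞 F)).mul_left_cancel ?_
    linear_combination hdet
  · rintro ⟨u, rfl⟩
    have hu : (u : 𝓞 F) * s u = 1 := by
      obtain ⟨m, hm0, hm⟩ := hpos u u.ne_zero
      obtain ⟨k, hk0, hk⟩ := hpos (u⁻¹ : (𝓞 F)ˣ) (u⁻¹).ne_zero
      have hmk : m * k = 1 := by
        have : ((m * k : ℤ) : 𝓞 F) = ((1 : ℤ) : 𝓞 F) := by
          push_cast
          rw [hm, hk, mul_mul_mul_comm, ← map_mul, Units.mul_inv, map_one, one_mul]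
        exact_mod_cast this
      rw [← hm, Int.eq_one_of_mul_eq_one_right hm0.le hmk, Int.cast_one]
    let g : Fin n → 𝓞 F := Pi.mulSingle ⟨0, hn⟩ (u : 𝓞 F)
    have hg : ∀ i, g i * s (g i) = 1 := fun i => by
      by_cases hi : i = ⟨0, hn⟩
      · subst hi
        simpa [g] using hu
      · simp [g, Pi.mulSingle_eq_of_ne hi]
    have hprod : ∏ i, g i = u := Fintype.prod_pi_mulSingle' _ _
    have hdet : (fromBlocks (diagonal g) 0 0 (diagonal g)).det = (u : 𝓞 F) ^ 2 := by
      rw [det_fromBlocks_zero₂₁, det_diagonal, hprod, sq]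
    refine ⟨fromBlocks (diagonal g) 0 0 (diagonal g), ?_, ?_, hdet⟩
    · rw [isUnit_iff_isUnit_det, hdet]
      exact u.isUnit.pow 2
    · have hg' : diagonal g * diagonal (fun i => τ (g i)) = 1 := by
        rw [diagonal_mul_diagonal, ← diagonal_one]
        exact congrArg diagonal (funext hg)
      have hmap : (diagonal g).map τ = diagonal (fun i => τ (g i)) :=
        diagonal_map (map_zero τ)
      have h0 : (0 : Matrix (Fin n) (Fin n) (𝓞 F)).map τ = 0 := by ext1; simp
      rw [fromBlocks_map, hmap, h0, fromBlocks_transpose, fromBlocks_multiply,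
        fromBlocks_multiply]
      simp only [zero_mul, mul_zero, add_zero, zero_add, mul_one, mul_neg, neg_mul, neg_zero, hg',
        transpose_zero, diagonal_transpose]
end

section
/- Let χ be a Dirichlet character of conductor f > 1 and n ≥ 1 an integer. Then f · B_{n,χ} lies in ℤ[χ], the ring generated over ℤ by the values of χ; i.e., the generalized Bernoulli number B_{n,χ} becomes an algebraic integer after multiplication by the conductor f. Consequently, for any prime ℓ ∤ f, the special value L(1−n, χ) = −B_{n,χ}/n is ℓ-integral whenever ℓ ∤ n. -/
open Finset Polynomial

namespace Polynomial

theorem iterate_derivative_bernoulli (m k : ℕ) :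
    derivative^[k] (bernoulli m) = (m.descFactorial k : ℚ[X]) * bernoulli (m - k) := by
  induction k with
  | zero => simp
  | succ k ih =>
    rw [Function.iterate_succ_apply', ih, Nat.descFactorial_succ]
    simp only [derivative_mul, derivative_natCast, derivative_bernoulli, Nat.sub_sub]
    push_cast
    ring

theorem hasseDeriv_bernoulli (m k : ℕ) :
    hasseDeriv k (bernoulli m) = (m.choose k : ℚ[X]) * bernoulli (m - k) := by
  have h := congrFun (factorial_smul_hasseDeriv (R := ℚ) k) (bernoulli m)
  rw [iterate_derivative_bernoulli, Nat.descFactorial_eq_factorial_mul_choose] at h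
  have hk : (k.factorial : ℚ[X]) ≠ 0 := by exact_mod_cast k.factorial_ne_zero
  apply mul_left_cancel₀ hk
  simpa [nsmul_eq_mul, mul_assoc] using h

theorem natDegree_bernoulli_le (m : ℕ) : (bernoulli m).natDegree ≤ m := by
  rw [natDegree_le_iff_coeff_eq_zero]
  intro i hi
  rw [coeff_bernoulli, if_neg (by omega)]

/-- The addition formula for Bernoulli polynomials. -/
theorem bernoulli_eval_add (m : ℕ) (x y : ℚ) :
    (bernoulli m).eval (y + x) =
      ∑ k ∈ range (m + 1), m.choose k * (bernoulli (m - k)).eval x * y ^ k := by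
  rw [← taylor_eval, eval_eq_sum_range' (n := m + 1)]
  · refine sum_congr rfl fun k _ => ?_
    rw [taylor_coeff, hasseDeriv_bernoulli]
    simp
  · rw [natDegree_taylor]
    exact Nat.lt_succ_of_le (natDegree_bernoulli_le m)

theorem sum_range_add_pow_eq_bernoulli_sub (n N : ℕ) (x : ℚ) :
    (n + 1) * ∑ j ∈ range N, (x + j) ^ n =
      (bernoulli (n + 1)).eval (N + x) - (bernoulli (n + 1)).eval x := by
  induction N with
  | zero => simp
  | succ N ih =>
    have h := bernoulli_eval_one_add (n + 1) (N + x)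
    have e : ((N + 1 : ℕ) : ℚ) + x = 1 + (N + x) := by push_cast; ring
    rw [sum_range_succ, mul_add, ih, e, h]
    simp only [Nat.add_sub_cancel]
    push_cast
    ring

theorem sum_range_add_pow (n N : ℕ) (x : ℚ) :
    ∑ j ∈ range N, (x + j) ^ n =
      ∑ i ∈ range (n + 1), n.choose i * (N ^ (i + 1) / (i + 1)) * (bernoulli (n - i)).eval x := by
  have hn : (n + 1 : ℚ) ≠ 0 := by positivity
  apply mul_left_cancel₀ hn
  rw [sum_range_add_pow_eq_bernoulli_sub, bernoulli_eval_add, sum_range_succ', mul_sum]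
  simp only [Nat.choose_zero_right, Nat.sub_zero, pow_zero, Nat.cast_one, one_mul, mul_one,
    add_sub_cancel_right, Nat.add_sub_add_right]
  refine sum_congr rfl fun i _ => ?_
  have hc : (n + 1 : ℚ) * n.choose i = (n + 1).choose (i + 1) * (i + 1) := by
    exact_mod_cast Nat.add_one_mul_choose_eq n i
  have hi : (i + 1 : ℚ) ≠ 0 := by positivity
  field_simp
  linear_combination (-(bernoulli (n - i)).eval x * N ^ (i + 1)) * hc

end Polynomial

theorem ZMod.sum_range_natCast {M : Type*} [AddCommMonoid M] (m : ℕ) [NeZero m] (g : ZMod m → M) :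
    ∑ a ∈ range m, g a = ∑ b, g b := by
  refine sum_bij' (fun a _ => (a : ZMod m)) (fun b _ => b.val) ?_ ?_ ?_ ?_ ?_
  · simp
  · intro b _
    exact mem_range.2 b.val_lt
  · intro a ha
    exact ZMod.val_cast_of_lt (mem_range.1 ha)
  · simp
  · simp

/-- Power sums over an arithmetic progression of length `p` whose difference is prime to `p` do not
depend on the initial term modulo `p`. -/
theorem dvd_sum_add_mul_pow_sub {p f : ℕ} (hp : p.Prime) (hpf : ¬ p ∣ f) (n a : ℕ) :
    (p : ℤ) ∣ ∑ j ∈ range p, ((a : ℤ) + j * f) ^ n - ∑ j ∈ range p, (j : ℤ) ^ n := by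
  have := Fact.mk hp
  rw [← ZMod.intCast_zmod_eq_zero_iff_dvd _ p]
  push_cast
  have hf : (f : ZMod p) ≠ 0 := by rwa [Ne, ZMod.natCast_eq_zero_iff]
  rw [ZMod.sum_range_natCast p fun b => ((a : ZMod p) + b * f) ^ n,
    ZMod.sum_range_natCast p fun b => b ^ n, sub_eq_zero]
  exact ((Equiv.mulRight₀ (f : ZMod p) hf).trans (Equiv.addLeft (a : ZMod p))).sum_comp
    fun b => b ^ n

namespace Subring

/-- The elements `x` of a field such that `u * x ∈ R` for some `u` prime to `p`. -/
def integralAt {K : Type*} [Field K] (R : Subring K) (p : ℕ) (hp : p.Prime) : Subring K where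
  carrier := {x | ∃ u : ℕ, ¬ p ∣ u ∧ u * x ∈ R}
  mul_mem' := by
    rintro x y ⟨u, hu, hx⟩ ⟨v, hv, hy⟩
    refine ⟨u * v, hp.not_dvd_mul hu hv, ?_⟩
    have e : ((u * v : ℕ) : K) * (x * y) = (u * x) * (v * y) := by push_cast; ring
    exact e ▸ R.mul_mem hx hy
  one_mem' := ⟨1, hp.not_dvd_one, by simp⟩
  add_mem' := by
    rintro x y ⟨u, hu, hx⟩ ⟨v, hv, hy⟩
    refine ⟨u * v, hp.not_dvd_mul hu hv, ?_⟩
    have e : ((u * v : ℕ) : K) * (x + y) = v * (u * x) + u * (v * y) := by push_cast; ring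
    exact e ▸ R.add_mem (R.mul_mem (natCast_mem R v) hx) (R.mul_mem (natCast_mem R u) hy)
  zero_mem' := ⟨1, hp.not_dvd_one, by simp⟩
  neg_mem' := by
    rintro x ⟨u, hu, hx⟩
    exact ⟨u, hu, by simpa using hx⟩

variable {K : Type*} [Field K] {R : Subring K}

theorem le_integralAt {p : ℕ} (hp : p.Prime) : R ≤ R.integralAt p hp :=
  fun x hx => ⟨1, hp.not_dvd_one, by simpa using hx⟩

theorem mem_of_forall_mem_integralAt {x : K}
    (h : ∀ (p : ℕ) (hp : p.Prime), x ∈ R.integralAt p hp) : x ∈ R := by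
  have key (u : ℕ) : addOrderOf (x : K ⧸ R.toAddSubgroup) ∣ u ↔ u * x ∈ R := by
    rw [addOrderOf_dvd_iff_nsmul_eq_zero, ← QuotientAddGroup.mk_nsmul, QuotientAddGroup.eq_zero_iff,
      nsmul_eq_mul]
    rfl
  have h1 : addOrderOf (x : K ⧸ R.toAddSubgroup) = 1 := by
    rw [Nat.eq_one_iff_not_exists_prime_dvd]
    intro p hp hpx
    obtain ⟨u, hu, hx⟩ := h p hp
    exact hu (hpx.trans ((key u).2 hx))
  simpa using (key 1).1 h1.dvd

theorem pow_div_mem_integralAt [CharZero K] {p m : ℕ} (hp : p.Prime) (hm : p ∣ m) (i : ℕ) :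
    (m : K) ^ i / (i + 1) ∈ R.integralAt p hp := by
  obtain ⟨v, u, hu, hi⟩ := Nat.exists_eq_pow_mul_and_not_dvd i.succ_ne_zero p hp.ne_one
  have hv : v ≤ i := by
    have h1 : p ^ v ≤ i + 1 := Nat.le_of_dvd i.succ_pos ⟨u, hi⟩
    have h2 : v < p ^ v := Nat.lt_pow_self hp.one_lt
    omega
  obtain ⟨w, hw⟩ : p ^ v ∣ m ^ i := (pow_dvd_pow p hv).trans (pow_dvd_pow_of_dvd hm i)
  refine ⟨u, hu, ?_⟩
  have hi' : (i + 1 : K) = p ^ v * u := by exact_mod_cast hi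
  have hw' : (m : K) ^ i = p ^ v * w := by exact_mod_cast hw
  have hne : (p ^ v * u : K) ≠ 0 := hi' ▸ i.cast_add_one_ne_zero
  have e : (u : K) * (m ^ i / (i + 1)) = w := by
    rw [hi', hw', mul_div_assoc', div_eq_iff hne]
    ring
  exact e ▸ natCast_mem R w

end Subring

/-- The twisted Bernoulli sum `f ^ n * ∑ a < f, ψ a * Bₙ(a / f)`; for a Dirichlet character `ψ` of
modulus `f` it is `f` times the generalized Bernoulli number. -/
noncomputable def twistedBernoulli (f : ℕ) (ψ : ℕ → ℂ) (n : ℕ) : ℂ :=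
  (f : ℂ) ^ n * ∑ a ∈ range f, ψ a * (((Polynomial.bernoulli n).eval ((a : ℚ) / f) : ℚ) : ℂ)

/-- Twisted power sums in terms of twisted Bernoulli sums. -/
theorem sum_mul_sum_add_mul_pow {f : ℕ} (hf : f ≠ 0) (ψ : ℕ → ℂ) (n N : ℕ) :
    ∑ a ∈ range f, ψ a * ∑ j ∈ range N, ((a : ℂ) + j * f) ^ n =
      N * ∑ i ∈ range (n + 1),
        n.choose i * (((f * N : ℕ) : ℂ) ^ i / (i + 1)) * twistedBernoulli f ψ (n - i) := by
  have hf' : (f : ℂ) ≠ 0 := Nat.cast_ne_zero.2 hf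
  have inner (a : ℕ) : ∑ j ∈ range N, ((a : ℂ) + j * f) ^ n =
      (f : ℂ) ^ n * ∑ i ∈ range (n + 1), n.choose i * (N ^ (i + 1) / (i + 1)) *
        (((Polynomial.bernoulli (n - i)).eval ((a : ℚ) / f) : ℚ) : ℂ) := by
    have h := congrArg (Rat.cast : ℚ → ℂ) (sum_range_add_pow n N ((a : ℚ) / f))
    push_cast at h
    rw [← h, mul_sum]
    refine sum_congr rfl fun j _ => ?_
    rw [← mul_pow]
    congr 1
    field_simp
  simp only [inner, twistedBernoulli, mul_sum]
  rw [sum_comm]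
  refine sum_congr rfl fun i hi => sum_congr rfl fun a _ => ?_
  have e : (f : ℂ) ^ n = f ^ i * f ^ (n - i) := by
    rw [← pow_add, Nat.add_sub_cancel' (Nat.lt_succ_iff.1 (mem_range.1 hi))]
  rw [e]
  push_cast
  ring

theorem twistedBernoulli_mem_integralAt {R : Subring ℂ} {f N p : ℕ} (hf : f ≠ 0) (hN : N ≠ 0)
    (hp : p.Prime) (hpN : p ∣ f * N) (ψ : ℕ → ℂ)
    (hS : ∀ n, ∃ s ∈ R, ∑ a ∈ range f, ψ a * ∑ j ∈ range N, ((a : ℂ) + j * f) ^ n = N * s)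
    (n : ℕ) : twistedBernoulli f ψ n ∈ R.integralAt p hp := by
  induction n using Nat.strong_induction_on with
  | _ n ih =>
    obtain ⟨s, hs, h⟩ := hS n
    rw [sum_mul_sum_add_mul_pow hf] at h
    have h := mul_left_cancel₀ (Nat.cast_ne_zero.2 hN) h
    rw [sum_range_succ'] at h
    simp only [Nat.choose_zero_right, pow_zero, Nat.cast_zero, Nat.cast_one, zero_add, div_one,
      one_mul, Nat.sub_zero] at h
    rw [eq_sub_of_add_eq' h]
    refine sub_mem (Subring.le_integralAt hp hs) (sum_mem fun i hi => ?_)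
    exact mul_mem (mul_mem (natCast_mem _ _) (Subring.pow_div_mem_integralAt hp hpN _))
      (ih _ (by have := mem_range.1 hi; omega))

theorem twistedBernoulli_mem {R : Subring ℂ} {f : ℕ} (hf : f ≠ 0) (ψ : ℕ → ℂ) (hψ : ∀ a, ψ a ∈ R)
    (hsum : ∑ a ∈ range f, ψ a = 0) (n : ℕ) : twistedBernoulli f ψ n ∈ R := by
  refine Subring.mem_of_forall_mem_integralAt fun p hp => ?_
  by_cases hpf : p ∣ f
  · refine twistedBernoulli_mem_integralAt (N := 1) hf one_ne_zero hp (by simpa using hpf) ψ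
      (fun n => ⟨_, ?_, (one_mul _).symm.trans (by rw [Nat.cast_one])⟩) n
    exact sum_mem fun a _ => mul_mem (hψ a) (sum_mem fun j _ => pow_mem (add_mem (natCast_mem _ _)
      (mul_mem (natCast_mem _ _) (natCast_mem _ _))) _)
  · refine twistedBernoulli_mem_integralAt (N := p) hf hp.ne_zero hp (dvd_mul_left p f) ψ
      (fun n => ?_) n
    choose t ht using dvd_sum_add_mul_pow_sub hp hpf n
    refine ⟨∑ a ∈ range f, ψ a * t a, sum_mem fun a _ => mul_mem (hψ a) (intCast_mem _ _), ?_⟩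
    have h (a : ℕ) : ∑ j ∈ range p, ((a : ℂ) + j * f) ^ n =
        ∑ j ∈ range p, (j : ℂ) ^ n + p * t a := by
      rw [← sub_eq_iff_eq_add']
      exact_mod_cast congrArg (Int.cast : ℤ → ℂ) (ht a)
    simp only [h, mul_add, sum_add_distrib, ← sum_mul, hsum, zero_mul, zero_add]
    rw [mul_sum]
    exact sum_congr rfl fun a _ => mul_left_comm _ _ _

/-- For a Dirichlet character `χ` of conductor `f > 1`, the generalized Bernoulli number
`B_{n,χ} = f^{n-1} Σ_{a=0}^{f-1} χ(a) Bₙ(a/f)` satisfies `f · B_{n,χ} ∈ ℤ[χ]`;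
consequently, for a prime `ℓ ∤ f` with `ℓ ∤ n`, the special value
`L(1-n, χ) = -B_{n,χ}/n` is `ℓ`-integral. -/
theorem stmt_17 (f : ℕ) (hf : 1 < f) (χ : DirichletCharacter ℂ f)
    (hcond : χ.conductor = f)
    (n : ℕ) (hn : 1 ≤ n)
    (B : ℂ)
    (hB : B = (f : ℂ) ^ (n - 1) *
      ∑ a ∈ Finset.range f,
        χ (a : ZMod f) * (((Polynomial.bernoulli n).eval ((a : ℚ) / f) : ℚ) : ℂ)) :
    (f : ℂ) * B ∈ Subring.closure (Set.range fun x : ZMod f => χ x) ∧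
    ∀ ℓ : ℕ, ℓ.Prime → ¬ ℓ ∣ f → ¬ ℓ ∣ n →
      ∃ (u : ℕ) (c : ℂ), 0 < u ∧ ¬ ℓ ∣ u ∧
        c ∈ Subring.closure (Set.range fun x : ZMod f => χ x) ∧
        (u : ℂ) * (-(B / n)) = c := by
  have hf0 : f ≠ 0 := by omega
  have : NeZero f := ⟨hf0⟩
  have hχ : χ ≠ 1 := fun h => by
    rw [DirichletCharacter.eq_one_iff_conductor_eq_one] at h
    omega
  have hfB : (f : ℂ) * B = twistedBernoulli f (fun a => χ a) n := by
    rw [hB, twistedBernoulli, ← mul_assoc, ← pow_succ', Nat.sub_add_cancel hn]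
  have hmem : (f : ℂ) * B ∈ Subring.closure (Set.range fun x : ZMod f => χ x) := by
    rw [hfB]
    refine twistedBernoulli_mem hf0 _ (fun a => Subring.subset_closure (Set.mem_range_self (a : ZMod f))) ?_ n
    rw [ZMod.sum_range_natCast f fun b => χ b]
    exact MulChar.sum_eq_zero_of_ne_one hχ
  refine ⟨hmem, fun ℓ hℓ hℓf hℓn => ⟨f * n, -(f * B), by positivity, hℓ.not_dvd_mul hℓf hℓn,
    neg_mem hmem, ?_⟩⟩
  have hn0 : (n : ℂ) ≠ 0 := Nat.cast_ne_zero.2 (by omega)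
  push_cast
  field_simp
end
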